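/- (Lenart's bijection.) For v a vexillary permutation, the Edelman–Greene recording-tableau map Q̃ is a bijection from PD(v) onto SSYT_{φ(v)}(λ(v)), the φ(v)-flagged semistandard Young tableaux of shape λ(v). -/

import Mathlib

/- Common definitions for formalizing "Lenart's bijection via bumpless pipe dreams"
   (Gregory–Hamaker). -/

namespace BPDPaper

/-! ### Permutations of the positive integers -/

/-- We model permutations of the positive integers as permutations of `ℕ`
(fixing `0`, with finite support). -/
abbrev Perm' := Equiv.Perm ℕ

/-- The simple transposition `s_a = t_{a,a+1}`. -/
def sT (a : ℕ) : Perm' := Equiv.swap a (a + 1)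

/-- The transposition `t_{ij}`. -/
def tT (i j : ℕ) : Perm' := Equiv.swap i j

/-- The product `s_{a_1} ⋯ s_{a_p}` of a word. -/
def wordProd (l : List ℕ) : Perm' := (l.map sT).prod

/-- `l` is a word for `w` (in the letters `s_1, s_2, …`). -/
def IsWord (w : Perm') (l : List ℕ) : Prop := (∀ x ∈ l, 1 ≤ x) ∧ wordProd l = w

/-- The Coxeter length `ℓ(w)`: the minimal length of a word for `w`. -/
noncomputable def plen (w : Perm') : ℕ :=
  sInf {m | ∃ l : List ℕ, IsWord w l ∧ l.length = m}

/-- `l` is a reduced word for `w`. -/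
def IsReducedWord (w : Perm') (l : List ℕ) : Prop := IsWord w l ∧ l.length = plen w

/-- A permutation of the positive integers: fixes `0` and all but finitely many points. -/
def IsPerm (w : Perm') : Prop := w 0 = 0 ∧ {k | w k ≠ k}.Finite

/-- `k` is a descent of `w`. -/
def Descent (w : Perm') (k : ℕ) : Prop := 1 ≤ k ∧ w (k + 1) < w k

/-- `w` is Grassmannian: at most one descent. -/
def Grassmannian (w : Perm') : Prop := IsPerm w ∧ Set.Subsingleton {k | Descent w k}

/-- `w` is vexillary: no indices `i < j < k < l` with `w j < w i < w l < w k`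
(pattern 2143 avoidance). -/
def Vexillary (w : Perm') : Prop := IsPerm w ∧
  ¬ ∃ i j k l : ℕ, 1 ≤ i ∧ i < j ∧ j < k ∧ k < l ∧ w j < w i ∧ w i < w l ∧ w l < w k

/-- The code `c_i(w) = #{j > i : w j < w i}`. -/
noncomputable def codeOf (w : Perm') (i : ℕ) : ℕ := Nat.card {j : ℕ | i < j ∧ w j < w i}

/-- Insert into a weakly decreasing list, keeping it weakly decreasing. -/
def insDesc (x : ℕ) : List ℕ → List ℕ
  | [] => [x]
  | y :: ys => if y < x then x :: y :: ys else y :: insDesc x ys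

/-- Sort a list into weakly decreasing order. -/
def sortDesc (l : List ℕ) : List ℕ := l.foldr insDesc []

/-- The shape `λ(w)`: the code `(c_1(w), …, c_n(w))` sorted decreasingly, zeros dropped
(`n` is any bound on the support of `w`). -/
noncomputable def shapeOf (w : Perm') (n : ℕ) : List ℕ :=
  (sortDesc ((List.range' 1 n).map (codeOf w))).filter (fun x => decide (0 < x))

/-- The Rothe diagram `D_w = {(i, w j) : i < j, w j < w i}` (matrix coordinates). -/
def RotheDiagram (w : Perm') : Set (ℕ × ℕ) :=
  {p | 1 ≤ p.1 ∧ ∃ j, p.1 < j ∧ w j < w p.1 ∧ p.2 = w j}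

/-- `φ_i`: the row index of the southeast-most box of `D_w` on the diagonal through
`(i, λ_i)`. -/
noncomputable def flagEntry (w : Perm') (i li : ℕ) : ℕ :=
  sSup {r : ℕ | ∃ c : ℕ, (r, c) ∈ RotheDiagram w ∧ (c : ℤ) - (r : ℤ) = (li : ℤ) - (i : ℤ)}

/-- The flag `φ(w) = (φ_1, …, φ_m)` of a vexillary permutation. -/
noncomputable def flagOf (w : Perm') (n : ℕ) : List ℕ :=
  (List.range (shapeOf w n).length).map (fun k => flagEntry w (k + 1) ((shapeOf w n).getD k 0))

/-- `ρ(w)_i`: the `i`-th row of the smallest partition whose Young diagram contains `D_w`. -/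
noncomputable def rhoRow (w : Perm') (i : ℕ) : ℕ :=
  sSup {c : ℕ | ∃ r : ℕ, i ≤ r ∧ (r, c) ∈ RotheDiagram w}

/-! ### Tableaux (lists of rows), flagged SSYT, jeu de taquin -/

/-- Semistandard Young tableau of partition shape, presented as a list of rows. -/
def IsSSYT (T : List (List ℕ)) : Prop :=
  (∀ row ∈ T, row ≠ []) ∧
  List.Chain' (fun r1 r2 : List ℕ => r2.length ≤ r1.length) T ∧
  (∀ row ∈ T, List.Chain' (· ≤ ·) row) ∧
  (∀ i j : ℕ, i + 1 < T.length → j < (T.getD (i + 1) []).length →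
    (T.getD i []).getD j 0 < (T.getD (i + 1) []).getD j 0)

/-- `φ`-flagged semistandard Young tableaux of shape `λ`: the last entry of row `i`
is at most `φ_i`. -/
def IsFlaggedSSYT (lam phi : List ℕ) (T : List (List ℕ)) : Prop :=
  IsSSYT T ∧ T.map List.length = lam ∧
  ∀ i : ℕ, i < T.length → (T.getD i []).getLastD 0 ≤ phi.getD i 0

/-- Semistandard Young tableaux with all entries at most `k` (`SSYT_k`). -/
def IsSSYTBounded (k : ℕ) (T : List (List ℕ)) : Prop :=
  IsSSYT T ∧ ∀ row ∈ T, ∀ x ∈ row, x ≤ k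

/-- Set an entry of a tableau. -/
def setEntry (T : List (List ℕ)) (r c x : ℕ) : List (List ℕ) :=
  T.set r ((T.getD r []).set c x)

/-- One jeu de taquin slide with the empty tile at `(r, c)` (0-indexed):
swap the empty tile with the smaller of the entries to its right and below
(ties move down; missing boxes are `∞`); when both are missing, delete the cell. -/
def jdtAux : ℕ → List (List ℕ) → ℕ → ℕ → List (List ℕ)
  | 0, T, _, _ => T
  | fuel + 1, T, r, c =>
    match (T.getD r [])[c + 1]?, (T.getD (r + 1) [])[c]? with
    | none, none => (T.set r ((T.getD r []).take c)).filter (fun row => !row.isEmpty)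
    | some x, none => jdtAux fuel (setEntry T r c x) r (c + 1)
    | none, some y => jdtAux fuel (setEntry T r c y) (r + 1) c
    | some x, some y =>
      if x < y then jdtAux fuel (setEntry T r c x) r (c + 1)
      else jdtAux fuel (setEntry T r c y) (r + 1) c

/-- `jdt(T)`: remove the top-left box of `T` and rectify by jeu de taquin. -/
def jdt (T : List (List ℕ)) : List (List ℕ) :=
  jdtAux ((T.map List.length).sum + 1) T 0 0

/-! ### Edelman–Greene column insertion and the recording tableau -/

/-- Edelman–Greene insertion of `x` into one increasing column `C`.
Returns the new column together with `none` (if `x` was appended, creating a new box)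
or `some y` (where `y` is to be inserted into the next column). -/
def colIns (x : ℕ) (C : List ℕ) : List ℕ × Option ℕ :=
  if C.all (fun c => decide (c < x)) then (C ++ [x], none)
  else if x ∈ C ∧ (x + 1) ∈ C then (C, some (x + 1))
  else
    match C.find? (fun c => decide (x < c)) with
    | some ck => (C.map (fun c => if c = ck then x else c), some ck)
    | none => (C, none)

/-- Edelman–Greene insertion of `x` into a tableau presented as a list of columns.
Returns the new columns and the (0-indexed) column containing the new box. -/
def egInsert : List (List ℕ) → ℕ → (List (List ℕ)) × ℕ
  | [], x => ([[x]], 0)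
  | C :: rest, x =>
    match colIns x C with
    | (C', none) => (C' :: rest, 0)
    | (C', some y) =>
      let res := egInsert rest y
      (C' :: res.1, res.2 + 1)

/-- One step of the Edelman–Greene algorithm on the pair (insertion, recording) tableau:
insert `ra.2` into `P` and record `ra.1` in the new box of `Q`. -/
def egStep (PQ : (List (List ℕ)) × (List (List ℕ))) (ra : ℕ × ℕ) :
    (List (List ℕ)) × (List (List ℕ)) :=
  let res := egInsert PQ.1 ra.2
  let Q := PQ.2
  let Q' := if res.2 < Q.length then Q.set res.2 (Q.getD res.2 [] ++ [ra.1]) else Q ++ [[ra.1]]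
  (res.1, Q')

/-- A biword `(r_1,…,r_l ; a_1,…,a_l)`. -/
structure Biword where
  top : List ℕ
  bot : List ℕ

/-- The (insertion, recording) column tableaux of a biword under Edelman–Greene insertion. -/
def egPQ (P : Biword) : (List (List ℕ)) × (List (List ℕ)) :=
  (P.top.zip P.bot).foldl egStep ([], [])

/-- Convert a tableau presented as a list of columns into a list of rows. -/
def colsToRows (cols : List (List ℕ)) : List (List ℕ) :=
  (List.range ((cols.map List.length).foldr max 0)).map
    (fun i => cols.filterMap (fun col => col[i]?))

/-- The Edelman–Greene recording tableau `Q̃` of a biword (as a list of rows). -/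
def Qtilde (P : Biword) : List (List ℕ) := colsToRows (egPQ P).2

/-- The Edelman–Greene insertion tableau `P̃` of a biword (as a list of rows). -/
def Ptilde (P : Biword) : List (List ℕ) := colsToRows (egPQ P).1

/-- `(r ; a)` is a reduced compatible sequence for `w`: `a` is a reduced word for `w`,
`r` is weakly increasing, `r_i ≤ a_i`, and `r_i < r_{i+1}` whenever `a_i < a_{i+1}`.
Membership in `PD(w)`. -/
def IsCompatible (w : Perm') (P : Biword) : Prop :=
  IsReducedWord w P.bot ∧
  List.Chain' (· ≤ ·) P.top ∧
  List.Forall₂ (· ≤ ·) P.top P.bot ∧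
  (∀ m : ℕ, m + 1 < P.bot.length →
    P.bot.getD m 0 < P.bot.getD (m + 1) 0 → P.top.getD m 0 < P.top.getD (m + 1) 0)

/-! ### Bumpless pipe dreams -/

/-- The tiles: blank, vertical, horizontal, ⌐-elbow (S–E, "r"), ⌟-elbow (W–N, "j"),
crossing, and the bump tile (for almost bumpless pipe dreams). -/
inductive Tile
  | blank | vert | horiz | se | nw | cross | bump
deriving DecidableEq

/-- A square grid of tiles; rows and columns are 1-indexed, rows increase downward. -/
structure Grid where
  n : ℕ
  tile : ℕ → ℕ → Tile

inductive Dir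
  | north | east
deriving DecidableEq

def hasN : Tile → Bool
  | .vert => true | .nw => true | .cross => true | .bump => true | _ => false
def hasS : Tile → Bool
  | .vert => true | .se => true | .cross => true | .bump => true | _ => false
def hasE : Tile → Bool
  | .horiz => true | .se => true | .cross => true | .bump => true | _ => false
def hasW : Tile → Bool
  | .horiz => true | .nw => true | .cross => true | .bump => true | _ => false

/-- The outgoing direction of a pipe through a tile, given the incoming heading
(`north` = entered through the south edge, `east` = entered through the west edge). -/
def outDir : Tile → Dir → Option Dir
  | .vert, .north => some .north
  | .cross, .north => some .north
  | .se, .north => some .east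
  | .bump, .north => some .east
  | .horiz, .east => some .east
  | .cross, .east => some .east
  | .nw, .east => some .north
  | .bump, .east => some .north
  | _, _ => none

/-- Trace a pipe; returns the row in which it exits through the east edge of the grid. -/
def traceAux (g : Grid) : ℕ → ℕ → ℕ → Dir → Option ℕ
  | 0, _, _, _ => none
  | fuel + 1, x, y, d =>
    match outDir (g.tile x y) d with
    | none => none
    | some Dir.north => if x ≤ 1 then none else traceAux g fuel (x - 1) y Dir.north
    | some Dir.east => if g.n ≤ y then some x else traceAux g fuel x (y + 1) Dir.east

/-- The exit row of the pipe entering at the bottom of column `c`. -/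
def exitRow (g : Grid) (c : ℕ) : Option ℕ := traceAux g (2 * g.n + 2) g.n c Dir.north

/-- The list of states `(row, column, heading)` visited by a pipe. -/
def pathAux (g : Grid) : ℕ → ℕ → ℕ → Dir → List (ℕ × ℕ × Dir)
  | 0, _, _, _ => []
  | fuel + 1, x, y, d =>
    (x, y, d) ::
      (match outDir (g.tile x y) d with
       | none => []
       | some Dir.north => if x ≤ 1 then [] else pathAux g fuel (x - 1) y Dir.north
       | some Dir.east => if g.n ≤ y then [] else pathAux g fuel x (y + 1) Dir.east)

/-- The path of the pipe entering at the bottom of column `c`. -/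
def pipePath (g : Grid) (c : ℕ) : List (ℕ × ℕ × Dir) := pathAux g (2 * g.n + 2) g.n c Dir.north

/-- Pipe `c` passes through position `z`. -/
def passes (g : Grid) (c : ℕ) (z : ℕ × ℕ) : Prop :=
  ∃ d : Dir, (z.1, z.2, d) ∈ pipePath g c

def InGrid (g : Grid) (i j : ℕ) : Prop := 1 ≤ i ∧ i ≤ g.n ∧ 1 ≤ j ∧ j ≤ g.n

/-- A (reduced) bumpless pipe dream: tiles match along edges; pipes enter along the
bottom and exit along the right; no bump tiles; no two pipes cross more than once.
(Tiles outside the grid are normalized to `horiz`.) -/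
def IsBPD (g : Grid) : Prop :=
  1 ≤ g.n ∧
  (∀ i j, ¬ InGrid g i j → g.tile i j = Tile.horiz) ∧
  (∀ i j, InGrid g i j → g.tile i j ≠ Tile.bump) ∧
  (∀ i j, 1 ≤ i → i < g.n → 1 ≤ j → j ≤ g.n → hasS (g.tile i j) = hasN (g.tile (i + 1) j)) ∧
  (∀ i j, 1 ≤ i → i ≤ g.n → 1 ≤ j → j < g.n → hasE (g.tile i j) = hasW (g.tile i (j + 1))) ∧
  (∀ j, 1 ≤ j → j ≤ g.n → hasN (g.tile 1 j) = false) ∧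
  (∀ j, 1 ≤ j → j ≤ g.n → hasS (g.tile g.n j) = true) ∧
  (∀ i, 1 ≤ i → i ≤ g.n → hasW (g.tile i 1) = false) ∧
  (∀ i, 1 ≤ i → i ≤ g.n → hasE (g.tile i g.n) = true) ∧
  (∀ c c', 1 ≤ c → c ≤ g.n → 1 ≤ c' → c' ≤ g.n → c ≠ c' →
    Set.Subsingleton {z : ℕ × ℕ | g.tile z.1 z.2 = Tile.cross ∧ passes g c z ∧ passes g c' z})

/-- `g ∈ BPD(w)`: `g` is a bumpless pipe dream whose permutation is `w`, i.e. the pipe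
entering at the bottom of column `c` exits to the right in row `w⁻¹(c)`. -/
def MemBPD (w : Perm') (g : Grid) : Prop :=
  IsBPD g ∧ w 0 = 0 ∧ (∀ k, g.n < k → w k = k) ∧
  (∀ c, 1 ≤ c → c ≤ g.n → exitRow g c = some (w.symm c))

/-! ### Weigandt's map γ -/

/-- The blank tiles on the diagonal `{(i,j) : j - i = d}`, from northwest to southeast. -/
def blanksOnDiag (g : Grid) (d : ℤ) : List (ℕ × ℕ) :=
  (List.range' 1 g.n).filterMap (fun (i : ℕ) =>
    let jz : ℤ := (i : ℤ) + d
    if 1 ≤ jz ∧ jz ≤ (g.n : ℤ) then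
      (if g.tile i jz.toNat = Tile.blank then some (i, jz.toNat) else none)
    else none)

/-- The number of pipes passing above position `(i,j)`: tiles above it in column `j`
in which a pipe travels eastward. -/
def pipesAbove (g : Grid) (i j : ℕ) : ℕ :=
  ((List.range' 1 g.n).filter (fun x => decide (x < i) && hasE (g.tile x j))).length

/-- Weigandt's map `γ` (for vexillary permutations): fill each blank tile with the number
of pipes above it, slide the filled tiles northwest along their diagonals into the Young
diagram of `lam`, and add `i` to every entry in row `i`. -/
def weigandt (g : Grid) (lam : List ℕ) : List (List ℕ) :=
  (List.range lam.length).map (fun (r0 : ℕ) =>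
    (List.range (lam.getD r0 0)).map (fun (c0 : ℕ) =>
      let r : ℕ := r0 + 1
      let c : ℕ := c0 + 1
      let p := (blanksOnDiag g ((c : ℤ) - (r : ℤ))).getD (min r c - 1) (0, 0)
      pipesAbove g p.1 p.2 + r))

/-! ### The Gao–Huang operator ∇, pop, and the bijection φ -/

/-- Backward tracing: enter tile `(x,y)` through its north edge (`viaN = true`) or its
east edge (`viaN = false`) and follow the pipe backwards; returns the bottom column
at which the pipe enters the grid. -/
def backAux (g : Grid) : ℕ → ℕ → ℕ → Bool → Option ℕ
  | 0, _, _, _ => none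
  | fuel + 1, x, y, viaN =>
    if g.n < x then none
    else if viaN then
      match g.tile x y with
      | .vert | .cross => if x = g.n then some y else backAux g fuel (x + 1) y true
      | .nw | .bump => backAux g fuel x (y - 1) false
      | _ => none
    else
      match g.tile x y with
      | .horiz | .cross => backAux g fuel x (y - 1) false
      | .se | .bump => if x = g.n then some y else backAux g fuel (x + 1) y true
      | _ => none

/-- The label of the pipe passing through `(x,y)` entering from the south. -/
def pipeFromS (g : Grid) (x y : ℕ) : Option ℕ :=
  if x = g.n then some y else backAux g (2 * g.n + 2) (x + 1) y true

/-- Move the mark east to the rightmost blank tile in its contiguous block of blanks. -/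
def slideEast (g : Grid) (i j : ℕ) : ℕ :=
  ((List.range' j (g.n + 1)).takeWhile (fun y => g.tile i y == Tile.blank)).getLastD j

/-- Tile rewrite for the undroop of the pipe `p` (from `(i', j+1)` into `(i, j)`)
performed in one iteration of the Gao–Huang procedure; the `(i', j+1)` case `cross → se`
is the final uncrossing step. -/
def nablaUndroop (T : ℕ → ℕ → Tile) (i i' j : ℕ) : ℕ → ℕ → Tile := fun x y =>
  let t := T x y
  if x = i ∧ y = j then (match t with | Tile.blank => Tile.se | _ => t)
  else if x = i' ∧ y = j then
    (match t with | Tile.se => Tile.vert | Tile.horiz => Tile.nw | _ => t)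
  else if x = i ∧ y = j + 1 then
    (match t with | Tile.se => Tile.horiz | Tile.vert => Tile.nw | _ => t)
  else if x = i' ∧ y = j + 1 then
    (match t with | Tile.nw => Tile.blank | Tile.cross => Tile.se | _ => t)
  else if y = j ∧ i < x ∧ x < i' then
    (match t with | Tile.blank => Tile.vert | Tile.horiz => Tile.cross | _ => t)
  else if y = j + 1 ∧ i < x ∧ x < i' then
    (match t with | Tile.vert => Tile.blank | Tile.cross => Tile.horiz | _ => t)
  else t

/-- Tile rewrite for the droop (from `(k, j)` into `(k', j+1)`) of a pipe `q` having both
a ⌐-turn and a ⌟-turn in column `j`, performed after the undroop of `p`. -/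
def nablaQDroop (T : ℕ → ℕ → Tile) (k k' j : ℕ) : ℕ → ℕ → Tile := fun x y =>
  let t := T x y
  if x = k ∧ y = j then (match t with | Tile.se => Tile.vert | _ => t)
  else if x = k' ∧ y = j then (match t with | Tile.nw => Tile.cross | _ => t)
  else if x = k ∧ y = j + 1 then (match t with | Tile.horiz => Tile.se | _ => t)
  else if x = k' ∧ y = j + 1 then (match t with | Tile.blank => Tile.nw | _ => t)
  else if y = j + 1 ∧ k < x ∧ x < k' then
    (match t with | Tile.blank => Tile.vert | Tile.horiz => Tile.cross | _ => t)
  else t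

/-- The ⌐/⌟ elbow pairs `(k, k')` of pipes in column `j` strictly between rows `i` and `i'`. -/
def qPairs (g : Grid) (i i' j : ℕ) : List (ℕ × ℕ) :=
  (List.range' 1 g.n).filterMap (fun k =>
    if i < k ∧ k < i' ∧ g.tile k j = Tile.se then
      match (List.range' 1 g.n).find?
          (fun k' => decide (k < k' ∧ k' < i' ∧ g.tile k' j = Tile.nw)) with
      | some k' => some (k, k')
      | none => none
    else none)

/-- One iteration of the marked-tile procedure on the rectangle with corners
`(i, j)` and `(i', j+1)`: undroop `p`, then droop the intersecting pipes. -/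
def nablaIter (g : Grid) (i i' j : ℕ) : Grid :=
  ⟨g.n, (qPairs g i i' j).foldl (fun T kk => nablaQDroop T kk.1 kk.2 j)
    (nablaUndroop g.tile i i' j)⟩

/-- The marked-tile loop of the Gao–Huang procedure; returns `(∇B, a)`. -/
def nablaLoop (g : Grid) : ℕ → ℕ × ℕ → Grid × ℕ
  | 0, _ => (g, 0)
  | fuel + 1, (i, j0) =>
    let j := slideEast g i j0
    match pipeFromS g i (j + 1) with
    | none => (g, 0)
    | some p =>
      if p = j + 1 then
        match (List.range' 1 g.n).find? (fun x =>
            decide (i < x) && (g.tile x (j + 1) == Tile.cross) &&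
            (backAux g (2 * g.n + 2) x (j + 1) false == some j)) with
        | some i' => (nablaIter g i i' j, j)
        | none => (g, 0)
      else
        match (List.range' 1 g.n).find? (fun x =>
            decide (i < x) && (g.tile x (j + 1) == Tile.nw)) with
        | some i' => nablaLoop (nablaIter g i i' j) fuel (i', j + 1)
        | none => (g, 0)

/-- The Gao–Huang procedure: returns `(∇B, (r, a))` where `pop(B) = (r, a)`. -/
def nablaPop (g : Grid) : Grid × ℕ × ℕ :=
  match (List.range' 1 g.n).find?
      (fun i => (List.range' 1 g.n).any (fun j => g.tile i j == Tile.blank)) with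
  | none => (g, 0, 0)
  | some r =>
    let j0 := ((List.range' 1 g.n).filter (fun j => g.tile r j == Tile.blank)).getLastD 0
    let res := nablaLoop g (g.n + 1) (r, j0)
    (res.1, r, res.2)

/-- The Gao–Huang operator `∇`. -/
def nabla (g : Grid) : Grid := (nablaPop g).1

/-- `pop(B) = (r, a)`. -/
def pop (g : Grid) : ℕ × ℕ := (nablaPop g).2

/-- The number of crossing tiles of `g` (which equals `ℓ(w)` for `g ∈ BPD(w)`). -/
def crossCount (g : Grid) : ℕ :=
  ((List.range' 1 g.n).map (fun i =>
    ((List.range' 1 g.n).filter (fun j => g.tile i j == Tile.cross)).length)).sum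

def phiAux : ℕ → Grid → List (ℕ × ℕ)
  | 0, _ => []
  | l + 1, g => pop g :: phiAux l (nabla g)

/-- The Gao–Huang bijection `φ : BPD(w) → PD(w)`,
`φ(B) = (r_1,…,r_l ; a_1,…,a_l)` with `(r_i, a_i) = pop(∇^{i-1} B)`. -/
def phi (g : Grid) : Biword :=
  ⟨(phiAux (crossCount g) g).map Prod.fst, (phiAux (crossCount g) g).map Prod.snd⟩

/-! ### Little bumps (relational) -/

/-- The reflection labelling the crossing at position `m` (0-indexed) of the word `a`:
deleting the letter at position `m` from `a` yields a word for `wordProd a * crossingRefl a m`.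
The wires `i` and `j` cross at position `m` iff `crossingRefl a m = t_{ij}`. -/
def crossingRefl (a : List ℕ) (m : ℕ) : Perm' :=
  (wordProd (a.drop (m + 1)))⁻¹ * sT (a.getD m 0) * wordProd (a.drop (m + 1))

/-- `a` is a reduced word (for its own product). -/
def IsReducedSelf (a : List ℕ) : Prop := IsReducedWord (wordProd a) a

/-- Increment the entry of `a` at position `m`. -/
def incrAt (a : List ℕ) (m : ℕ) : List ℕ := a.set m (a.getD m 0 + 1)

/-- The (upward) Little bump `L_{ij}` as a relation on biwords: starting at the position
`m_1` where wires `i` and `j` cross, repeatedly increment the current entry; stop when the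
bottom word becomes reduced, and otherwise move to the unique other position whose crossing
involves the same pair of wires. -/
def LittleBumpRel (i j : ℕ) (P P' : Biword) : Prop :=
  P'.top = P.top ∧
  ∃ ms : List ℕ, ∃ ws : List (List ℕ),
    ms ≠ [] ∧
    ws.length = ms.length + 1 ∧
    ws.getD 0 [] = P.bot ∧
    ws.getLastD [] = P'.bot ∧
    (∀ t : ℕ, t < ms.length → ws.getD (t + 1) [] = incrAt (ws.getD t []) (ms.getD t 0)) ∧
    crossingRefl P.bot (ms.getD 0 0) = tT i j ∧
    (∀ t : ℕ, t + 1 < ms.length →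
      ¬ IsReducedSelf (ws.getD (t + 1) []) ∧
      ms.getD (t + 1) 0 ≠ ms.getD t 0 ∧
      crossingRefl (ws.getD (t + 1) []) (ms.getD t 0)
        = crossingRefl (ws.getD (t + 1) []) (ms.getD (t + 1) 0)) ∧
    IsReducedSelf P'.bot

/-! ### Huang bumps -/

/-- Least offset `t ≥ 1` satisfying `p` (searched up to `bound + 1`). -/
def leastOff (p : ℕ → Bool) (bound : ℕ) : ℕ :=
  ((List.range' 1 (bound + 1)).filter p).headD 1

/-- The southeast corner `(x + k, y + l)` of the min-droop at `(x, y)`: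
`k, l ≥ 1` minimal with `(x+k, y)` and `(x, y+l)` not crossing tiles. -/
def minDroopCorner (g : Grid) (x y : ℕ) : ℕ × ℕ :=
  (x + leastOff (fun k => !(g.tile (x + k) y == Tile.cross)) g.n,
   y + leastOff (fun l => !(g.tile x (y + l) == Tile.cross)) g.n)

/-- The min-droop at `(x, y)`: droop the ⌐-turn at `(x, y)` into `(x+k, y+l)`. -/
def minDroopT (g : Grid) (x y : ℕ) : Grid :=
  let k := leastOff (fun k => !(g.tile (x + k) y == Tile.cross)) g.n
  let l := leastOff (fun l => !(g.tile x (y + l) == Tile.cross)) g.n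
  ⟨g.n, fun a b =>
    let t := g.tile a b
    if a = x ∧ b = y then
      (match t with | Tile.se => Tile.blank | Tile.bump => Tile.nw | _ => t)
    else if a = x + k ∧ b = y then (match t with | Tile.vert => Tile.se | _ => t)
    else if a = x ∧ b = y + l then
      (match t with | Tile.horiz => Tile.se | Tile.nw => Tile.vert | _ => t)
    else if a = x + k ∧ b = y + l then
      (match t with | Tile.blank => Tile.nw | Tile.se => Tile.bump | _ => t)
    else if b = y ∧ x < a ∧ a < x + k then
      (match t with | Tile.cross => Tile.horiz | Tile.vert => Tile.blank | _ => t)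
    else if a = x ∧ y < b ∧ b < y + l then
      (match t with | Tile.cross => Tile.vert | Tile.horiz => Tile.blank | _ => t)
    else if a = x + k ∧ y < b ∧ b < y + l then
      (match t with | Tile.blank => Tile.horiz | Tile.vert => Tile.cross | _ => t)
    else if b = y + l ∧ x < a ∧ a < x + k then
      (match t with | Tile.blank => Tile.vert | Tile.horiz => Tile.cross | _ => t)
    else t⟩

/-- Replace a single tile. -/
def setTile (g : Grid) (x y : ℕ) (t : Tile) : Grid :=
  ⟨g.n, fun a b => if a = x ∧ b = y then t else g.tile a b⟩

/-- Pipe `c` passes through `(x, y)` (Boolean). -/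
def onPath (g : Grid) (c : ℕ) (x y : ℕ) : Bool :=
  decide ((x, y, Dir.north) ∈ pipePath g c) || decide ((x, y, Dir.east) ∈ pipePath g c)

/-- The position of the crossing tile where pipes `c` and `c'` cross, if any. -/
def findCrossing (g : Grid) (c c' : ℕ) : Option (ℕ × ℕ) :=
  (pipePath g c).findSome? (fun s =>
    if (g.tile s.1 s.2.1 == Tile.cross) && onPath g c' s.1 s.2.1 then some (s.1, s.2.1)
    else none)

/-- The column of the ⌐-turn of pipe `c` in row `row`, if any. -/
def seTurnCol (g : Grid) (c row : ℕ) : Option ℕ :=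
  (pipePath g c).findSome? (fun s =>
    if s.1 = row ∧ s.2.2 = Dir.north ∧
        (g.tile s.1 s.2.1 = Tile.se ∨ g.tile s.1 s.2.1 = Tile.bump) then some s.2.1
    else none)

/-- The iteration of the Huang bump: min-droops and cross-bump-swaps until a bump tile
is turned into a crossing tile. -/
def huangLoop (iPipe : ℕ) : ℕ → Grid → ℕ × ℕ → Grid
  | 0, g, _ => g
  | fuel + 1, g, (x, y) =>
    let c := minDroopCorner g x y
    let g1 := minDroopT g x y
    match g1.tile c.1 c.2 with
    | Tile.nw =>
      match seTurnCol g1 iPipe c.1 with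
      | some col => huangLoop iPipe fuel g1 (c.1, col)
      | none => g1
    | Tile.bump =>
      match backAux g1 (2 * g1.n + 2) c.1 c.2 false with
      | some q =>
        match findCrossing g1 iPipe q with
        | some z =>
          huangLoop iPipe fuel (setTile (setTile g1 c.1 c.2 Tile.cross) z.1 z.2 Tile.bump) z
        | none => setTile g1 c.1 c.2 Tile.cross
      | none => g1
    | _ => g1

/-- Fuel exceeding the number of states of the procedure. -/
def huangFuel (g : Grid) : ℕ := 7 ^ (g.n * g.n) * (g.n * g.n) + 2

/-- The Huang bump `H_{ij}`: replace the crossing of pipes `i` and `j` by a bump tile,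
then repeatedly min-droop and cross-bump-swap until a new crossing tile is created. -/
def huang (i j : ℕ) (g : Grid) : Grid :=
  match findCrossing g i j with
  | some z => huangLoop i (huangFuel g) (setTile g z.1 z.2 Tile.bump) z
  | none => g


/-! ### Reduced words -/

/-- A word in positive letters of minimal length among the words with the same product. -/
def Red (l : List ℕ) : Prop :=
  (∀ x ∈ l, 1 ≤ x) ∧ ∀ l' : List ℕ, (∀ x ∈ l', 1 ≤ x) → wordProd l' = wordProd l →
    l.length ≤ l'.length

@[simp] lemma wordProd_nil : wordProd [] = 1 := rfl

@[simp] lemma wordProd_cons (a : ℕ) (l : List ℕ) : wordProd (a :: l) = sT a * wordProd l := by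
  simp [wordProd]

@[simp] lemma wordProd_append (l l' : List ℕ) :
    wordProd (l ++ l') = wordProd l * wordProd l' := by
  simp [wordProd]

lemma sT_mul_self (a : ℕ) : sT a * sT a = 1 := Equiv.swap_mul_self _ _

lemma sT_apply (a k : ℕ) : sT a k = if k = a then a + 1 else if k = a + 1 then a else k :=
  Equiv.swap_apply_def _ _ _

lemma sT_comm {a b : ℕ} (h : a + 2 ≤ b) : sT a * sT b = sT b * sT a := by
  ext k
  simp only [Equiv.Perm.mul_apply, sT_apply]
  split_ifs <;> omega

lemma sT_braid (a : ℕ) : sT a * sT (a + 1) * sT a = sT (a + 1) * sT a * sT (a + 1) := by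
  ext k
  simp only [Equiv.Perm.mul_apply, sT_apply]
  split_ifs <;> omega

lemma sT_comm_wordProd_of_lt {a : ℕ} {l : List ℕ} (h : ∀ b ∈ l, a + 2 ≤ b) :
    sT a * wordProd l = wordProd l * sT a := by
  induction l with
  | nil => simp
  | cons b l ih =>
    simp only [List.mem_cons, forall_eq_or_imp] at h
    rw [wordProd_cons, ← mul_assoc, sT_comm h.1, mul_assoc, ih h.2, mul_assoc]

lemma sT_comm_wordProd_of_gt {a : ℕ} {l : List ℕ} (h : ∀ b ∈ l, b + 2 ≤ a) :
    sT a * wordProd l = wordProd l * sT a := by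
  induction l with
  | nil => simp
  | cons b l ih =>
    simp only [List.mem_cons, forall_eq_or_imp] at h
    rw [wordProd_cons, ← mul_assoc, ← sT_comm h.1, mul_assoc, ih h.2, mul_assoc]

lemma wordProd_reverse (l : List ℕ) : wordProd l.reverse = (wordProd l)⁻¹ := by
  induction l with
  | nil => simp
  | cons a l ih => simp [ih, sT]

lemma Red.of_eq {l l' : List ℕ} (h : Red l) (hp : ∀ x ∈ l', 1 ≤ x)
    (hl : l'.length = l.length) (he : wordProd l' = wordProd l) : Red l' :=
  ⟨hp, fun m hm hm' => hl ▸ h.2 m hm (hm'.trans he)⟩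

lemma Red.left {l l' : List ℕ} (h : Red (l ++ l')) : Red l := by
  refine ⟨fun x hx => h.1 x (by simp [hx]), fun m hm he => ?_⟩
  have := h.2 (m ++ l') (by
    intro x hx
    rcases List.mem_append.1 hx with hx | hx
    · exact hm x hx
    · exact h.1 x (by simp [hx])) (by simp [he])
  simpa using this

lemma Red.right {l l' : List ℕ} (h : Red (l ++ l')) : Red l' := by
  refine ⟨fun x hx => h.1 x (by simp [hx]), fun m hm he => ?_⟩
  have := h.2 (l ++ m) (by
    intro x hx
    rcases List.mem_append.1 hx with hx | hx
    · exact h.1 x (by simp [hx])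
    · exact hm x hx) (by simp [he])
  simpa using this

lemma Red.reverse {l : List ℕ} (h : Red l) : Red l.reverse := by
  refine ⟨by simpa using h.1, fun m hm he => ?_⟩
  have := h.2 m.reverse (by simpa using hm) (by
    rw [wordProd_reverse, he, wordProd_reverse, inv_inv])
  simpa using this

/-- The exchange property. -/
lemma exists_delete_letter {l : List ℕ} (hl : ∀ x ∈ l, 1 ≤ x) {g h : ℕ} (hgh : g < h)
    (hd : wordProd l h < wordProd l g) :
    ∃ l' : List ℕ, (∀ x ∈ l', 1 ≤ x) ∧ l'.length + 1 = l.length ∧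
      wordProd l * Equiv.swap g h = wordProd l' := by
  induction l with
  | nil => simp at hd; omega
  | cons a l ih =>
    simp only [List.mem_cons, forall_eq_or_imp] at hl
    by_cases hc : wordProd l h < wordProd l g
    · obtain ⟨l', h1, h2, h3⟩ := ih hl.2 hc
      refine ⟨a :: l', by simpa [hl.1] using h1, by simp [h2], ?_⟩
      rw [wordProd_cons, wordProd_cons, mul_assoc, h3]
    · have hne : wordProd l g ≠ wordProd l h := fun e => by
        have := (wordProd l).injective e
        omega
      have hga : wordProd l g = a ∧ wordProd l h = a + 1 := by
        simp only [wordProd_cons, Equiv.Perm.mul_apply, sT_apply] at hd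
        split_ifs at hd <;> omega
      refine ⟨l, hl.2, rfl, ?_⟩
      have : wordProd l * Equiv.swap g h = sT a * wordProd l := by
        rw [Equiv.mul_swap_eq_swap_mul, hga.1, hga.2, sT]
      rw [wordProd_cons, mul_assoc, this, ← mul_assoc, sT_mul_self, one_mul]

lemma Red.lt_of_append_singleton {l : List ℕ} {g : ℕ} (h : Red (l ++ [g])) :
    wordProd l g < wordProd l (g + 1) := by
  by_contra hc
  have hne : wordProd l g ≠ wordProd l (g + 1) := fun e => by
    have := (wordProd l).injective e
    omega
  obtain ⟨l', h1, h2, h3⟩ := exists_delete_letter (l := l) (g := g) (h := g + 1) h.left.1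
    (by omega) (by omega)
  have := h.2 l' h1 (by rw [← h3]; simp [sT])
  simp at this
  omega

lemma Red.symm_lt_of_cons {l : List ℕ} {g : ℕ} (h : Red (g :: l)) :
    (wordProd l).symm g < (wordProd l).symm (g + 1) := by
  have h1 := h.reverse
  rw [List.reverse_cons] at h1
  have := h1.lt_of_append_singleton
  rwa [wordProd_reverse] at this

lemma Red.ne_of_append_pair {l l' : List ℕ} {a b : ℕ} (h : Red (l ++ a :: b :: l')) : a ≠ b := by
  rintro rfl
  have := h.2 (l ++ l') (fun x hx => h.1 x (by
    simp only [List.mem_append, List.mem_cons] at hx ⊢; tauto))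
    (by rw [wordProd_append, wordProd_append, wordProd_cons, wordProd_cons,
      ← mul_assoc (sT a), sT_mul_self, one_mul])
  simp at this

lemma isReducedWord_iff {w : Perm'} {l : List ℕ} :
    IsReducedWord w l ↔ Red l ∧ wordProd l = w := by
  constructor
  · rintro ⟨⟨h1, h2⟩, h3⟩
    refine ⟨⟨h1, fun l' hl' he => ?_⟩, h2⟩
    rw [h3]
    exact Nat.sInf_le ⟨l', ⟨hl', he.trans h2⟩, rfl⟩
  · rintro ⟨h1, h2⟩
    refine ⟨⟨h1.1, h2⟩, le_antisymm ?_ (Nat.sInf_le ⟨l, ⟨h1.1, h2⟩, rfl⟩)⟩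
    refine le_csInf ⟨_, l, ⟨h1.1, h2⟩, rfl⟩ ?_
    rintro _ ⟨l', ⟨h3, h4⟩, rfl⟩
    exact h1.2 l' h3 (h4.trans h2.symm)

/-! ### Column insertion -/

/-- `ColStep C x C' o`: inserting `x` into the increasing column `C` yields the column `C'` and
passes on the letter `o`, if any. -/
inductive ColStep : List ℕ → ℕ → List ℕ → Option ℕ → Prop
  | app {C : List ℕ} {x : ℕ} (h : ∀ c ∈ C, c < x) : ColStep C x (C ++ [x]) none
  | bump {A B : List ℕ} {x y : ℕ} (hA : ∀ a ∈ A, a < x) (hxy : x < y) (hB : ∀ b ∈ B, y < b) :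
      ColStep (A ++ y :: B) x (A ++ x :: B) (some y)
  | special {A B : List ℕ} {x : ℕ} (hA : ∀ a ∈ A, a < x) (hB : ∀ b ∈ B, x + 1 < b) :
      ColStep (A ++ x :: (x + 1) :: B) x (A ++ x :: (x + 1) :: B) (some (x + 1))

lemma ColStep.colIns_eq {C C' : List ℕ} {x : ℕ} {o : Option ℕ} (h : ColStep C x C' o) :
    colIns x C = (C', o) := by
  unfold colIns
  cases h with
  | app h => rw [if_pos (by simpa using h)]
  | @bump A B x y hA hxy hB =>
    have hx : x ∉ A ++ y :: B := by
      simp only [List.mem_append, List.mem_cons, not_or]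
      exact ⟨fun h => (hA _ h).false, hxy.ne, fun h => (hxy.trans (hB _ h)).false⟩
    have hf : (A ++ y :: B).find? (fun c => decide (x < c)) = some y := by
      rw [List.find?_eq_some_iff_append]
      exact ⟨by simpa using hxy, A, B, rfl, fun a ha => by simpa using (hA a ha).le⟩
    rw [if_neg (by
      simp only [List.all_eq_true, decide_eq_true_eq]
      exact fun h => (hxy.trans (h y (by simp))).false), if_neg (by tauto)]
    simp only [hf]
    congr 1
    rw [List.map_append, List.map_cons, if_pos rfl]
    congr 1
    · conv_rhs => rw [← List.map_id A]
      refine List.map_congr_left fun a ha => ?_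
      have := hA a ha
      simp; omega
    · congr 1
      conv_rhs => rw [← List.map_id B]
      refine List.map_congr_left fun a ha => ?_
      have := hB a ha
      simp; omega
  | @special A B x hA hB =>
    rw [if_neg (by
      simp only [List.all_eq_true, decide_eq_true_eq]
      exact fun h => (h x (by simp)).false), if_pos (by simp)]

lemma exists_colStep {x : ℕ} {C : List ℕ} (hC : C.Pairwise (· < ·)) (hx : x ∈ C → x + 1 ∈ C) :
    ∃ C' o, ColStep C x C' o := by
  have hsplit : ∃ A B, C = A ++ B ∧ (∀ a ∈ A, a < x) ∧ ∀ b ∈ B, x ≤ b := by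
    clear hx
    induction C with
    | nil => exact ⟨[], [], by simp⟩
    | cons c C ih =>
      rw [List.pairwise_cons] at hC
      by_cases hc : c < x
      · obtain ⟨A, B, rfl, hA, hB⟩ := ih hC.2
        exact ⟨c :: A, B, rfl, by simpa using ⟨hc, hA⟩, hB⟩
      · refine ⟨[], c :: C, rfl, by simp, ?_⟩
        simp only [List.mem_cons]
        rintro b (rfl | hb)
        · omega
        · have := hC.1 b hb; omega
  obtain ⟨A, B, rfl, hA, hB⟩ := hsplit
  rcases B with _ | ⟨y, B⟩
  · exact ⟨_, _, .app (by simpa using hA)⟩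
  simp only [List.pairwise_append, List.pairwise_cons, List.mem_cons] at hC
  rcases (hB y (by simp)).lt_or_eq with hy | rfl
  · exact ⟨_, _, .bump hA hy hC.2.1.1⟩
  · have h1 := hx (by simp)
    simp only [List.mem_append, List.mem_cons] at h1
    have h2 : x + 1 ∈ B := by
      rcases h1 with h1 | h1 | h1
      · have := hA _ h1; omega
      · omega
      · exact h1
    rcases B with _ | ⟨b, B⟩
    · simp at h2
    have hb : b = x + 1 := by
      have := hC.2.1.1 b (by simp)
      rcases List.mem_cons.1 h2 with h | h
      · exact h.symm
      · have := (List.pairwise_cons.1 hC.2.1.2).1 _ h; omega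
    subst hb
    exact ⟨_, _, .special hA (List.pairwise_cons.1 hC.2.1.2).1⟩

/-- In a reduced word consisting of an increasing column followed by a letter of that column, the
next letter is also in the column. -/
lemma Red.succ_mem {C : List ℕ} {x : ℕ} (hC : C.Pairwise (· < ·)) (h : Red (C ++ [x])) :
    x ∈ C → x + 1 ∈ C := by
  intro hm
  by_contra hx
  obtain ⟨A, B, rfl⟩ := List.append_of_mem hm
  simp only [List.pairwise_append, List.pairwise_cons, List.mem_cons] at hC
  have hB : ∀ b ∈ B, x + 2 ≤ b := by
    intro b hb
    have h1 := hC.2.1.1 b hb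
    have h2 : b ≠ x + 1 := fun e => hx (by simp [← e, hb])
    omega
  have h2 := h.2 (A ++ B) (fun y hy => h.1 y (by
    simp only [List.mem_append, List.mem_cons] at hy ⊢; tauto)) (by
      simp only [wordProd_append, wordProd_cons, wordProd_nil, mul_one]
      rw [mul_assoc, mul_assoc, ← sT_comm_wordProd_of_lt hB, ← mul_assoc (sT x), sT_mul_self,
        one_mul])
  simp at h2

/-- Dual form of `Red.succ_mem`. -/
lemma Red.pred_mem {C : List ℕ} {y : ℕ} (hC : C.Pairwise (· < ·)) (h : Red (y :: C)) :
    y ∈ C → ∃ x, x + 1 = y ∧ x ∈ C := by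
  intro hm
  by_contra hx
  obtain ⟨A, B, rfl⟩ := List.append_of_mem hm
  simp only [List.pairwise_append, List.pairwise_cons, List.mem_cons] at hC
  have hA : ∀ b ∈ A, b + 2 ≤ y := by
    intro b hb
    have h1 := hC.2.2 b hb y (Or.inl rfl)
    have h2 : b + 1 ≠ y := fun e => hx ⟨b, e, by simp [hb]⟩
    omega
  have h2 := h.2 (A ++ B) (fun y hy => h.1 y (by
    simp only [List.mem_append, List.mem_cons] at hy ⊢; tauto)) (by
      simp only [wordProd_append, wordProd_cons]
      rw [← mul_assoc, sT_comm_wordProd_of_gt hA, mul_assoc, ← mul_assoc (sT y), sT_mul_self,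
        one_mul])
  simp at h2

lemma wordProd_bump {A B : List ℕ} {x y : ℕ} (hA : ∀ a ∈ A, a < x) (hxy : x < y)
    (hB : ∀ b ∈ B, y < b) :
    wordProd (A ++ y :: B ++ [x]) = wordProd (y :: (A ++ x :: B)) := by
  have h1 : ∀ b ∈ B, x + 2 ≤ b := fun b hb => by have := hB b hb; omega
  have h2 : ∀ a ∈ A, a + 2 ≤ y := fun a ha => by have := hA a ha; omega
  simp only [wordProd_append, wordProd_cons, wordProd_nil, mul_one]
  rw [← mul_assoc (sT y) (wordProd A), sT_comm_wordProd_of_gt h2, mul_assoc, mul_assoc, mul_assoc,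
    ← sT_comm_wordProd_of_lt h1]

lemma wordProd_special {A B : List ℕ} {x : ℕ} (hA : ∀ a ∈ A, a < x)
    (hB : ∀ b ∈ B, x + 1 < b) :
    wordProd (A ++ x :: (x + 1) :: B ++ [x]) =
      wordProd ((x + 1) :: (A ++ x :: (x + 1) :: B)) := by
  have h1 : ∀ b ∈ B, x + 2 ≤ b := fun b hb => by have := hB b hb; omega
  have h2 : ∀ a ∈ A, a + 2 ≤ x + 1 := fun a ha => by have := hA a ha; omega
  simp only [wordProd_append, wordProd_cons, wordProd_nil, mul_one]
  rw [← mul_assoc (sT (x + 1)) (wordProd A), sT_comm_wordProd_of_gt h2]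
  simp only [mul_assoc]
  rw [← sT_comm_wordProd_of_lt h1, ← mul_assoc (sT (x + 1)) (sT x) (wordProd B),
    ← mul_assoc (sT x) (sT (x + 1) * sT x), ← mul_assoc (sT x), sT_braid]
  simp only [mul_assoc]

lemma ColStep.wordProd_eq {x y : ℕ} {C C' : List ℕ} (h : ColStep C x C' (some y)) :
    wordProd (C ++ [x]) = wordProd (y :: C') := by
  cases h with
  | bump hA hxy hB => exact wordProd_bump hA hxy hB
  | special hA hB => exact wordProd_special hA hB

lemma ColStep.length_eq {x y : ℕ} {C C' : List ℕ} (h : ColStep C x C' (some y)) :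
    C'.length = C.length := by
  cases h with
  | bump hA hxy hB => simp
  | special hA hB => rfl

lemma ColStep.lt {x y : ℕ} {C C' : List ℕ} (h : ColStep C x C' (some y)) : x < y := by
  cases h with
  | bump hA hxy hB => exact hxy
  | special hA hB => omega

lemma ColStep.pairwise {x : ℕ} {C C' : List ℕ} {o : Option ℕ} (h : ColStep C x C' o)
    (hC : C.Pairwise (· < ·)) : C'.Pairwise (· < ·) := by
  cases h with
  | app h =>
    simp only [List.pairwise_append, List.pairwise_cons]
    simpa using ⟨hC, h⟩
  | bump h1 h2 h3 =>
    simp only [List.pairwise_append, List.pairwise_cons, List.mem_cons] at hC ⊢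
    refine ⟨hC.1, ⟨fun b hb => h2.trans (h3 b hb), hC.2.1.2⟩, ?_⟩
    rintro a ha b (rfl | hb)
    · exact h1 a ha
    · exact hC.2.2 a ha b (Or.inr hb)
  | special => exact hC

lemma ColStep.mem {x : ℕ} {C C' : List ℕ} {o : Option ℕ} (h : ColStep C x C' o) : x ∈ C' := by
  cases h <;> simp

/-- The bumped letter is a letter of the column. -/
lemma ColStep.bumped_mem {x y : ℕ} {C C' : List ℕ} (h : ColStep C x C' (some y)) : y ∈ C := by
  cases h <;> simp

/-- The bumped letter is the least letter exceeding the inserted one. -/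
lemma ColStep.le_of_mem {x y c : ℕ} {C C' : List ℕ} (h : ColStep C x C' (some y)) (hc : c ∈ C)
    (hxc : x < c) : y ≤ c := by
  cases h with
  | bump h1 h2 h3 =>
    simp only [List.mem_append, List.mem_cons] at hc
    rcases hc with hc | rfl | hc
    · have := h1 c hc; omega
    · rfl
    · exact (h3 c hc).le
  | special => exact hxc

/-- Letters of the new column exceeding the inserted letter are at least the bumped letter. -/
lemma ColStep.le_of_mem_new {x y c : ℕ} {C C' : List ℕ} (h : ColStep C x C' (some y))
    (hc : c ∈ C') (hxc : x < c) : y ≤ c := by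
  cases h with
  | bump h1 h2 h3 =>
    simp only [List.mem_append, List.mem_cons] at hc
    rcases hc with hc | rfl | hc
    · have := h1 c hc; omega
    · omega
    · exact (h3 c hc).le
  | special => exact hxc

lemma eq_of_append_cons_eq {A B A' B' : List ℕ} {x : ℕ} (hA : ∀ a ∈ A, a < x)
    (hA' : ∀ a ∈ A', a < x) (he : A ++ x :: B = A' ++ x :: B') : A = A' ∧ B = B' := by
  induction A generalizing A' with
  | nil =>
    cases A' with
    | nil => simpa using he
    | cons a A' =>
      simp only [List.nil_append, List.cons_append, List.cons.injEq] at he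
      have := hA' a (by simp)
      omega
  | cons a A ih =>
    cases A' with
    | nil =>
      simp only [List.nil_append, List.cons_append, List.cons.injEq] at he
      have := hA a (by simp)
      omega
    | cons a' A' =>
      simp only [List.cons_append, List.cons.injEq] at he
      obtain ⟨rfl, he⟩ := he
      obtain ⟨rfl, rfl⟩ := ih (fun b hb => hA b (by simp [hb]))
        (fun b hb => hA' b (by simp [hb])) he
      exact ⟨rfl, rfl⟩

/-- A column insertion that bumps a letter is determined by its outcome. -/
lemma ColStep.injective {x₁ x₂ y : ℕ} {C₁ C₂ C' : List ℕ} (h₁ : ColStep C₁ x₁ C' (some y))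
    (h₂ : ColStep C₂ x₂ C' (some y)) : C₁ = C₂ ∧ x₁ = x₂ := by
  have hx : x₁ = x₂ := by
    have := h₁.lt
    have := h₂.lt
    rcases lt_trichotomy x₁ x₂ with h | h | h
    · have := h₁.le_of_mem_new h₂.mem h; omega
    · exact h
    · have := h₂.le_of_mem_new h₁.mem h; omega
  subst hx
  refine ⟨?_, rfl⟩
  generalize hD : C' = D at h₂
  generalize hz : some y = z at h₂
  cases h₁ with
  | bump h1 h2 h3 =>
    cases h₂ with
    | app => simp at hz
    | bump h1' h2' h3' =>
      obtain ⟨rfl, rfl⟩ := eq_of_append_cons_eq h1 h1' hD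
      simp_all
    | special h1' h2' =>
      obtain ⟨rfl, rfl⟩ := eq_of_append_cons_eq h1 h1' hD
      have := h3 (x₁ + 1) (by simp)
      simp_all
  | special h1 h2 =>
    cases h₂ with
    | app => simp at hz
    | bump h1' h2' h3' =>
      obtain ⟨rfl, rfl⟩ := eq_of_append_cons_eq h1 h1' hD
      have := h3' (x₁ + 1) (by simp)
      simp_all
    | special h1' h2' => exact hD

/-! ### Increasing tableaux and insertion into them -/

/-- Column `D` can stand to the right of column `C` in a tableau with strictly increasing rows. -/
def ColLT (C D : List ℕ) : Prop := ∀ i d : ℕ, D[i]? = some d → ∃ c, C[i]? = some c ∧ c < d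

/-- Tableaux with strictly increasing rows and columns, as lists of columns. -/
def Tab : List (List ℕ) → Prop
  | [] => True
  | C :: P => C.Pairwise (· < ·) ∧ ColLT C (P.headD []) ∧ Tab P

/-- The column reading word: columns from right to left, each from top to bottom. -/
def colRead : List (List ℕ) → List ℕ
  | [] => []
  | C :: P => colRead P ++ C

/-- `EGIns P x P' j`: inserting `x` into `P` gives `P'`, with a new box in column `j`. -/
inductive EGIns : List (List ℕ) → ℕ → List (List ℕ) → ℕ → Prop
  | nil (x : ℕ) : EGIns [] x [[x]] 0
  | place {C C' : List ℕ} {x : ℕ} (P : List (List ℕ)) (h : ColStep C x C' none) :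
      EGIns (C :: P) x (C' :: P) 0
  | step {C C' : List ℕ} {x y j : ℕ} {P P' : List (List ℕ)} (h : ColStep C x C' (some y))
      (h' : EGIns P y P' j) : EGIns (C :: P) x (C' :: P') (j + 1)

lemma EGIns.egInsert_eq {P P' : List (List ℕ)} {x j : ℕ} (h : EGIns P x P' j) :
    egInsert P x = (P', j) := by
  induction h with
  | nil x => rfl
  | place P h => simp [egInsert, h.colIns_eq]
  | step h h' ih => simp [egInsert, h.colIns_eq, ih]

lemma Tab.pairwise_head {P : List (List ℕ)} (h : Tab P) : (P.headD []).Pairwise (· < ·) := by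
  cases P with
  | nil => simp
  | cons C P => exact h.1

lemma exists_egIns {P : List (List ℕ)} {x : ℕ} (hP : Tab P) (hr : Red (colRead P ++ [x])) :
    ∃ P' j, EGIns P x P' j := by
  induction P generalizing x with
  | nil => exact ⟨_, _, .nil x⟩
  | cons C P ih =>
    simp only [colRead, List.append_assoc] at hr
    obtain ⟨C', o, h⟩ := exists_colStep hP.1 (hr.right.succ_mem hP.1)
    cases o with
    | none => exact ⟨_, _, .place P h⟩
    | some y =>
      have hr' : Red ((colRead P ++ [y]) ++ C') := by
        refine hr.of_eq ?_ ?_ ?_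
        · intro z hz
          have hCx : ∀ z ∈ C', 1 ≤ z := by
            clear hz
            intro z hz
            refine hr.1 z ?_
            cases h <;> simp only [List.mem_append, List.mem_cons] at hz ⊢ <;> tauto
          simp only [List.mem_append, List.mem_singleton] at hz
          rcases hz with (hz | rfl) | hz
          · exact hr.1 z (by simp [hz])
          · exact Nat.one_le_of_lt h.lt
          · exact hCx z hz
        · simp [h.length_eq]
        · have := h.wordProd_eq
          simp only [wordProd_append, wordProd_cons, wordProd_nil, mul_one, mul_assoc] at this ⊢
          rw [this]
      obtain ⟨P', j, h'⟩ := ih hP.2.2 hr'.left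
      exact ⟨_, _, .step h h'⟩

lemma EGIns.wordProd_eq {P P' : List (List ℕ)} {x j : ℕ} (h : EGIns P x P' j) :
    wordProd (colRead P') = wordProd (colRead P ++ [x]) := by
  induction h with
  | nil x => rfl
  | place P h => cases h; simp [colRead]
  | step h h' ih =>
    have := h.wordProd_eq
    simp only [colRead, wordProd_append, wordProd_cons, wordProd_nil, mul_one, mul_assoc]
      at this ih ⊢
    rw [ih, this, mul_assoc]

lemma EGIns.length_colRead {P P' : List (List ℕ)} {x j : ℕ} (h : EGIns P x P' j) :
    (colRead P').length = (colRead P ++ [x]).length := by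
  induction h with
  | nil x => rfl
  | place P h => cases h; simp [colRead]
  | step h h' ih =>
    have := h.length_eq
    simp [colRead] at *
    omega

lemma EGIns.mem_colRead {P P' : List (List ℕ)} {x j : ℕ} (h : EGIns P x P' j) {t : ℕ}
    (ht : t ∈ colRead P') : t ∈ colRead P ∨ x ≤ t := by
  induction h with
  | nil x => simp [colRead] at ht; omega
  | place P h =>
    cases h
    simp only [colRead, List.mem_append, List.mem_singleton] at ht ⊢
    rcases ht with ht | ht | ht <;> [tauto; tauto; (right; omega)]
  | step h h' ih =>
    simp only [colRead, List.mem_append] at ht ⊢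
    rcases ht with ht | ht
    · have := h.lt
      rcases ih ht with h1 | h1
      · tauto
      · right; omega
    · cases h with
      | bump h1 h2 h3 =>
        simp only [List.mem_append, List.mem_cons] at ht ⊢
        rcases ht with ht | ht | ht <;> [tauto; (right; omega); tauto]
      | special h1 h2 => tauto

lemma EGIns.red {P P' : List (List ℕ)} {x j : ℕ} (h : EGIns P x P' j)
    (hr : Red (colRead P ++ [x])) : Red (colRead P') := by
  refine hr.of_eq (fun z hz => ?_) h.length_colRead h.wordProd_eq
  rcases h.mem_colRead hz with h1 | h1
  · exact hr.1 z (by simp [h1])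
  · exact (hr.1 x (by simp)).trans h1

lemma EGIns.red_rev {P P' : List (List ℕ)} {x j : ℕ} (h : EGIns P x P' j)
    (hp : ∀ z ∈ colRead P ++ [x], 1 ≤ z) (hr : Red (colRead P')) : Red (colRead P ++ [x]) :=
  hr.of_eq hp h.length_colRead.symm h.wordProd_eq.symm

lemma EGIns.colStep_head {P P' : List (List ℕ)} {x j : ℕ} (h : EGIns P x P' j) :
    ∃ o, ColStep (P.headD []) x (P'.headD []) o := by
  cases h with
  | nil x => exact ⟨_, by simpa using ColStep.app (C := []) (x := x) (by simp)⟩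
  | place P h => exact ⟨_, h⟩
  | step h h' => exact ⟨_, h⟩

/-- Insertion weakly decreases the entries of a column. -/
lemma ColStep.getElem?_le {x : ℕ} {C C' : List ℕ} {o : Option ℕ} (h : ColStep C x C' o) {i s : ℕ}
    (hs : C[i]? = some s) : ∃ t, C'[i]? = some t ∧ t ≤ s := by
  cases h with
  | app h =>
    have : i < C.length := by
      by_contra hc
      rw [List.getElem?_eq_none (by omega)] at hs
      simp at hs
    exact ⟨s, by rw [List.getElem?_append_left this, hs], le_rfl⟩
  | @bump A B x y h1 h2 h3 =>
    rcases lt_trichotomy i A.length with hi | hi | hi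
    · rw [List.getElem?_append_left hi] at hs ⊢
      exact ⟨s, hs, le_rfl⟩
    · subst hi
      simp at hs ⊢
      omega
    · rw [List.getElem?_append_right hi.le] at hs ⊢
      obtain ⟨k, hk⟩ := Nat.exists_eq_add_of_lt hi
      rw [show i - A.length = k + 1 by omega, List.getElem?_cons_succ] at hs ⊢
      exact ⟨s, hs, le_rfl⟩
  | special => exact ⟨s, hs, le_rfl⟩

/-- Changed entries of a column equal the inserted letter. -/
lemma ColStep.getElem?_new {x : ℕ} {C C' : List ℕ} {o : Option ℕ} (h : ColStep C x C' o) {i t : ℕ}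
    (ht : C'[i]? = some t) : C[i]? = some t ∨ (t = x ∧ ∀ k < i, ∃ c, C[k]? = some c ∧ c < x) := by
  have key : ∀ A : List ℕ, ∀ D : List ℕ, (∀ a ∈ A, a < x) → ∀ k < A.length,
      ∃ c, (A ++ D)[k]? = some c ∧ c < x := by
    intro A D hA k hk
    rw [List.getElem?_append_left hk, List.getElem?_eq_getElem hk]
    exact ⟨_, rfl, hA _ (List.getElem_mem hk)⟩
  cases h with
  | app h =>
    by_cases hi : i < C.length
    · left; rwa [List.getElem?_append_left hi] at ht
    · right
      rw [List.getElem?_append_right (by omega)] at ht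
      obtain ⟨h1, rfl⟩ : i - C.length = 0 ∧ x = t := by
        simpa [List.getElem?_singleton] using ht
      refine ⟨rfl, fun k hk => ?_⟩
      simpa using key C [] h k (by omega)
  | @bump A B x y h1 h2 h3 =>
    rcases lt_trichotomy i A.length with hi | hi | hi
    · rw [List.getElem?_append_left hi] at ht ⊢
      exact Or.inl ht
    · subst hi
      simp at ht
      exact Or.inr ⟨ht.symm, key A _ h1⟩
    · rw [List.getElem?_append_right hi.le] at ht ⊢
      obtain ⟨k, hk⟩ := Nat.exists_eq_add_of_lt hi
      rw [show i - A.length = k + 1 by omega, List.getElem?_cons_succ] at ht ⊢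
      exact Or.inl ht
  | special => exact Or.inl ht

/-- Given that `y` is bumped from `C`, the rows of `C'` that are available to `y` in the next
column `D`. -/
lemma ColStep.available {x y : ℕ} {C C' D : List ℕ} (h : ColStep C x C' (some y))
    (hR : ColLT C D) : ∃ k : ℕ, (∀ i ≤ k, ∃ c, C'[i]? = some c ∧ c < y) ∧
      ∀ d, D[k]? = some d → y ≤ d := by
  cases h with
  | @bump A B x y h1 h2 h3 =>
    refine ⟨A.length, fun i hi => ?_, fun d hd => ?_⟩
    · rcases hi.lt_or_eq with hi | rfl
      · rw [List.getElem?_append_left hi, List.getElem?_eq_getElem hi]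
        exact ⟨_, rfl, (h1 _ (List.getElem_mem hi)).trans h2⟩
      · simpa using h2
    · obtain ⟨c, hc, hcd⟩ := hR _ _ hd
      simp at hc
      omega
  | @special A B x h1 h2 =>
    refine ⟨A.length, fun i hi => ?_, fun d hd => ?_⟩
    · rcases hi.lt_or_eq with hi | rfl
      · rw [List.getElem?_append_left hi, List.getElem?_eq_getElem hi]
        exact ⟨_, rfl, (h1 _ (List.getElem_mem hi)).trans (by omega)⟩
      · simp
    · obtain ⟨c, hc, hcd⟩ := hR _ _ hd
      simp at hc
      omega

lemma ColLT.step {x y : ℕ} {C C' D D' : List ℕ} {o : Option ℕ} (hR : ColLT C D)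
    (h : ColStep C x C' (some y)) (h' : ColStep D y D' o) : ColLT C' D' := by
  intro i d hd
  rcases h'.getElem?_new hd with h1 | ⟨rfl, h1⟩
  · obtain ⟨c, hc, hcd⟩ := hR i d h1
    obtain ⟨c', hc', hcc⟩ := h.getElem?_le hc
    exact ⟨c', hc', by omega⟩
  · obtain ⟨k, hk, hD⟩ := h.available hR
    refine hk i ?_
    by_contra hki
    obtain ⟨e, he, hed⟩ := h1 k (by omega)
    have := hD e he
    omega

lemma EGIns.tab {P P' : List (List ℕ)} {x j : ℕ} (h : EGIns P x P' j) (hP : Tab P) : Tab P' := by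
  induction h with
  | nil x => simp [Tab, ColLT]
  | place P h =>
    refine ⟨h.pairwise hP.1, fun i d hd => ?_, hP.2.2⟩
    obtain ⟨c, hc, hcd⟩ := hP.2.1 i d hd
    obtain ⟨c', hc', hcc⟩ := h.getElem?_le hc
    exact ⟨c', hc', by omega⟩
  | step h h' ih =>
    obtain ⟨o, ho⟩ := h'.colStep_head
    exact ⟨h.pairwise hP.1, hP.2.1.step h ho, ih hP.2.2⟩

lemma EGIns.ne_nil {P P' : List (List ℕ)} {x j : ℕ} (h : EGIns P x P' j) (hP : ∀ C ∈ P, C ≠ []) :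
    ∀ C ∈ P', C ≠ [] := by
  induction h with
  | nil x => simp
  | place P h =>
    simp only [List.mem_cons] at hP ⊢
    rintro C (rfl | hC)
    · exact List.ne_nil_of_mem h.mem
    · exact hP C (Or.inr hC)
  | step h h' ih =>
    simp only [List.mem_cons] at hP ⊢
    rintro C (rfl | hC)
    · exact List.ne_nil_of_mem h.mem
    · exact ih (fun C hC => hP C (Or.inr hC)) C hC

lemma EGIns.injective {P₁ P₂ P' : List (List ℕ)} {x₁ x₂ j : ℕ} (h₁ : EGIns P₁ x₁ P' j)
    (h₂ : EGIns P₂ x₂ P' j) (hP₁ : ∀ C ∈ P₁, C ≠ []) (hP₂ : ∀ C ∈ P₂, C ≠ []) :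
    P₁ = P₂ ∧ x₁ = x₂ := by
  induction h₁ generalizing P₂ x₂ with
  | nil x =>
    cases h₂ with
    | nil => exact ⟨rfl, rfl⟩
    | place P h =>
      generalize hD : [x] = D at h
      cases h with
      | app h =>
        rename_i C
        have := hP₂ C (by simp)
        have := congrArg List.length hD
        simp at this
        simp_all
  | place P h =>
    rename_i C C' x
    cases h with
    | app h =>
      generalize hD : C ++ [x] = D at h₂
      cases h₂ with
      | nil x' =>
        have := hP₁ C (by simp)
        have := congrArg List.length hD
        simp at this
        simp_all
      | place P h' =>
        cases h' with
        | app h' =>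
          obtain ⟨rfl, h2⟩ := List.append_inj' hD rfl
          simp at h2
          exact ⟨rfl, h2⟩
  | step h h' ih =>
    cases h₂ with
    | step k k' =>
      obtain ⟨rfl, rfl⟩ := ih k' (fun C hC => hP₁ C (by simp [hC]))
        (fun C hC => hP₂ C (by simp [hC]))
      obtain ⟨rfl, rfl⟩ := h.injective k
      exact ⟨rfl, rfl⟩

lemma exists_split (y : ℕ) {C : List ℕ} (hC : C.Pairwise (· < ·)) :
    ∃ A B, C = A ++ B ∧ (∀ a ∈ A, a < y) ∧ ∀ b ∈ B, y ≤ b := by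
  induction C with
  | nil => exact ⟨[], [], by simp⟩
  | cons c C ih =>
    rw [List.pairwise_cons] at hC
    by_cases hc : c < y
    · obtain ⟨A, B, rfl, hA, hB⟩ := ih hC.2
      exact ⟨c :: A, B, rfl, by simpa using ⟨hc, hA⟩, hB⟩
    · refine ⟨[], c :: C, rfl, by simp, ?_⟩
      simp only [List.mem_cons]
      rintro b (rfl | hb)
      · omega
      · have := hC.1 b hb; omega

lemma lt_length_of_getElem? {C : List ℕ} {i t : ℕ} (h : C[i]? = some t) : i < C.length :=
  (List.getElem?_eq_some_iff.1 h).1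

lemma getElem?_append_cons {A B : List ℕ} {z i t : ℕ} (h : (A ++ z :: B)[i]? = some t)
    (hi : i ≠ A.length) (w : ℕ) : (A ++ w :: B)[i]? = some t := by
  rcases lt_trichotomy i A.length with hi | hi | hi
  · rw [List.getElem?_append_left hi] at h ⊢
    exact h
  · omega
  · rw [List.getElem?_append_right hi.le] at h ⊢
    obtain ⟨k, hk⟩ := Nat.exists_eq_add_of_lt hi
    rw [show i - A.length = k + 1 by omega, List.getElem?_cons_succ] at h ⊢
    exact h

lemma pairwise_getElem? {C : List ℕ} (hC : C.Pairwise (· < ·)) {i k s t : ℕ} (hs : C[i]? = some s)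
    (ht : C[k]? = some t) (hik : i < k) : s < t := by
  obtain ⟨h1, rfl⟩ := List.getElem?_eq_some_iff.1 hs
  obtain ⟨h2, rfl⟩ := List.getElem?_eq_some_iff.1 ht
  exact List.pairwise_iff_getElem.1 hC _ _ _ _ hik

/-- Reverse column insertion. -/
lemma exists_colStep_rev {y : ℕ} {C' D D' : List ℕ} {o : Option ℕ} (hC : C'.Pairwise (· < ·))
    (hR : ColLT C' D') (h : ColStep D y D' o) (hr : Red (y :: C')) (hD : D.Pairwise (· < ·)) :
    ∃ C x, ColStep C x C' (some y) ∧ C.Pairwise (· < ·) ∧ ColLT C D := by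
  obtain ⟨A, B, rfl, hA, hB⟩ := exists_split y hC
  have hRD : ColLT (A ++ B) D := by
    intro i d hd
    obtain ⟨d', hd', hdd⟩ := h.getElem?_le hd
    obtain ⟨c, hc, hcd⟩ := hR i d' hd'
    exact ⟨c, hc, by omega⟩
  have hlen : ∀ k : ℕ, D'[k]? = some y → k < A.length := by
    intro k hk
    obtain ⟨c, hc, hcy⟩ := hR k y hk
    by_contra hkA
    rw [List.getElem?_append_right (by omega)] at hc
    have := hB c (List.mem_of_getElem? hc)
    omega
  rcases List.eq_nil_or_concat A with rfl | ⟨A, x, rfl⟩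
  · obtain ⟨k, hk⟩ := List.mem_iff_getElem?.1 h.mem
    have := hlen k hk
    simp at this
  simp only [List.concat_eq_append, List.append_assoc, List.singleton_append] at *
  have hxy : x < y := hA x (by simp)
  by_cases hyB : y ∈ B
  · obtain ⟨z, rfl, hz⟩ := hr.pred_mem hC (by simp [hyB])
    have hzx : z = x := by
      simp only [List.pairwise_append, List.pairwise_cons, List.mem_cons] at hC
      simp only [List.mem_append, List.mem_cons] at hz
      rcases hz with hz | hz | hz
      · have := hC.2.2 z hz x (Or.inl rfl); omega
      · exact hz
      · have := hB z hz; omega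
    subst hzx
    have hx : ∃ B', B = (z + 1) :: B' := by
      rcases B with _ | ⟨b, B⟩
      · simp at hyB
      · refine ⟨B, ?_⟩
        simp only [List.pairwise_append, List.pairwise_cons, List.mem_cons] at hC
        rcases List.mem_cons.1 hyB with h | h
        · rw [h]
        · have := hC.2.1.2.1 _ h
          have := hB b (by simp)
          omega
    obtain ⟨B, rfl⟩ := hx
    refine ⟨_, z, .special ?_ ?_, hC, hRD⟩
    all_goals simp only [List.pairwise_append, List.pairwise_cons, List.mem_cons] at hC
    · exact fun a ha => hC.2.2 a ha z (Or.inl rfl)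
    · exact hC.2.1.2.1
  · have hB' : ∀ b ∈ B, y < b := fun b hb => by
      have := hB b hb
      have : b ≠ y := fun e => hyB (e ▸ hb)
      omega
    have hC' := hC
    simp only [List.pairwise_append, List.pairwise_cons, List.mem_cons] at hC'
    refine ⟨A ++ y :: B, x, .bump (fun a ha => hC'.2.2 a ha x (Or.inl rfl)) hxy hB', ?_, ?_⟩
    · simp only [List.pairwise_append, List.pairwise_cons, List.mem_cons]
      refine ⟨hC'.1, ⟨hB', hC'.2.1.2⟩, ?_⟩
      rintro a ha b (rfl | hb)
      · exact hA a (by simp [ha])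
      · exact hC'.2.2 a ha b (Or.inr hb)
    · intro i d hd
      by_cases hi : i = A.length
      · subst hi
        refine ⟨y, by simp, ?_⟩
        cases h with
        | app h =>
          have := hlen D.length (by simp)
          have := lt_length_of_getElem? hd
          simp at *
          omega
        | @bump A₂ B₂ _ z h1 h2 h3 =>
          have := hlen A₂.length (by simp)
          simp at this
          rcases (show A₂.length ≤ A.length by omega).lt_or_eq with h | h
          · exact h2.trans (pairwise_getElem? hD (i := A₂.length) (by simp) hd h)
          · rw [← h] at hd
            simp at hd
            omega
        | @special A₂ B₂ _ h1 h2 =>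
          have := hlen A₂.length (by simp)
          simp at this
          refine pairwise_getElem? hD (i := A₂.length) (by simp) hd ?_
          by_contra hlt
          obtain ⟨c, hc, hcy⟩ := hR (A₂.length + 1) (y + 1) (by
            simp)
          rw [show A₂.length + 1 = A.length + 1 by omega,
            List.getElem?_append_right (by omega), Nat.add_sub_cancel_left,
            List.getElem?_cons_succ] at hc
          have := hB' c (List.mem_of_getElem? hc)
          omega
      · obtain ⟨c, hc, hcd⟩ := hRD i d hd
        exact ⟨c, getElem?_append_cons hc hi _, hcd⟩

lemma ColLT.length_le {C D : List ℕ} (h : ColLT C D) : D.length ≤ C.length := by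
  by_contra hlt
  obtain ⟨c, hc, -⟩ := h C.length _ (List.getElem?_eq_getElem (by omega))
  simp at hc

/-- Reverse insertion into a tableau, starting from a corner. -/
lemma exists_egIns_rev {P' : List (List ℕ)} {j : ℕ} (hT : Tab P') (hne : ∀ C ∈ P', C ≠ [])
    (hr : Red (colRead P')) (hj : (P'.getD (j + 1) []).length < (P'.getD j []).length) :
    ∃ P x, EGIns P x P' j ∧ Tab P ∧ (∀ C ∈ P, C ≠ []) ∧ Red (colRead P ++ [x]) := by
  suffices ∃ P x, EGIns P x P' j ∧ Tab P ∧ (∀ C ∈ P, C ≠ []) ∧ ∀ z ∈ colRead P ++ [x], 1 ≤ z by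
    obtain ⟨P, x, h1, h2, h3, h4⟩ := this
    exact ⟨P, x, h1, h2, h3, h1.red_rev h4 hr⟩
  induction j generalizing P' with
  | zero =>
    rcases P' with _ | ⟨C', P⟩
    · simp at hj
    rcases List.eq_nil_or_concat C' with rfl | ⟨C, x, rfl⟩
    · simp at hj
    simp only [List.concat_eq_append] at *
    have hT1 := hT.1
    simp only [List.pairwise_append, List.pairwise_cons, List.mem_singleton] at hT1
    have hCx : ∀ c ∈ C, c < x := fun c hc => hT1.2.2 c hc x rfl
    have hpos : ∀ z ∈ colRead P ++ C ++ [x], 1 ≤ z := fun z hz => hr.1 z (by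
      simpa [colRead] using hz)
    rcases C with _ | ⟨c, C⟩
    · rcases P with _ | ⟨E, P⟩
      · exact ⟨[], x, .nil x, trivial, by simp, by simpa [colRead] using hpos⟩
      · have := hne E (by simp)
        simp at hj
        contradiction
    · refine ⟨(c :: C) :: P, x, .place P (.app hCx), ⟨hT1.1, ?_, hT.2.2⟩, ?_, hpos⟩
      · intro i d hd
        obtain ⟨e, he, hed⟩ := hT.2.1 i d hd
        have h1 := lt_length_of_getElem? hd
        have h2 : (P.headD []).length < (c :: C).length + 1 := by
          cases P <;> simp at hj ⊢ <;> omega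
        rw [List.getElem?_append_left (by omega)] at he
        exact ⟨e, he, hed⟩
      · simp only [List.mem_cons] at hne ⊢
        rintro E (rfl | hE)
        · simp
        · exact hne E (Or.inr hE)
  | succ j ih =>
    rcases P' with _ | ⟨C', P'⟩
    · simp at hj
    simp only [List.getD_cons_succ] at hj
    obtain ⟨P, y, h1, h2, h3, h4⟩ := ih hT.2.2 (fun C hC => hne C (by simp [hC])) hr.left hj
    obtain ⟨o, ho⟩ := h1.colStep_head
    have hr' : Red (colRead P ++ (y :: C')) := by
      refine hr.of_eq ?_ ?_ ?_
      · intro z hz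
        simp only [List.mem_append, List.mem_cons] at hz
        rcases hz with hz | rfl | hz
        · exact h4 z (by simp [hz])
        · exact h4 z (by simp)
        · exact hr.1 z (by simp [colRead, hz])
      · have := h1.length_colRead
        simp [colRead] at *
        omega
      · have := h1.wordProd_eq
        simp [colRead] at *
        rw [this, mul_assoc]
    obtain ⟨C, x, h5, h6, h7⟩ := exists_colStep_rev hT.1 hT.2.1 ho hr'.right h2.pairwise_head
    refine ⟨C :: P, x, .step h5 h1, ⟨h6, h7, h2⟩, ?_, ?_⟩
    · simp only [List.mem_cons]
      rintro E (rfl | hE)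
      · exact List.ne_nil_of_mem h5.bumped_mem
      · exact h3 E hE
    · have hC : ∀ z ∈ C ++ [x], 1 ≤ z := by
        intro z hz
        refine hr'.1 z ?_
        cases h5 <;> simp only [List.mem_append, List.mem_cons] at hz ⊢ <;> tauto
      intro z hz
      simp only [colRead, List.append_assoc, List.mem_append] at hz hC
      rcases hz with hz | hz
      · exact h4 z (by simp [hz])
      · exact hC z (by simpa using hz)

/-! ### Successive insertions -/

lemma ColStep.exists_of_mem {x c : ℕ} {C C' : List ℕ} {o : Option ℕ} (h : ColStep C x C' o)
    (hc : c ∈ C) (hxc : x < c) : ∃ y, o = some y ∧ y ≤ c := by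
  cases o with
  | none => cases h with
    | app h => have := h c hc; omega
  | some y => exact ⟨y, rfl, h.le_of_mem hc hxc⟩

lemma ColStep.lt_of_lt {x y x' y' : ℕ} {C C' C'' : List ℕ} (h : ColStep C x C' (some y))
    (h' : ColStep C' x' C'' (some y')) (hx : x < x') : y < y' := by
  have h1 := h'.bumped_mem
  have h2 := h'.lt
  have h3 := h.le_of_mem_new h1 (by omega)
  rcases h3.lt_or_eq with h3 | rfl
  · exact h3
  · cases h with
    | bump hA hxy hB =>
      simp only [List.mem_append, List.mem_cons] at h1
      rcases h1 with h1 | h1 | h1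
      · have := hA _ h1; omega
      · omega
      · have := hB _ h1; omega
    | special hA hB => omega

lemma EGIns.col_lt_of_gt {P P' P'' : List (List ℕ)} {x x' j j' : ℕ} (h : EGIns P x P' j)
    (h' : EGIns P' x' P'' j') (hx : x' < x) : j < j' := by
  induction h generalizing x' P'' j' with
  | nil x =>
    cases h' with
    | place P h =>
      obtain ⟨y, hy, -⟩ := h.exists_of_mem (c := x) (by simp) hx
      simp at hy
    | step => omega
  | place P h =>
    cases h' with
    | place P h' =>
      obtain ⟨y, hy, -⟩ := h'.exists_of_mem h.mem hx
      simp at hy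
    | step => omega
  | step h k ih =>
    cases h' with
    | place P h' =>
      obtain ⟨y, hy, -⟩ := h'.exists_of_mem h.mem hx
      simp at hy
    | step h' k' =>
      have h1 := h'.le_of_mem h.mem hx
      have h2 := h.lt
      have := ih k' (by omega)
      omega

lemma EGIns.col_le_of_lt {P P' P'' : List (List ℕ)} {x x' j j' : ℕ} (h : EGIns P x P' j)
    (h' : EGIns P' x' P'' j') (hx : x < x') : j' ≤ j := by
  induction h generalizing x' P'' j' with
  | nil x =>
    cases h' with
    | place P h => rfl
    | step h k =>
      have h1 := h.bumped_mem
      have h2 := h.lt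
      simp at h1
      omega
  | place P h =>
    cases h' with
    | place P h' => rfl
    | step h' k =>
      have h1 := h'.bumped_mem
      have h2 := h'.lt
      cases h with
      | app h =>
        simp only [List.mem_append, List.mem_singleton] at h1
        rcases h1 with h1 | h1
        · have := h _ h1; omega
        · omega
  | step h k ih =>
    cases h' with
    | place P h' => omega
    | step h' k' =>
      have := ih k' (h.lt_of_lt h' hx)
      omega

/-! ### Shapes and entries -/

lemma EGIns.length_getD {P P' : List (List ℕ)} {x j : ℕ} (h : EGIns P x P' j) (c : ℕ) :
    (P'.getD c []).length = (P.getD c []).length + if c = j then 1 else 0 := by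
  induction h generalizing c with
  | nil x => cases c <;> simp
  | place P h => cases h; cases c <;> simp
  | step h k ih =>
    cases c with
    | zero => simpa using h.length_eq
    | succ c => simpa using ih c

lemma EGIns.entry_le {P P' : List (List ℕ)} {x j : ℕ} (h : EGIns P x P' j) {c i s : ℕ}
    (hs : (P.getD c [])[i]? = some s) : ∃ t, (P'.getD c [])[i]? = some t ∧ t ≤ s := by
  induction h generalizing c with
  | nil x => simp at hs
  | place P h =>
    cases c with
    | zero => exact h.getElem?_le hs
    | succ c => exact ⟨s, hs, le_rfl⟩
  | step h k ih =>
    cases c with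
    | zero => exact h.getElem?_le hs
    | succ c => exact ih hs

/-- Changed entries in column `c` are at least `x + c`. -/
lemma EGIns.entry_new {P P' : List (List ℕ)} {x j : ℕ} (h : EGIns P x P' j) {c i t : ℕ}
    (ht : (P'.getD c [])[i]? = some t) : (P.getD c [])[i]? = some t ∨ x + c ≤ t := by
  induction h generalizing c with
  | nil x =>
    right
    cases c with
    | zero =>
      have := List.mem_of_getElem? ht
      simp at this
      omega
    | succ c => simp at ht
  | place P h =>
    cases c with
    | zero => rcases h.getElem?_new ht with h | h <;> [exact Or.inl h; (right; omega)]
    | succ c => exact Or.inl ht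
  | step h k ih =>
    cases c with
    | zero => rcases h.getElem?_new ht with h | h <;> [exact Or.inl h; (right; omega)]
    | succ c =>
      have := h.lt
      rcases ih ht with h | h <;> [exact Or.inl h; (right; omega)]

/-- The new box lies weakly above row `k` if the letter is smaller than the `k`-th entry of the
first column. -/
lemma EGIns.row_le {P P' : List (List ℕ)} {x j : ℕ} (h : EGIns P x P' j) (hP : Tab P) {k : ℕ}
    (hk : ∀ d, (P.headD [])[k]? = some d → x < d) : (P.getD j []).length ≤ k := by
  induction h generalizing k with
  | nil x => simp
  | place P h =>
    cases h with
    | app h =>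
      rename_i C
      by_contra hlt
      simp at hlt
      have := hk _ (List.getElem?_eq_getElem hlt)
      have := h _ (List.getElem_mem hlt)
      omega
  | step h k' ih =>
    simp only [List.getD_cons_succ]
    cases h with
    | @bump A B x y h1 h2 h3 =>
      have hA : A.length ≤ k := by
        by_contra hlt
        push Not at hlt
        have := hk A[k] (by simp [List.getElem?_append_left hlt])
        have := h1 _ (List.getElem_mem hlt)
        omega
      refine (ih hP.2.2 (k := A.length) fun d hd => ?_).trans hA
      obtain ⟨c, hc, hcd⟩ := hP.2.1 _ _ hd
      simp at hc
      omega
    | @special A B x h1 h2 =>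
      have hA : A.length + 1 ≤ k := by
        by_contra hlt
        push Not at hlt
        rcases (Nat.le_of_lt_succ hlt).lt_or_eq with hlt | rfl
        · have := hk A[k] (by simp [List.getElem?_append_left hlt])
          have := h1 _ (List.getElem_mem hlt)
          omega
        · have := hk _ (by simp; rfl)
          omega
      refine (ih hP.2.2 (k := A.length + 1) fun d hd => ?_).trans hA
      obtain ⟨c, hc, hcd⟩ := hP.2.1 _ _ hd
      simp at hc
      omega

/-- If a letter `m < R` is inserted and the new box in column `j'` has an entry at least `R + j'`,
then some earlier column has a gap weakly below the row of the new box. -/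
lemma EGIns.exists_gap {P P' : List (List ℕ)} {m j' : ℕ} (h : EGIns P m P' j') (hP : Tab P)
    {R t : ℕ} (hm : m < R) (ht : (P'.getD j' [])[(P.getD j' []).length]? = some t)
    (hRt : R + j' ≤ t) :
    ∃ j < j', ∃ i u, (P.getD j' []).length ≤ i ∧ (P'.getD j [])[i]? = some u ∧ u < R + j ∧
      ∀ w, (P'.getD j [])[i + 1]? = some w → R + j + 2 ≤ w := by
  induction h generalizing R with
  | nil x => simp at ht; omega
  | place P h =>
    cases h with
    | app h => simp at ht; omega
  | @step C C' x y j P P' h k ih =>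
    by_cases hy : y < R + 1
    · obtain ⟨j₁, hj₁, i, u, h1, h2, h3, h4⟩ := ih hP.2.2 hy ht (by omega)
      refine ⟨j₁ + 1, by omega, i, u, h1, h2, by omega, fun w hw => ?_⟩
      have := h4 w hw
      omega
    · cases h with
      | @bump A B x y h1 h2 h3 =>
        refine ⟨0, by omega, A.length, x, ?_, by simp, by omega, fun w hw => ?_⟩
        · refine k.row_le hP.2.2 fun d hd => ?_
          obtain ⟨c, hc, hcd⟩ := hP.2.1 _ _ hd
          simp at hc
          omega
        · simp [List.getElem?_append_right] at hw
          have := h3 w (List.mem_of_getElem? hw)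
          omega
      | special => omega

/-! ### Rank positions of the boxes of the Rothe diagram -/

/-- `w` contains no pattern `2143`. -/
def Avoids2143 (w : Perm') : Prop :=
  ¬ ∃ i j k l : ℕ, 1 ≤ i ∧ i < j ∧ j < k ∧ k < l ∧ w j < w i ∧ w i < w l ∧ w l < w k

/-- The number of dots of `w` strictly northwest of `(x, y)`. -/
def rk (w : Perm') (x y : ℕ) : ℕ := ((Finset.Ico 1 x).filter fun p => w p < y).card

/-- Row `x` of the Rothe diagram of `w` contains a box which moves to the (`0`-indexed) position
`(i, j)` when it is pushed to the northwest by the number of dots northwest of it. -/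
def BoxAt (w : Perm') (i j x : ℕ) : Prop :=
  1 ≤ x ∧ ∃ k, x < k ∧ w k < w x ∧ rk w x (w k) + i + 1 = x ∧ rk w x (w k) + j + 1 = w k

/-- The product `s_{a+c-1} ⋯ s_{a+1} s_a`. -/
def descProd (a : ℕ) : ℕ → Perm'
  | 0 => 1
  | c + 1 => sT (a + c) * descProd a c

lemma descProd_apply (a c k : ℕ) : descProd a c k =
    if k < a then k else if k = a then a + c else if k ≤ a + c then k - 1 else k := by
  induction c with
  | zero =>
    simp only [descProd, Equiv.Perm.coe_one, id_eq]
    split_ifs <;> omega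
  | succ c ih =>
    simp only [descProd, Equiv.Perm.mul_apply, ih, sT_apply]
    split_ifs <;> omega

lemma descProd_succ (a c : ℕ) : descProd a (c + 1) = descProd (a + 1) c * sT a := by
  induction c generalizing a with
  | zero => simp [descProd]
  | succ c ih =>
    rw [descProd, ih a, ← mul_assoc]
    congr 1
    rw [descProd, show a + (c + 1) = a + 1 + c by omega]

section
variable {v X : Perm'} {a c : ℕ}

lemma lt_apply_of_fix (hX : ∀ k ≤ a, X k = k) {k : ℕ} (hk : a < k) : a < X k := by
  by_contra h
  push Not at h
  have := X.injective (hX _ h)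
  omega

lemma eq_of_descProd (hX : ∀ k ≤ a, X k = k) (hv : v = descProd a c * X) :
    (∀ k < a, v k = k) ∧ v a = a + c ∧
      ∀ k, a < k → a < X k ∧ ((X k ≤ a + c ∧ v k + 1 = X k) ∨ (a + c < X k ∧ v k = X k)) := by
  subst hv
  refine ⟨fun k hk => ?_, ?_, fun k hk => ?_⟩
  · rw [Equiv.Perm.mul_apply, hX k hk.le, descProd_apply, if_pos hk]
  · rw [Equiv.Perm.mul_apply, hX a le_rfl, descProd_apply]; simp
  · have h := lt_apply_of_fix hX hk
    refine ⟨h, ?_⟩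
    rw [Equiv.Perm.mul_apply, descProd_apply]
    split_ifs <;> omega

lemma avoids_of_descProd (hX : ∀ k ≤ a, X k = k) (hv : v = descProd a c * X)
    (h : Avoids2143 v) : Avoids2143 X := by
  rintro ⟨i, j, k, l, h1, h2, h3, h4, h5, h6, h7⟩
  obtain ⟨-, -, h8⟩ := eq_of_descProd hX hv
  have hi : a < i := by
    by_contra hi
    push Not at hi
    rw [hX i hi] at h5
    have h9 := hX (X j) (by omega)
    have := X.injective h9
    omega
  have e1 := h8 i hi
  have e2 := h8 j (by omega)
  have e3 := h8 k (by omega)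
  have e4 := h8 l (by omega)
  exact h ⟨i, j, k, l, h1, h2, h3, h4, by omega, by omega, by omega⟩

lemma rk_le (w : Perm') (x y : ℕ) : rk w x y ≤ x - 1 := by
  refine (Finset.card_filter_le _ _).trans ?_
  simp

/-- The boxes of the Rothe diagram below row `a` and their ranks. -/
lemma box_step (ha : 1 ≤ a) (hX : ∀ k ≤ a, X k = k) (hv : v = descProd a c * X)
    (hav : Avoids2143 v) {x k : ℕ} (hx : a < x) (hxk : x < k) (hkx : v k < v x) :
    (v k + 1 = X k ∧ rk X x (X k) = rk v x (v k) + 1 ∧ a ≤ rk X x (X k) ∧ X k ≤ a + c) ∨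
      (v k = X k ∧ rk X x (X k) = rk v x (v k) ∧ rk v x (v k) + c + 1 ≤ v k) := by
  obtain ⟨h1, h2, h3⟩ := eq_of_descProd hX hv
  obtain ⟨hk, hk' | hk'⟩ := h3 k (by omega)
  · left
    refine ⟨hk'.2, ?_, ?_, hk'.1⟩
    · have : (Finset.Ico 1 x).filter (fun p => X p < X k) =
          insert a ((Finset.Ico 1 x).filter (fun p => v p < v k)) := by
        ext p
        simp only [Finset.mem_filter, Finset.mem_Ico, Finset.mem_insert]
        rcases lt_trichotomy p a with hp | rfl | hp
        · have := h1 p hp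
          have := hX p hp.le
          omega
        · have := hX p le_rfl
          omega
        · have := h3 p hp
          omega
      rw [rk, this, Finset.card_insert_of_notMem, rk]
      simp only [Finset.mem_filter, Finset.mem_Ico, h2]
      omega
    · calc a = (Finset.Ico 1 (a + 1)).card := by simp
        _ ≤ _ := by
          refine Finset.card_le_card fun p hp => ?_
          simp only [Finset.mem_filter, Finset.mem_Ico] at hp ⊢
          have := hX p (by omega)
          omega
  · right
    refine ⟨hk'.2, ?_, ?_⟩
    · refine congrArg Finset.card (Finset.filter_congr fun p hp => ?_)
      simp only [Finset.mem_Ico] at hp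
      rcases lt_trichotomy p a with hp | rfl | hp
      · have := h1 p hp
        have := hX p hp.le
        omega
      · have := hX p le_rfl
        omega
      · have := h3 p hp
        omega
    · have hsub : ((Finset.Ico 1 x).filter (fun p => v p < v k)).image v ⊆
          Finset.Ico 1 (v k) \ Finset.Ico a (a + c) := by
        intro q hq
        simp only [Finset.mem_image, Finset.mem_filter, Finset.mem_Ico, Finset.mem_sdiff] at hq ⊢
        obtain ⟨p, ⟨⟨hp1, hp2⟩, hp3⟩, rfl⟩ := hq
        rcases lt_trichotomy p a with hp | rfl | hp
        · have := h1 p hp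
          omega
        · omega
        · have := h3 p hp
          refine ⟨by omega, fun hq => hav ⟨a, p, x, k, ha, hp, hp2, hxk, by omega, by omega, hkx⟩⟩
      have h := Finset.card_le_card hsub
      rw [Finset.card_image_of_injective _ v.injective, Finset.card_sdiff_of_subset] at h
      · simp only [Nat.card_Ico] at h
        unfold rk
        omega
      · intro q hq
        simp only [Finset.mem_Ico] at hq ⊢
        omega

lemma lt_iff_of_descProd (hX : ∀ k ≤ a, X k = k) (hv : v = descProd a c * X) {x k : ℕ}
    (hx : a < x) (hk : a < k) : v k < v x ↔ X k < X x := by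
  obtain ⟨-, -, h⟩ := eq_of_descProd hX hv
  have h1 := h x hx
  have h2 := h k hk
  have h3 : v k = v x ↔ X k = X x := by rw [v.injective.eq_iff, X.injective.eq_iff]
  omega

lemma BoxAt.lt_of_fix (hX : ∀ k ≤ a, X k = k) {i j x : ℕ} (h : BoxAt X i j x) : a < x := by
  obtain ⟨-, k, hxk, hkx, -⟩ := h
  by_contra hx
  push Not at hx
  rw [hX x hx] at hkx
  have := X.injective (hX (X k) (by omega))
  omega

lemma rk_of_fix (hfix : ∀ k < a, v k = k) {k : ℕ} (hk : a < k) : rk v a (v k) = a - 1 := by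
  have hvk : a ≤ v k := by
    by_contra hlt
    have := v.injective (hfix (v k) (by omega))
    omega
  unfold rk
  rw [Finset.filter_true_of_mem, Nat.card_Ico]
  intro p hp
  simp only [Finset.mem_Ico] at hp
  have := hfix p (by omega)
  omega

lemma boxAt_iff_of_ge (ha : 1 ≤ a) (hX : ∀ k ≤ a, X k = k) (hv : v = descProd a c * X)
    (hav : Avoids2143 v) {i j x : ℕ} (hj : c ≤ j) : BoxAt v i j x ↔ BoxAt X i j x := by
  have hfix := (eq_of_descProd hX hv).1
  have hva := (eq_of_descProd hX hv).2.1
  constructor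
  · intro h
    have hax : a < x := by
      have h1 := BoxAt.lt_of_fix (a := a - 1) (fun k hk => hfix k (by omega)) h
      obtain ⟨hx, k, hxk, hkx, h2, h3⟩ := h
      by_contra hax
      have : x = a := by omega
      subst this
      have := rk_of_fix hfix hxk
      omega
    obtain ⟨hx, k, hxk, hkx, h2, h3⟩ := h
    refine ⟨hx, k, hxk, (lt_iff_of_descProd hX hv hax (by omega)).1 hkx, ?_⟩
    rcases box_step ha hX hv hav hax hxk hkx with h | h <;> omega
  · intro h
    have hax := h.lt_of_fix hX
    obtain ⟨hx, k, hxk, hkx, h2, h3⟩ := h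
    have hkx' := (lt_iff_of_descProd hX hv hax (by omega)).2 hkx
    refine ⟨hx, k, hxk, hkx', ?_⟩
    rcases box_step ha hX hv hav hax hxk hkx' with h | h <;> omega

lemma boxAt_succ_iff_of_lt (ha : 1 ≤ a) (hX : ∀ k ≤ a, X k = k) (hv : v = descProd a c * X)
    (hav : Avoids2143 v) {i j x : ℕ} (hj : j < c) : BoxAt v (i + 1) j x ↔ BoxAt X i j x := by
  have hfix := (eq_of_descProd hX hv).1
  constructor
  · intro h
    have hax : a < x := by
      have h1 := BoxAt.lt_of_fix (a := a - 1) (fun k hk => hfix k (by omega)) h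
      obtain ⟨hx, k, hxk, hkx, h2, h3⟩ := h
      by_contra hax
      have : x = a := by omega
      subst this
      have := rk_of_fix hfix hxk
      omega
    obtain ⟨hx, k, hxk, hkx, h2, h3⟩ := h
    refine ⟨hx, k, hxk, (lt_iff_of_descProd hX hv hax (by omega)).1 hkx, ?_⟩
    rcases box_step ha hX hv hav hax hxk hkx with h | h <;> omega
  · intro h
    have hax := h.lt_of_fix hX
    obtain ⟨hx, k, hxk, hkx, h2, h3⟩ := h
    have hkx' := (lt_iff_of_descProd hX hv hax (by omega)).2 hkx
    refine ⟨hx, k, hxk, hkx', ?_⟩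
    rcases box_step ha hX hv hav hax hxk hkx' with h | h <;> omega

lemma boxAt_zero_iff_of_lt (ha : 1 ≤ a) (hX : ∀ k ≤ a, X k = k) (hv : v = descProd a c * X)
    (hav : Avoids2143 v) {j x : ℕ} (hj : j < c) : BoxAt v 0 j x ↔ x = a := by
  obtain ⟨hfix, hva, -⟩ := eq_of_descProd hX hv
  constructor
  · intro h
    have h1 := BoxAt.lt_of_fix (a := a - 1) (fun k hk => hfix k (by omega)) h
    by_contra hax
    obtain ⟨hx, k, hxk, hkx, h2, h3⟩ := h
    rcases box_step ha hX hv hav (by omega) hxk hkx with h | h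
    · have := rk_le X x (X k)
      omega
    · omega
  · rintro rfl
    have hk : x < v.symm (x + j) := by
      by_contra hlt
      push Not at hlt
      rcases hlt.lt_or_eq with h | h
      · have := hfix _ h
        rw [Equiv.apply_symm_apply] at this
        omega
      · have := congrArg v h
        rw [Equiv.apply_symm_apply] at this
        omega
    refine ⟨ha, v.symm (x + j), hk, ?_, ?_, ?_⟩
    · rw [Equiv.apply_symm_apply]; omega
    · rw [rk_of_fix hfix hk]; omega
    · rw [rk_of_fix hfix hk, Equiv.apply_symm_apply]; omega

end

/-! ### The insertion tableau of a vexillary permutation -/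

lemma colRead_append (A B : List (List ℕ)) : colRead (A ++ B) = colRead B ++ colRead A := by
  induction A with
  | nil => simp [colRead]
  | cons C A ih => simp [colRead, ih]

lemma wordProd_apply_of_le {l : List ℕ} {a k : ℕ} (hl : ∀ x ∈ l, a + 1 ≤ x) (hk : k ≤ a) :
    wordProd l k = k := by
  induction l with
  | nil => simp
  | cons x l ih =>
    simp only [List.mem_cons, forall_eq_or_imp] at hl
    rw [wordProd_cons, Equiv.Perm.mul_apply, ih hl.2, sT_apply]
    split_ifs <;> omega

lemma wordProd_column {C : List ℕ} (hC : C.Pairwise (· < ·)) (k : ℕ) :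
    wordProd C k ≤ k + 1 ∧ (wordProd C k = k + 1 → k ∈ C) := by
  induction C with
  | nil => simp
  | cons c C ih =>
    rw [List.pairwise_cons] at hC
    obtain ⟨h1, h2⟩ := ih hC.2
    rw [wordProd_cons, Equiv.Perm.mul_apply, sT_apply, List.mem_cons]
    have h3 : wordProd C k = k + 1 → c < k := fun h => hC.1 k (h2 h)
    split_ifs with h4 h5
    · refine ⟨?_, fun h => Or.inl ?_⟩ <;> by_contra <;> have := h3 (by omega) <;> omega
    · refine ⟨by omega, fun h => by omega⟩
    · exact ⟨h1, fun h => Or.inr (h2 h)⟩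

lemma Tab.pairwise {P : List (List ℕ)} (hP : Tab P) {C : List ℕ} (h : C ∈ P) :
    C.Pairwise (· < ·) := by
  induction P with
  | nil => simp at h
  | cons D P ih =>
    rcases List.mem_cons.1 h with rfl | h
    · exact hP.1
    · exact ih hP.2.2 h

lemma wordProd_colRead {P : List (List ℕ)} (hP : ∀ C ∈ P, C.Pairwise (· < ·)) (k : ℕ) :
    wordProd (colRead P) k ≤ k + P.length ∧
      (wordProd (colRead P) k = k + P.length → ∀ j C, P[j]? = some C → k + j ∈ C) := by
  induction P generalizing k with
  | nil => simp [colRead]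
  | cons C P ih =>
    simp only [List.mem_cons, forall_eq_or_imp] at hP
    obtain ⟨h1, h2⟩ := wordProd_column hP.1 k
    obtain ⟨h3, h4⟩ := ih hP.2 (wordProd C k)
    rw [colRead, wordProd_append, Equiv.Perm.mul_apply, List.length_cons]
    refine ⟨by omega, fun h j D hD => ?_⟩
    cases j with
    | zero =>
      simp only [List.getElem?_cons_zero, Option.some.injEq] at hD
      subst hD
      exact h2 (by omega)
    | succ j =>
      have h5 : wordProd C k = k + 1 := by omega
      have := h4 (by omega) j D (by simpa using hD)
      rwa [h5, show k + 1 + j = k + (j + 1) by omega] at this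

lemma getElem?_of_forall_mem {l : List ℕ} {b m : ℕ} (hl : l.Pairwise (· < ·))
    (hb : ∀ x ∈ l, b ≤ x) (h : ∀ t < m, b + t ∈ l) : ∀ t < m, l[t]? = some (b + t) := by
  induction l generalizing b m with
  | nil =>
    intro t ht
    simpa using h t ht
  | cons x l ih =>
    intro t ht
    rw [List.pairwise_cons] at hl
    simp only [List.mem_cons, forall_eq_or_imp] at hb
    have hx : x = b := by
      rcases List.mem_cons.1 (h 0 (by omega)) with h | h
      · simpa using h.symm
      · have := hl.1 _ h
        omega
    subst hx
    cases t with
    | zero => simp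
    | succ t =>
      rw [List.getElem?_cons_succ,
        ih (b := x + 1) (m := m - 1) hl.2 (fun y hy => hl.1 y hy) _ t (by omega)]
      · congr 1; omega
      · intro s hs
        rcases List.mem_cons.1 (h (s + 1) (by omega)) with h | h
        · omega
        · rwa [show x + 1 + s = x + (s + 1) by omega]

lemma pairwise_getElem?_ge {C : List ℕ} (hC : C.Pairwise (· < ·)) {a : ℕ} (ha : ∀ d ∈ C, a ≤ d)
    {i t : ℕ} (h : C[i]? = some t) : a + i ≤ t := by
  induction C generalizing a i with
  | nil => simp at h
  | cons x C ih =>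
    rw [List.pairwise_cons] at hC
    cases i with
    | zero =>
      simp only [List.getElem?_cons_zero, Option.some.injEq] at h
      exact ha t (by simp [h])
    | succ i =>
      have hax := ha x (by simp)
      have := ih (a := a + 1) hC.2 (fun d hd => by have := hC.1 d hd; omega) (by simpa using h)
      omega

lemma ColLT.forall_mem {C D : List ℕ} (h : ColLT C D) {a : ℕ} (ha : ∀ d ∈ C, a ≤ d) :
    ∀ d ∈ D, a + 1 ≤ d := by
  intro d hd
  obtain ⟨i, hi⟩ := List.mem_iff_getElem?.1 hd
  obtain ⟨c, hc, hcd⟩ := h i d hi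
  have := ha c (List.mem_of_getElem? hc)
  omega

lemma Tab.forall_mem_colRead {P : List (List ℕ)} (hP : Tab P) {a : ℕ}
    (ha : ∀ d ∈ P.headD [], a ≤ d) : ∀ x ∈ colRead P, a ≤ x := by
  induction P generalizing a with
  | nil => simp [colRead]
  | cons C P ih =>
    intro x hx
    rcases List.mem_append.1 hx with hx | hx
    · have := ih hP.2.2 (hP.2.1.forall_mem ha) x hx
      omega
    · exact ha x hx

/-- Prepend the entries `a, a + 1, …` to the columns of a tableau. -/
def consHeads (a : ℕ) : List (List ℕ) → List (List ℕ)
  | [] => []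
  | C :: S => (a :: C) :: consHeads (a + 1) S

@[simp] lemma length_consHeads (a : ℕ) (S : List (List ℕ)) :
    (consHeads a S).length = S.length := by
  induction S generalizing a with
  | nil => rfl
  | cons C S ih => simp [consHeads, ih]

lemma exists_consHeads {T : List (List ℕ)} {a : ℕ} (hT : Tab T) (ha : ∀ d ∈ T.headD [], a ≤ d) :
    ∃ S U, T = consHeads a S ++ U ∧ ∀ d ∈ U.headD [], a + S.length + 1 ≤ d := by
  induction T generalizing a with
  | nil => exact ⟨[], [], rfl, by simp⟩
  | cons C P ih =>
    obtain ⟨h1, h2, h3⟩ := hT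
    cases C with
    | nil => exact ⟨[], [] :: P, rfl, by simp⟩
    | cons x C =>
      rcases (ha x (by simp)).eq_or_lt with rfl | hx
      · obtain ⟨S, U, rfl, h4⟩ := ih h3 (h2.forall_mem ha)
        exact ⟨C :: S, U, rfl, fun d hd => by have := h4 d hd; simp only [List.length_cons]; omega⟩
      · refine ⟨[], (x :: C) :: P, rfl, fun d hd => ?_⟩
        rw [List.pairwise_cons] at h1
        rcases List.mem_cons.1 hd with rfl | hd
        · simpa using hx
        · have := h1.1 d hd
          simp only [List.length_nil]
          omega

lemma forall_mem_of_consHeads {S U : List (List ℕ)} {a : ℕ} (hT : Tab (consHeads a S ++ U))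
    (hU : ∀ d ∈ U.headD [], a + S.length + 1 ≤ d) : ∀ x ∈ colRead (S ++ U), a + 1 ≤ x := by
  induction S generalizing a with
  | nil => exact hT.forall_mem_colRead hU
  | cons C S ih =>
    intro x hx
    rcases List.mem_append.1 hx with hx | hx
    · have := ih hT.2.2 (fun d hd => by
        have := hU d hd
        simp only [List.length_cons] at this
        omega) x hx
      omega
    · exact (List.pairwise_cons.1 hT.1).1 x hx

lemma wordProd_consHeads {S U : List (List ℕ)} {a : ℕ} (hT : Tab (consHeads a S ++ U))
    (hU : ∀ d ∈ U.headD [], a + S.length + 1 ≤ d) :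
    wordProd (colRead (consHeads a S ++ U)) =
      descProd a S.length * wordProd (colRead (S ++ U)) := by
  induction S generalizing a with
  | nil => simp [consHeads, descProd]
  | cons C S ih =>
    have hU' : ∀ d ∈ U.headD [], a + 1 + S.length + 1 ≤ d := fun d hd => by
      have := hU d hd; simp only [List.length_cons] at this; omega
    rw [consHeads, List.cons_append, colRead, wordProd_append, ih hT.2.2 hU', wordProd_cons,
      List.length_cons, descProd_succ, List.cons_append, colRead, wordProd_append, mul_assoc,
      mul_assoc, ← mul_assoc (sT a),
      sT_comm_wordProd_of_lt (forall_mem_of_consHeads hT.2.2 hU'), mul_assoc]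

lemma length_colRead_consHeads (a : ℕ) (S U : List (List ℕ)) :
    (colRead (consHeads a S ++ U)).length = S.length + (colRead (S ++ U)).length := by
  induction S generalizing a with
  | nil => simp [consHeads]
  | cons C S ih =>
    simp only [consHeads, List.cons_append, colRead, List.length_append, ih, List.length_cons]
    omega

lemma mem_colRead_consHeads {a x : ℕ} {S U : List (List ℕ)} (h : x ∈ colRead (S ++ U)) :
    x ∈ colRead (consHeads a S ++ U) := by
  induction S generalizing a with
  | nil => exact h
  | cons C S ih =>
    rcases List.mem_append.1 h with h | h
    · exact List.mem_append_left _ (ih h)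
    · exact List.mem_append_right _ (List.mem_cons_of_mem _ h)

lemma exists_word_descProd (a c : ℕ) :
    ∃ l : List ℕ, l.length = c ∧ (∀ x ∈ l, a ≤ x) ∧ wordProd l = descProd a c := by
  induction c with
  | zero => exact ⟨[], rfl, by simp, rfl⟩
  | succ c ih =>
    obtain ⟨l, h1, h2, h3⟩ := ih
    refine ⟨(a + c) :: l, by simp [h1], ?_, by rw [wordProd_cons, h3, descProd]⟩
    simp only [List.mem_cons, forall_eq_or_imp]
    exact ⟨by omega, h2⟩

lemma red_of_consHeads {S U : List (List ℕ)} {a : ℕ} (ha : 1 ≤ a) (hT : Tab (consHeads a S ++ U))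
    (hU : ∀ d ∈ U.headD [], a + S.length + 1 ≤ d) (hr : Red (colRead (consHeads a S ++ U))) :
    Red (colRead (S ++ U)) := by
  obtain ⟨l, h1, h2, h3⟩ := exists_word_descProd a S.length
  refine Red.right (l := l) (hr.of_eq ?_ ?_ ?_)
  · intro x hx
    rcases List.mem_append.1 hx with hx | hx
    · exact ha.trans (h2 x hx)
    · have := forall_mem_of_consHeads hT hU x hx
      omega
  · rw [List.length_append, h1, length_colRead_consHeads]
  · rw [wordProd_append, h3, wordProd_consHeads hT hU]

lemma getD_consHeads_append (a : ℕ) (S U : List (List ℕ)) (j : ℕ) :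
    (consHeads a S ++ U).getD j [] =
      if j < S.length then (a + j) :: (S ++ U).getD j [] else (S ++ U).getD j [] := by
  induction S generalizing a j with
  | nil => simp [consHeads]
  | cons C S ih =>
    cases j with
    | zero => simp [consHeads]
    | succ j =>
      simp only [consHeads, List.cons_append, List.getD_cons_succ, ih, List.length_cons,
        Nat.add_lt_add_iff_right]
      rw [show a + 1 + j = a + (j + 1) by omega]

lemma tab_of_consHeads {S U : List (List ℕ)} {a : ℕ} (hT : Tab (consHeads a S ++ U))
    (hS : ∀ C, S.getLast? = some C → ColLT C (U.headD [])) : Tab (S ++ U) := by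
  induction S generalizing a with
  | nil => exact hT
  | cons C S ih =>
    obtain ⟨h1, h2, h3⟩ := hT
    refine ⟨(List.pairwise_cons.1 h1).2, ?_, ih h3 fun D hD => hS D ?_⟩
    · cases S with
      | nil => exact hS C rfl
      | cons D S =>
        intro i d hd
        obtain ⟨e, he, hed⟩ := h2 (i + 1) d (by simpa [consHeads] using hd)
        exact ⟨e, by simpa using he, hed⟩
    · rw [List.getLast?_cons, hD, Option.getD_some]


lemma colLT_last_of_consHeads {S U : List (List ℕ)} {a : ℕ} {C : List ℕ} (ha : 1 ≤ a)
    (hT : Tab (consHeads a (S ++ [C]) ++ U)) (hU : ∀ d ∈ U.headD [], a + (S ++ [C]).length + 1 ≤ d)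
    (hr : Red (colRead (consHeads a (S ++ [C]) ++ U)))
    (hav : Avoids2143 (wordProd (colRead (consHeads a (S ++ [C]) ++ U)))) :
    ColLT C (U.headD []) := by
  intro i d hd
  have hXfix : ∀ k ≤ a, wordProd (colRead (S ++ [C] ++ U)) k = k := fun k hk =>
    wordProd_apply_of_le (forall_mem_of_consHeads hT hU) hk
  obtain ⟨hfix, hva, -⟩ := eq_of_descProd hXfix (wordProd_consHeads hT hU)
  have hcol := getD_consHeads_append a (S ++ [C]) U S.length
  have hlen : (S ++ [C]).length = S.length + 1 := by simp
  generalize hc : (S ++ [C]).length = c at *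
  generalize hA : consHeads a (S ++ [C]) = A at *
  have hAl : A.length = c := by rw [← hA, length_consHeads, hc]
  have hpw : ∀ C ∈ A, C.Pairwise (· < ·) := fun C hC => hT.pairwise (by simp [hC])
  have hUt : Tab U := by
    clear hcol hAl hpw hva hav hr hA hfix
    induction A with
    | nil => exact hT
    | cons D A ih => exact ih hT.2.2
  have hYfix : ∀ k ≤ a + c, wordProd (colRead U) k = k := fun k hk =>
    wordProd_apply_of_le (hUt.forall_mem_colRead hU) hk
  rw [colRead_append] at hr hav hva hfix
  generalize hv : wordProd (colRead U ++ colRead A) = v at *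
  have hvYZ : ∀ k, v k = wordProd (colRead U) (wordProd (colRead A) k) := fun k => by
    rw [← hv, wordProd_append, Equiv.Perm.mul_apply]
  obtain ⟨D, g, V, rfl⟩ : ∃ D g V, U = (D ++ [g]) :: V := by
    cases U with
    | nil => simp at hd
    | cons D V =>
      rcases List.eq_nil_or_concat D with rfl | ⟨D', g, rfl⟩
      · simp at hd
      · exact ⟨D', g, V, by simp⟩
  simp only [List.headD_cons] at hd hU
  have hdg : d ≤ g := by
    have h1 := hUt.1
    rw [List.pairwise_append] at h1
    have := List.mem_of_getElem? hd
    simp only [List.mem_append, List.mem_singleton] at this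
    rcases this with h | h
    · exact (h1.2.2 d h g (by simp)).le
    · exact h.le
  have hdi := pairwise_getElem?_ge hUt.1 hU hd
  obtain ⟨j0, hj0, hj0'⟩ : ∃ k, (a < k ∧ v k < a + c) ∧ ∀ k' < k, ¬ (a < k' ∧ v k' < a + c) := by
    classical
    have hex : ∃ k, a < k ∧ v k < a + c := by
      refine ⟨v.symm (a + c - 1), ?_, by rw [Equiv.apply_symm_apply]; omega⟩
      by_contra h
      push Not at h
      rcases h.lt_or_eq with h | h
      · have := hfix _ h
        rw [Equiv.apply_symm_apply] at this
        omega
      · have := congrArg v h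
        rw [Equiv.apply_symm_apply] at this
        omega
    exact ⟨Nat.find hex, Nat.find_spec hex, fun k' => Nat.find_min hex⟩
  have hZ : ∀ k, a ≤ k → k < j0 → wordProd (colRead A) k = k + c := by
    intro k
    induction k using Nat.strong_induction_on with
    | _ k ih =>
      intro hak hk
      rcases hak.eq_or_lt with rfl | hak
      · rw [hvYZ, ← hYfix (a + c) le_rfl] at hva
        exact (wordProd _).injective hva
      · have h1 : ¬ wordProd (colRead A) k ≤ a + c := by
          intro h
          have h2 := hYfix _ h
          rw [← hvYZ] at h2
          have h3 := hj0' k hk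
          have : v k = v a := by omega
          have := v.injective this
          omega
        have h2 := (wordProd_colRead hpw k).1
        rw [hAl] at h2
        by_contra h3
        have h4 := ih (wordProd (colRead A) k - c) (by omega) (by omega) (by omega)
        rw [Nat.sub_add_cancel (by omega)] at h4
        have := (wordProd _).injective h4
        omega
  have hg : g + 1 ≤ j0 + c := by
    by_contra hg
    have hgc : a + c < g := by omega
    have h1 := (Red.left (l := colRead V ++ D ++ [g]) (l' := colRead A)
      (by simpa [colRead] using hr)).lt_of_append_singleton
    have h2 := (Red.right (l := colRead V ++ D) (l' := g :: colRead A)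
      (by simpa [colRead] using hr)).symm_lt_of_cons
    generalize hp : (wordProd (colRead A)).symm g = p at *
    generalize hq : (wordProd (colRead A)).symm (g + 1) = q at *
    rw [Equiv.symm_apply_eq] at hp hq
    have hY : wordProd (colRead ((D ++ [g]) :: V)) = wordProd (colRead V ++ D) * sT g := by
      simp [colRead, mul_assoc]
    have hvp : v p = wordProd (colRead V ++ D) (g + 1) := by
      rw [hvYZ, ← hp, hY, Equiv.Perm.mul_apply, sT_apply, if_pos rfl]
    have hvq : v q = wordProd (colRead V ++ D) g := by
      rw [hvYZ, ← hq, hY, Equiv.Perm.mul_apply, sT_apply, if_neg (by omega), if_pos rfl]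
    have hvq' : a + c < v q := by
      rw [hvYZ, ← hq]
      exact lt_apply_of_fix hYfix (by omega)
    have hpj : j0 < p := by
      have h3 := (wordProd_colRead hpw p).1
      rw [hAl] at h3
      have h4 : j0 ≤ p := by omega
      rcases h4.eq_or_lt with rfl | h4
      · have h5 : v j0 = wordProd (colRead A) j0 := by
          have h6 := hYfix (v j0) (by omega)
          nth_rewrite 2 [hvYZ] at h6
          exact (wordProd _).injective h6
        omega
      · exact h4
    exact hav ⟨a, j0, p, q, ha, hj0.1, hpj, h2, by omega, by omega, by omega⟩
  have hlast : A[S.length]? = some ((a + S.length) :: C) := by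
    rw [if_pos (by omega), List.getD_append _ _ _ _ (by omega)] at hcol
    rw [List.getD_eq_getElem?_getD, List.getElem?_eq_getElem (by omega)] at hcol
    rw [List.getElem?_eq_getElem (by omega)]
    simpa using hcol
  have hpwl := hpw _ (List.mem_of_getElem? hlast)
  have hmem : ∀ t < j0 - a, a + S.length + t ∈ (a + S.length) :: C := by
    intro t ht
    have := (wordProd_colRead hpw (a + t)).2
      (by rw [hAl]; exact hZ _ (by omega) (by omega)) _ _ hlast
    rwa [show a + S.length + t = a + t + S.length by omega]
  have := getElem?_of_forall_mem hpwl (b := a + S.length) (fun x hx => by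
    rcases List.mem_cons.1 hx with rfl | hx
    · exact le_rfl
    · exact ((List.pairwise_cons.1 hpwl).1 x hx).le) hmem (i + 1) (by omega)
  exact ⟨_, by simpa using this, by omega⟩

/-- The insertion tableau of a vexillary permutation is determined by its Rothe diagram. -/
theorem getElem?_iff_boxAt {T : List (List ℕ)} (hT : Tab T) (hr : Red (colRead T))
    (hav : Avoids2143 (wordProd (colRead T))) (i j t : ℕ) :
    (T.getD j [])[i]? = some t ↔ ∃ x, BoxAt (wordProd (colRead T)) i j x ∧ t = x + j := by
  obtain ⟨n, hn⟩ : ∃ n, ∀ x ∈ colRead T, x < 1 + n := by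
    obtain ⟨n, hn⟩ := (colRead T).toFinset.exists_nat_subset_range
    exact ⟨n, fun x hx => by have := hn (List.mem_toFinset.2 hx); simp at this; omega⟩
  have ha : ∀ d ∈ T.headD [], 1 ≤ d := fun d hd => hr.1 d (by
    cases T with
    | nil => simp at hd
    | cons C T => exact List.mem_append_right _ hd)
  have key : ∀ n a, 1 ≤ a → ∀ T, Tab T → Red (colRead T) → Avoids2143 (wordProd (colRead T)) →
      (∀ x ∈ colRead T, x < a + n) → (∀ d ∈ T.headD [], a ≤ d) → ∀ i j t,
      ((T.getD j [])[i]? = some t ↔ ∃ x, BoxAt (wordProd (colRead T)) i j x ∧ t = x + j) := by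
    clear! T
    intro n
    induction n with
    | zero =>
      intro a ha T hT hr hav hn hT' i j t
      have hnil : colRead T = [] := List.eq_nil_iff_forall_not_mem.2 fun x hx => by
        have h1 := hT.forall_mem_colRead hT' x hx
        have h2 := hn x hx
        omega
      constructor
      · intro h
        have hm : t ∈ colRead T := by
          clear * - h
          induction T generalizing j with
          | nil => simp at h
          | cons C T ih =>
            cases j with
            | zero => exact List.mem_append_right _ (List.mem_of_getElem? (by simpa using h))
            | succ j => exact List.mem_append_left _ (ih j (by simpa using h))
        simp [hnil] at hm
      · rintro ⟨x, ⟨-, k, h1, h2, -⟩, -⟩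
        simp only [hnil, wordProd_nil, Equiv.Perm.coe_one, id_eq] at h2
        omega
    | succ n ih =>
      intro a ha T hT hr hav hn hT' i j t
      obtain ⟨S, U, rfl, hU⟩ := exists_consHeads hT hT'
      have hXfix : ∀ k ≤ a, wordProd (colRead (S ++ U)) k = k := fun k hk =>
        wordProd_apply_of_le (forall_mem_of_consHeads hT hU) hk
      have hv := wordProd_consHeads hT hU
      have hlt := forall_mem_of_consHeads hT hU
      have ih := ih (a + 1) (by omega) (S ++ U) (tab_of_consHeads hT fun C hC => by
          obtain ⟨S, rfl⟩ : ∃ S', S = S' ++ [C] := List.getLast?_eq_some_iff.1 hC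
          exact colLT_last_of_consHeads ha hT hU hr hav) (red_of_consHeads ha hT hU hr)
          (avoids_of_descProd hXfix hv hav) (fun x hx => by
            have := hn x (mem_colRead_consHeads hx)
            omega) (fun d hd => hlt d (by
              cases hSU : S ++ U with
              | nil => simp [hSU] at hd
              | cons C P => exact List.mem_append_right _ (by simpa [hSU] using hd)))
      rw [getD_consHeads_append]
      split_ifs with hj
      · cases i with
        | zero =>
          simp only [List.getElem?_cons_zero, Option.some.injEq,
            boxAt_zero_iff_of_lt ha hXfix hv hav hj, exists_eq_left]
          exact eq_comm
        | succ i =>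
          simp only [List.getElem?_cons_succ, ih, boxAt_succ_iff_of_lt ha hXfix hv hav hj]
      · simp only [ih, boxAt_iff_of_ge ha hXfix hv hav (not_lt.1 hj)]
  exact key n 1 le_rfl T hT hr hav hn ha i j t

/-! ### Combinatorics of the Rothe diagram -/

/-- In a vexillary diagram, if some box weakly above `(i, j)` comes from a
lower row than `(i, j)`, then `(i + 1, j)` is a box coming from the row following that of
`(i, j)`. -/
lemma BoxAt.succ {v : Perm'} (hav : Avoids2143 v) {i j x i' j' x' : ℕ} (h : BoxAt v i j x)
    (h' : BoxAt v i' j' x') (hi : i' ≤ i) (hx : x < x') :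
    BoxAt v (i + 1) j (x + 1) := by
  obtain ⟨h0, k, hxk, hkx, h1, h2⟩ := h
  obtain ⟨h0', k', hxk', hkx', h1', h2'⟩ := h'
  have hxk1 : x + 1 = k → v (x + 1) = v k := fun h => congrArg v h
  by_cases hlt : v k < v (x + 1)
  · refine ⟨by omega, k, by omega, hlt, ?_⟩
    have : rk v (x + 1) (v k) = rk v x (v k) := by
      unfold rk
      rw [Finset.Ico_add_one_right_eq_Icc, ← Finset.Ico_insert_right h0, Finset.filter_insert,
        if_neg (by omega)]
    omega
  · exfalso
    obtain ⟨p, hp1, hpx, hp2, hp3⟩ : ∃ p, 1 ≤ p ∧ p ≤ x ∧ v k < v p ∧ v p < v k' := by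
      by_contra hno
      push Not at hno
      have hsub : (Finset.Ico 1 x').filter (fun p => v p < v k') ⊆
          (Finset.Ico 1 x).filter (fun p => v p < v k) ∪ Finset.Ico (x + 1) x' := by
        intro p hp
        simp only [Finset.mem_filter, Finset.mem_Ico, Finset.mem_union] at hp ⊢
        by_cases hpx : p ≤ x
        · have h3 := hno p hp.1.1 hpx
          have h4 : v p ≠ v k := fun h => by have := v.injective h; omega
          have h5 : p = x → v p = v x := fun h => congrArg v h
          omega
        · omega
      have := (Finset.card_le_card hsub).trans (Finset.card_union_le _ _)
      rw [Nat.card_Ico] at this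
      unfold rk at h1 h2 h1' h2'
      omega
    have hxx : x + 1 = x' → v (x + 1) = v x' := fun h => congrArg v h
    exact hav ⟨p, x + 1, x', k', hp1, by omega, by omega, hxk', by omega, hp3, hkx'⟩

lemma card_filter_lt_iff (E : Finset ℕ) (j : ℕ) :
    (∃ y ∈ E, (E.filter (· < y)).card = j) ↔ j < E.card := by
  constructor
  · rintro ⟨y, hy, rfl⟩
    refine Finset.card_lt_card (Finset.filter_ssubset.2 ⟨y, hy, lt_irrefl y⟩)
  · intro h
    have hc (hf : {y | y ∈ E}.Finite) : j < hf.toFinset.card := by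
      have : hf.toFinset = E := by ext; simp
      rwa [this]
    refine ⟨Nat.nth (· ∈ E) j, Nat.nth_mem j hc, ?_⟩
    conv_rhs => rw [← Nat.count_nth (p := (· ∈ E)) (n := j) hc]
    rw [Nat.count_eq_card_filter_range]
    congr 1
    ext y
    simp [and_comm]

lemma rk_add_card {v : Perm'} (h0 : v 0 = 0) {x k : ℕ} (hk : x < k) (hkx : v k < v x)
    {E : Finset ℕ} (hE : ∀ y, y ∈ E ↔ ∃ k, x < k ∧ v k < v x ∧ y = v k) :
    rk v x (v k) + (E.filter (· < v k)).card + 1 = v k := by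
  have hvk : 0 < v k := by
    rw [Nat.pos_iff_ne_zero, ← h0]
    exact fun h => by have := v.injective h; omega
  have hd : Disjoint (((Finset.Ico 1 x).filter fun p => v p < v k).image v)
      (E.filter (· < v k)) := by
    rw [Finset.disjoint_left]
    intro y hy hy'
    simp only [Finset.mem_image, Finset.mem_filter, Finset.mem_Ico, hE] at hy hy'
    obtain ⟨p, hp, rfl⟩ := hy
    obtain ⟨⟨q, hq, -, h⟩, -⟩ := hy'
    have := v.injective h
    omega
  have hu : ((Finset.Ico 1 x).filter fun p => v p < v k).image v ∪ E.filter (· < v k) =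
      Finset.Ico 1 (v k) := by
    ext y
    simp only [Finset.mem_union, Finset.mem_image, Finset.mem_filter, Finset.mem_Ico, hE]
    constructor
    · rintro (⟨p, hp, rfl⟩ | ⟨⟨q, hq, h1, rfl⟩, h2⟩)
      · refine ⟨?_, hp.2⟩
        rw [Nat.one_le_iff_ne_zero, ← h0]
        exact fun h => by have := v.injective h; omega
      · refine ⟨?_, h2⟩
        rw [Nat.one_le_iff_ne_zero, ← h0]
        exact fun h => by have := v.injective h; omega
    · rintro ⟨h1, h2⟩
      obtain ⟨p, rfl⟩ := v.surjective y
      rcases lt_trichotomy p x with hp | rfl | hp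
      · refine Or.inl ⟨p, ⟨⟨?_, hp⟩, h2⟩, rfl⟩
        rcases Nat.eq_zero_or_pos p with rfl | h
        · omega
        · exact h
      · omega
      · exact Or.inr ⟨⟨p, hp, by omega, rfl⟩, h2⟩
  have := congrArg Finset.card hu
  rw [Finset.card_union_of_disjoint hd, Finset.card_image_of_injective _ v.injective,
    Nat.card_Ico] at this
  unfold rk
  omega

lemma exists_boxAt_iff {v : Perm'} (h0 : v 0 = 0) (j x : ℕ) :
    (∃ i, BoxAt v i j x) ↔ 1 ≤ x ∧ j < codeOf v x := by
  classical
  have hfin : {k | x < k ∧ v k < v x}.Finite :=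
    Set.Finite.subset ((Set.finite_lt_nat (v x)).preimage v.injective.injOn) fun k hk => hk.2
  have hE : ∀ y, y ∈ hfin.toFinset.image v ↔ ∃ k, x < k ∧ v k < v x ∧ y = v k := by
    intro y
    simp only [Finset.mem_image, Set.Finite.mem_toFinset, Set.mem_ofPred_eq]
    constructor
    · rintro ⟨k, ⟨h1, h2⟩, rfl⟩; exact ⟨k, h1, h2, rfl⟩
    · rintro ⟨k, h1, h2, rfl⟩; exact ⟨k, ⟨h1, h2⟩, rfl⟩
  have hcard : codeOf v x = (hfin.toFinset.image v).card := by
    rw [Finset.card_image_of_injective _ v.injective, codeOf, Nat.card_coe_set_eq,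
      Set.ncard_eq_toFinset_card _ hfin]
  generalize hfin.toFinset.image v = E at hE hcard
  rw [hcard, ← card_filter_lt_iff E j]
  constructor
  · rintro ⟨i, hx, k, hxk, hkx, h1, h2⟩
    refine ⟨hx, v k, (hE _).2 ⟨k, hxk, hkx, rfl⟩, ?_⟩
    have := rk_add_card h0 hxk hkx hE
    omega
  · rintro ⟨hx, y, hy, rfl⟩
    obtain ⟨k, hxk, hkx, rfl⟩ := (hE _).1 hy
    have := rk_add_card h0 hxk hkx hE
    have := rk_le v x (v k)
    exact ⟨x - 1 - rk v x (v k), hx, k, hxk, hkx, by omega, by omega⟩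

lemma Tab.getD {P : List (List ℕ)} (h : Tab P) (j : ℕ) :
    (P.getD j []).Pairwise (· < ·) ∧ ColLT (P.getD j []) (P.getD (j + 1) []) := by
  induction P generalizing j with
  | nil => simp [ColLT]
  | cons C P ih =>
    cases j with
    | zero =>
      refine ⟨h.1, ?_⟩
      have := h.2.1
      cases P <;> simpa using this
    | succ j => simpa using ih h.2.2 j

lemma Tab.exists_left {P : List (List ℕ)} (h : Tab P) {i j j' t : ℕ} (hj : j' ≤ j)
    (ht : (P.getD j [])[i]? = some t) : ∃ s, (P.getD j' [])[i]? = some s ∧ s + (j - j') ≤ t := by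
  induction j, hj using Nat.le_induction generalizing t with
  | base => exact ⟨t, ht, by omega⟩
  | succ j hj ih =>
    obtain ⟨c, hc, hct⟩ := (h.getD j).2 i t ht
    obtain ⟨s, hs, hsc⟩ := ih hc
    exact ⟨s, hs, by omega⟩

lemma exists_above {C : List ℕ} {i i' t : ℕ} (hi : i' ≤ i) (ht : C[i]? = some t) :
    ∃ s, C[i']? = some s := by
  have := lt_length_of_getElem? ht
  exact ⟨_, List.getElem?_eq_getElem (by omega)⟩

lemma Tab.exists_mono {P : List (List ℕ)} (h : Tab P) {i i' j j' t : ℕ} (hi : i' ≤ i) (hj : j' ≤ j)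
    (ht : (P.getD j [])[i]? = some t) : ∃ s, (P.getD j' [])[i']? = some s ∧ s + (j - j') ≤ t := by
  obtain ⟨u, hu⟩ := exists_above hi ht
  obtain ⟨s, hs, hsu⟩ := h.exists_left hj hu
  refine ⟨s, hs, ?_⟩
  rcases hi.eq_or_lt with rfl | hi
  · rw [ht, Option.some_inj] at hu
    omega
  · have := pairwise_getElem? (h.getD j).1 hu ht hi
    omega

/-- `T` is the tableau given by the Rothe diagram of the vexillary permutation `v`. -/
structure IsRotheTab (v : Perm') (T : List (List ℕ)) : Prop where
  tab : Tab T
  ne_nil : ∀ C ∈ T, C ≠ []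
  iff_boxAt : ∀ i j t : ℕ, (T.getD j [])[i]? = some t ↔ ∃ x, BoxAt v i j x ∧ t = x + j

lemma IsRotheTab.length_column {v : Perm'} {T : List (List ℕ)} (hT : IsRotheTab v T) (h0 : v 0 = 0)
    {n : ℕ} (hn : ∀ m, n < m → v m = m) (j : ℕ) :
    (T.getD j []).length = (List.range' 1 n).countP fun x => j < codeOf v x := by
  have hnd : ((T.getD j []).map fun t => t - j).Nodup := by
    rw [List.nodup_map_iff_inj_on]
    · intro s hs t ht hst
      obtain ⟨i, hi⟩ := List.mem_iff_getElem?.1 hs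
      obtain ⟨k, hk⟩ := List.mem_iff_getElem?.1 ht
      obtain ⟨x, -, rfl⟩ := (hT.iff_boxAt _ _ _).1 hi
      obtain ⟨y, -, rfl⟩ := (hT.iff_boxAt _ _ _).1 hk
      omega
    · exact (hT.tab.getD j).1.imp fun h => h.ne
  have hnd' : ((List.range' 1 n).filter fun x => j < codeOf v x).Nodup :=
    (List.nodup_range' (step := 1) (by omega)).filter _
  rw [List.countP_eq_length_filter, ← List.length_map (as := T.getD j []) fun t => t - j]
  refine ((List.perm_ext_iff_of_nodup hnd hnd').2 fun x => ?_).length_eq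
  have hbox := exists_boxAt_iff h0 j x
  simp only [List.mem_map, List.mem_filter, List.mem_range'_1, decide_eq_true_eq]
  constructor
  · rintro ⟨t, ht, rfl⟩
    obtain ⟨i, hi⟩ := List.mem_iff_getElem?.1 ht
    obtain ⟨x, hx, rfl⟩ := (hT.iff_boxAt _ _ _).1 hi
    rw [Nat.add_sub_cancel] at hbox ⊢
    obtain ⟨h1, h2⟩ := hbox.1 ⟨i, hx⟩
    refine ⟨⟨h1, ?_⟩, h2⟩
    by_contra hlt
    obtain ⟨-, k, hxk, hkx, -⟩ := hx
    rw [hn x (by omega), hn k (by omega)] at hkx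
    omega
  · rintro ⟨⟨h1, -⟩, h2⟩
    obtain ⟨i, hi⟩ := hbox.2 ⟨h1, h2⟩
    exact ⟨x + j, List.mem_of_getElem? ((hT.iff_boxAt i j (x + j)).2 ⟨x, hi, rfl⟩), by omega⟩

lemma IsRotheTab.flagEntry_eq {v : Perm'} {T : List (List ℕ)} (hT : IsRotheTab v T) (h0 : v 0 = 0)
    {i j t : ℕ} (ht : (T.getD j [])[i]? = some t) (hend : (T.getD (j + 1) [])[i]? = none) :
    flagEntry v (i + 1) (j + 1) + j = t := by
  obtain ⟨x, hx, rfl⟩ := (hT.iff_boxAt _ _ _).1 ht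
  rw [Nat.add_right_cancel_iff]
  refine IsGreatest.csSup_eq ⟨?_, ?_⟩
  · obtain ⟨hx, k, hxk, hkx, h1, h2⟩ := hx
    exact ⟨v k, ⟨hx, k, hxk, hkx, rfl⟩, by omega⟩
  · rintro r ⟨c, ⟨hr, k, hrk, hkr, hc⟩, hdiag⟩
    simp only at hr hrk hkr hc
    subst hc
    have hrk' := rk_le v r (v k)
    obtain ⟨j', hj'⟩ : ∃ j', rk v r (v k) + j' + 1 = v k := by
      classical
      have hfin : {k | r < k ∧ v k < v r}.Finite :=
        Set.Finite.subset ((Set.finite_lt_nat (v r)).preimage v.injective.injOn) fun k hk => hk.2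
      refine ⟨_, rk_add_card h0 hrk hkr (E := hfin.toFinset.image v) fun y => ?_⟩
      simp only [Finset.mem_image, Set.Finite.mem_toFinset, Set.mem_ofPred_eq]
      constructor
      · rintro ⟨k, ⟨h1, h2⟩, rfl⟩; exact ⟨k, h1, h2, rfl⟩
      · rintro ⟨k, h1, h2, rfl⟩; exact ⟨k, ⟨h1, h2⟩, rfl⟩
    have hbox : BoxAt v (r - 1 - rk v r (v k)) j' r := ⟨hr, k, hrk, hkr, by omega, hj'⟩
    have hent := (hT.iff_boxAt _ _ _).2 ⟨r, hbox, rfl⟩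
    by_cases hlt : j' ≤ j
    · obtain ⟨s, hs, hst⟩ := hT.tab.exists_mono (i' := r - 1 - rk v r (v k)) (by omega) hlt ht
      rw [hs, Option.some_inj] at hent
      omega
    · obtain ⟨s, hs, -⟩ := hT.tab.exists_mono (i' := i) (j' := j + 1) (by omega) (by omega) hent
      exact absurd (hs.symm.trans hend) (by simp)

/-- Semistandardness of a filling given as a list of columns. -/
structure QTab (Q : List (List ℕ)) : Prop where
  row : ∀ i j q r : ℕ, (Q.getD j [])[i]? = some q → (Q.getD (j + 1) [])[i]? = some r → q ≤ r
  col : ∀ i j q r : ℕ, (Q.getD j [])[i]? = some q → (Q.getD j [])[i + 1]? = some r → q < r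

/-- A flag condition at the row ends implies a bound at every box. -/
lemma QTab.entry_le {v : Perm'} (hav : Avoids2143 v) {T Q : List (List ℕ)} (hT : IsRotheTab v T)
    (hQ : QTab Q) (hlen : ∀ j, (Q.getD j []).length = (T.getD j []).length)
    (hend : ∀ i j q t : ℕ, (Q.getD j [])[i]? = some q → (T.getD j [])[i]? = some t →
      (T.getD (j + 1) [])[i]? = none → q + j ≤ t) {i j q t : ℕ}
    (hq : (Q.getD j [])[i]? = some q) (ht : (T.getD j [])[i]? = some t) : q + j ≤ t := by
  obtain ⟨N, hN⟩ : ∃ N, ∀ i j t, (T.getD j [])[i]? = some t → i + j < N := by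
    refine ⟨(T.getD 0 []).length + T.length, fun i j t ht => ?_⟩
    obtain ⟨s, hs, -⟩ := hT.tab.exists_left (Nat.zero_le j) ht
    have := lt_length_of_getElem? hs
    have : j < T.length := by
      by_contra hj
      rw [List.getD_eq_default _ _ (by omega)] at ht
      simp at ht
    omega
  have hex : ∀ i j t, (T.getD j [])[i]? = some t → ∃ q, (Q.getD j [])[i]? = some q :=
    fun i j t h => ⟨_, List.getElem?_eq_getElem (by rw [hlen]; exact lt_length_of_getElem? h)⟩
  obtain ⟨d, hd⟩ : ∃ d, N ≤ i + j + d := ⟨N, by omega⟩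
  induction d generalizing i j q t with
  | zero =>
    have := hN i j t ht
    omega
  | succ d ih =>
    rcases h : (T.getD (j + 1) [])[i]? with _ | t'
    · exact hend i j q t hq ht h
    · obtain ⟨q', hq'⟩ := hex _ _ _ h
      have h1 := ih hq' h (by omega)
      have h2 := hQ.row _ _ _ _ hq hq'
      obtain ⟨x, hx, rfl⟩ := (hT.iff_boxAt _ _ _).1 ht
      obtain ⟨x', hx', rfl⟩ := (hT.iff_boxAt _ _ _).1 h
      by_cases hlt : x < x'
      · have h3 := (hT.iff_boxAt _ _ _).2 ⟨_, hx.succ hav hx' le_rfl hlt, rfl⟩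
        obtain ⟨q'', hq''⟩ := hex _ _ _ h3
        have h4 := ih hq'' h3 (by omega)
        have h5 := hQ.col _ _ _ _ hq hq''
        omega
      · omega

/-! ### Recording tableaux -/

lemma ext_of_getElem? {L L' : List (List ℕ)} (hL : ∀ C ∈ L, C ≠ []) (hL' : ∀ C ∈ L', C ≠ [])
    (h : ∀ i j : ℕ, (L.getD j [])[i]? = (L'.getD j [])[i]?) : L = L' := by
  have hcol : ∀ j, L.getD j [] = L'.getD j [] := fun j => List.ext_getElem? fun i => h i j
  have hlt : ∀ {A B : List (List ℕ)}, (∀ C ∈ A, C ≠ []) → (∀ j, A.getD j [] = B.getD j []) →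
      A.length ≤ B.length := by
    intro A B hA hAB
    by_contra hlt
    push Not at hlt
    have h1 := hAB B.length
    rw [List.getD_eq_getElem _ _ hlt, List.getD_eq_default _ _ le_rfl] at h1
    exact hA _ (List.getElem_mem _) h1
  have hlen := le_antisymm (hlt hL hcol) (hlt hL' fun j => (hcol j).symm)
  refine List.ext_getElem hlen fun j h1 h2 => ?_
  have := hcol j
  rwa [List.getD_eq_getElem _ _ h1, List.getD_eq_getElem _ _ h2] at this

/-- Add an entry at the bottom of column `j`. -/
def addAt (Q : List (List ℕ)) (j r : ℕ) : List (List ℕ) :=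
  if j < Q.length then Q.set j (Q.getD j [] ++ [r]) else Q ++ [[r]]

lemma getD_addAt {Q : List (List ℕ)} {j r : ℕ} (hj : j ≤ Q.length) (c : ℕ) :
    (addAt Q j r).getD c [] = if c = j then Q.getD j [] ++ [r] else Q.getD c [] := by
  unfold addAt
  simp only [List.getD_eq_getElem?_getD]
  split_ifs with h1 h2 h2
  · subst h2
    rw [List.getElem?_set_self h1, Option.getD_some]
  · rw [List.getElem?_set_ne (by omega)]
  · have : j = Q.length := by omega
    subst h2 this
    simp
  · have : j = Q.length := by omega
    subst this
    rcases Nat.lt_or_ge c Q.length with h | h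
    · rw [List.getElem?_append_left h]
    · rw [List.getElem?_append_right h, List.getElem?_eq_none h,
        List.getElem?_eq_none (by simp; omega)]

lemma addAt_ne_nil {Q : List (List ℕ)} {j r : ℕ} (hQ : ∀ C ∈ Q, C ≠ []) :
    ∀ C ∈ addAt Q j r, C ≠ [] := by
  intro C hC
  unfold addAt at hC
  split_ifs at hC
  · rcases List.mem_or_eq_of_mem_set hC with h | rfl
    · exact hQ C h
    · simp
  · simp only [List.mem_append, List.mem_singleton] at hC
    rcases hC with h | rfl
    · exact hQ C h
    · simp

lemma getElem?_addAt {Q : List (List ℕ)} {j r : ℕ} (hj : j ≤ Q.length) {i c q : ℕ} :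
    ((addAt Q j r).getD c [])[i]? = some q ↔
      (Q.getD c [])[i]? = some q ∨ (c = j ∧ i = (Q.getD j []).length ∧ q = r) := by
  rw [getD_addAt hj]
  split_ifs with h
  · subst h
    generalize Q.getD c [] = C
    rcases lt_trichotomy i C.length with h | h | h
    · rw [List.getElem?_append_left h]
      exact ⟨Or.inl, fun h' => h'.resolve_right fun h'' => by omega⟩
    · subst h
      rw [List.getElem?_append_right le_rfl, List.getElem?_eq_none le_rfl]
      simp [eq_comm]
    · rw [List.getElem?_append_right h.le, List.getElem?_eq_none h.le,
        List.getElem?_eq_none (by simp; omega)]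
      simp only [reduceCtorEq, false_or, true_and, false_iff]
      omega
  · simp [h]

/-- The pair of tableaux produced from a list of pairs (recorded letter, inserted letter). -/
def egPair (L : List (ℕ × ℕ)) : List (List ℕ) × List (List ℕ) := L.foldl egStep ([], [])

/-- What is known about the pair of tableaux obtained from a reduced word. -/
structure EGInv (L : List (ℕ × ℕ)) (P Q : List (List ℕ)) : Prop where
  tab : Tab P
  ne_nil : ∀ C ∈ P, C ≠ []
  red : Red (colRead P)
  wordProd_eq : wordProd (colRead P) = wordProd (L.map Prod.snd)
  length_colRead : (colRead P).length = L.length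
  length_eq : ∀ c, (Q.getD c []).length = (P.getD c []).length
  ne_nil' : ∀ C ∈ Q, C ≠ []

lemma length_eq_of_getD {P Q : List (List ℕ)} (hP : ∀ C ∈ P, C ≠ []) (hQ : ∀ C ∈ Q, C ≠ [])
    (h : ∀ c, (Q.getD c []).length = (P.getD c []).length) : Q.length = P.length := by
  have key : ∀ {A B : List (List ℕ)}, (∀ C ∈ A, C ≠ []) →
      (∀ c, (A.getD c []).length = (B.getD c []).length) → A.length ≤ B.length := by
    intro A B hA hAB
    by_contra hlt
    push Not at hlt
    have h1 := hAB B.length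
    rw [List.getD_eq_getElem _ _ hlt, List.getD_eq_default _ _ le_rfl] at h1
    exact hA _ (List.getElem_mem _) (List.length_eq_zero_iff.1 h1)
  exact le_antisymm (key hQ h) (key hP fun c => (h c).symm)

lemma EGIns.le_length {P P' : List (List ℕ)} {x j : ℕ} (h : EGIns P x P' j) : j ≤ P.length := by
  induction h with
  | nil => simp
  | place => simp
  | step _ _ ih => simpa using ih

lemma EGInv.nil : EGInv [] [] [] where
  tab := trivial
  ne_nil := by simp
  red := ⟨by simp [colRead], by simp [colRead]⟩
  wordProd_eq := rfl
  length_colRead := rfl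
  length_eq := by simp
  ne_nil' := by simp

lemma EGInv.red_append {L : List (ℕ × ℕ)} {P Q : List (List ℕ)} (h : EGInv L P Q) {r a : ℕ}
    (hr : Red ((L ++ [(r, a)]).map Prod.snd)) : Red (colRead P ++ [a]) := by
  refine hr.of_eq (fun x hx => ?_) (by simp [h.length_colRead]) (by simp [h.wordProd_eq])
  rcases List.mem_append.1 hx with hx | hx
  · exact h.red.1 x hx
  · exact hr.1 x (by simpa using Or.inr (List.mem_singleton.1 hx))

lemma EGInv.step {L : List (ℕ × ℕ)} {P Q P' : List (List ℕ)} (h : EGInv L P Q) {r a j : ℕ}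
    (hr : Red (colRead P ++ [a])) (hi : EGIns P a P' j) :
    j ≤ Q.length ∧ EGInv (L ++ [(r, a)]) P' (addAt Q j r) := by
  have hj : j ≤ Q.length := by
    rw [length_eq_of_getD h.ne_nil h.ne_nil' h.length_eq]
    exact hi.le_length
  refine ⟨hj, hi.tab h.tab, hi.ne_nil h.ne_nil, hi.red hr, ?_, ?_, fun c => ?_,
    addAt_ne_nil h.ne_nil'⟩
  · rw [hi.wordProd_eq, List.map_append, wordProd_append, wordProd_append, h.wordProd_eq]
    rfl
  · rw [hi.length_colRead]
    simp [h.length_colRead]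
  · rw [getD_addAt hj, hi.length_getD, ← h.length_eq c]
    split_ifs with hc
    · simp [hc]
    · rfl

lemma egStep_eq {P Q P' : List (List ℕ)} {r a j : ℕ} (hi : EGIns P a P' j) :
    egStep (P, Q) (r, a) = (P', addAt Q j r) := by
  simp [egStep, hi.egInsert_eq, addAt]

lemma egPair_append (L : List (ℕ × ℕ)) (p : ℕ × ℕ) :
    egPair (L ++ [p]) = egStep (egPair L) p := by
  simp [egPair]

lemma egInv_egPair {L : List (ℕ × ℕ)} (hr : Red (L.map Prod.snd)) :
    EGInv L (egPair L).1 (egPair L).2 := by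
  induction L using List.reverseRecOn with
  | nil => exact EGInv.nil
  | append_singleton L p ih =>
    have h := ih (Red.left (by simpa using hr))
    have hr' := h.red_append hr
    obtain ⟨P', j, hi⟩ := exists_egIns h.tab hr'
    rw [egPair_append, ← Prod.mk.eta (p := egPair L), egStep_eq hi]
    exact (h.step hr' hi).2

/-- The insertion producing the last step of the algorithm. -/
lemma exists_egPair_append {L : List (ℕ × ℕ)} {r a : ℕ}
    (hr : Red ((L ++ [(r, a)]).map Prod.snd)) :
    ∃ j ≤ (egPair L).2.length, EGIns (egPair L).1 a (egPair (L ++ [(r, a)])).1 j ∧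
      (egPair (L ++ [(r, a)])).2 = addAt (egPair L).2 j r := by
  have h := egInv_egPair (L := L) (Red.left (by simpa using hr))
  have hr' := h.red_append hr
  obtain ⟨P', j, hi⟩ := exists_egIns h.tab hr'
  rw [egPair_append, ← Prod.mk.eta (p := egPair L), egStep_eq hi]
  exact ⟨j, (h.step (r := r) hr' hi).1, hi, rfl⟩

/-- The condition on consecutive pairs of a compatible sequence. -/
def CompatRel (p q : ℕ × ℕ) : Prop := p.1 ≤ q.1 ∧ (p.2 < q.2 → p.1 < q.1)

lemma EGIns.col_unique {P P' P'' : List (List ℕ)} {x j j' : ℕ} (h : EGIns P x P' j)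
    (h' : EGIns P x P'' j') : j = j' := by
  have := h.egInsert_eq.symm.trans h'.egInsert_eq
  exact congrArg Prod.snd this

/-- The recording tableau of a compatible sequence is semistandard, and the last recorded letter
is its largest entry, recorded in the rightmost possible column. -/
lemma qTab_egPair {L : List (ℕ × ℕ)} (hr : Red (L.map Prod.snd)) (hc : L.IsChain CompatRel) :
    QTab (egPair L).2 ∧ ∀ L0 r a, L = L0 ++ [(r, a)] → ∀ j, EGIns (egPair L0).1 a (egPair L).1 j →
      ∀ i c q : ℕ, ((egPair L).2.getD c [])[i]? = some q → q ≤ r ∧ (q = r → c ≤ j) := by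
  induction L using List.reverseRecOn with
  | nil => exact ⟨⟨by simp [egPair], by simp [egPair]⟩, by simp⟩
  | append_singleton L p ih =>
    obtain ⟨r, a⟩ := p
    have hrL : Red (L.map Prod.snd) := Red.left (by simpa using hr)
    obtain ⟨ih1, ih2⟩ := ih hrL hc.left_of_append
    obtain ⟨j, hj, hi, hQ⟩ := exists_egPair_append hr
    have hinv := egInv_egPair hrL
    have hold : ∀ i c q : ℕ, ((egPair L).2.getD c [])[i]? = some q → q ≤ r ∧ (q = r → c < j) := by
      rcases List.eq_nil_or_concat L with rfl | ⟨L0, ⟨r0, a0⟩, rfl⟩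
      · simp [egPair]
      · rw [List.concat_eq_append] at *
        intro i c q hq
        obtain ⟨j0, -, hi0, -⟩ := exists_egPair_append hrL
        obtain ⟨h1, h2⟩ := ih2 L0 r0 a0 rfl j0 hi0 i c q hq
        have hrel : CompatRel (r0, a0) (r, a) := by
          rw [List.append_assoc, List.isChain_append] at hc
          simpa using hc.2.1
        obtain ⟨h3, h4⟩ := hrel
        simp only at h3 h4
        refine ⟨h1.trans h3, fun h5 => ?_⟩
        have hne : a0 ≠ a := Red.ne_of_append_pair (l := L0.map Prod.snd) (l' := [])
          (by simpa using hr)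
        have := hi0.col_lt_of_gt hi (by omega)
        have := h2 (by omega)
        omega
    rw [hQ]
    refine ⟨⟨fun i c q q' h h' => ?_, fun i c q q' h h' => ?_⟩, ?_⟩
    · rw [getElem?_addAt hj] at h h'
      rcases h with h | ⟨rfl, rfl, rfl⟩ <;> rcases h' with h' | ⟨h1, h2, rfl⟩
      · exact ih1.row i c q q' h h'
      · exact (hold i c q h).1
      · exfalso
        have h1 := (hinv.tab.getD c).2.length_le
        have h2 := lt_length_of_getElem? h'
        have h3 := hinv.length_eq c
        have h4 := hinv.length_eq (c + 1)
        omega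
      · exact le_rfl
    · rw [getElem?_addAt hj] at h h'
      rcases h with h | ⟨rfl, rfl, rfl⟩ <;> rcases h' with h' | ⟨h1, h2, rfl⟩
      · exact ih1.col i c q q' h h'
      · have := hold i c q h
        omega
      · have := lt_length_of_getElem? h'
        omega
      · omega
    · intro L0 r' a' he j' hi' i c q hq
      obtain ⟨rfl, he'⟩ := List.append_inj' he rfl
      simp only [List.cons.injEq, Prod.mk.injEq, and_true] at he'
      obtain ⟨rfl, rfl⟩ := he'
      have hjj := hi.col_unique hi'
      subst hjj
      rw [getElem?_addAt hj] at hq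
      rcases hq with h | ⟨rfl, rfl, rfl⟩
      · have := hold i c q h
        exact ⟨this.1, fun h => (this.2 h).le⟩
      · simp

lemma egPair_injective {L L' : List (ℕ × ℕ)} (hr : Red (L.map Prod.snd))
    (hc : L.IsChain CompatRel) (hr' : Red (L'.map Prod.snd)) (hc' : L'.IsChain CompatRel)
    (h : egPair L = egPair L') : L = L' := by
  induction L using List.reverseRecOn generalizing L' with
  | nil =>
    have h1 := (egInv_egPair hr).length_colRead
    have h2 := (egInv_egPair hr').length_colRead
    rw [h, h2] at h1
    exact (List.length_eq_zero_iff.1 h1).symm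
  | append_singleton L p ih =>
    rcases List.eq_nil_or_concat L' with rfl | ⟨L', p', rfl⟩
    · have h1 := (egInv_egPair hr).length_colRead
      have h2 := (egInv_egPair hr').length_colRead
      rw [h, h2] at h1
      simp at h1
    · rw [List.concat_eq_append] at *
      obtain ⟨r, a⟩ := p
      obtain ⟨r', a'⟩ := p'
      obtain ⟨j, hj, hi, hQ⟩ := exists_egPair_append hr
      obtain ⟨j', hj', hi', hQ'⟩ := exists_egPair_append hr'
      have hrL : Red (L.map Prod.snd) := Red.left (by simpa using hr)
      have hrL' : Red (L'.map Prod.snd) := Red.left (by simpa using hr')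
      have h1 := (qTab_egPair hr hc).2 L r a rfl j hi
      have h2 := (qTab_egPair hr' hc').2 L' r' a' rfl j' hi'
      have e1 : ((egPair (L ++ [(r, a)])).2.getD j [])[((egPair L).2.getD j []).length]? =
          some r := by
        rw [hQ, getElem?_addAt hj]; simp
      have e2 : ((egPair (L' ++ [(r', a')])).2.getD j' [])[((egPair L').2.getD j' []).length]? =
          some r' := by
        rw [hQ', getElem?_addAt hj']; simp
      rw [h] at e1
      rw [← h] at e2
      have h3 := h2 _ _ _ e1
      have h4 := h1 _ _ _ e2
      have hrr : r = r' := by omega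
      have hjj : j = j' := by
        have := h3.2 hrr
        have := h4.2 hrr.symm
        omega
      subst hrr hjj
      rw [h] at hi hQ
      obtain ⟨hP, rfl⟩ := hi.injective hi' (egInv_egPair hrL).ne_nil (egInv_egPair hrL').ne_nil
      have hQQ : (egPair L).2 = (egPair L').2 := by
        refine ext_of_getElem? (egInv_egPair hrL).ne_nil' (egInv_egPair hrL').ne_nil' fun i c => ?_
        have h5 := congrArg (fun Q => Q.getD c []) (hQ.symm.trans hQ')
        simp only [getD_addAt hj, getD_addAt hj'] at h5
        split_ifs at h5 with hc
        · rw [hc, List.append_cancel_right h5]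
        · rw [h5]
      rw [ih hrL hc.left_of_append hrL' hc'.left_of_append (Prod.ext hP hQQ)]

lemma exists_removeAt {Q : List (List ℕ)} {j r : ℕ} {C : List ℕ} (hne : ∀ C ∈ Q, C ≠ [])
    (hj : Q.getD j [] = C ++ [r]) (hnext : (Q.getD (j + 1) []).length ≤ C.length) :
    ∃ Q0, (∀ C ∈ Q0, C ≠ []) ∧ j ≤ Q0.length ∧ Q = addAt Q0 j r := by
  have hlt : j < Q.length := by
    by_contra h
    rw [List.getD_eq_default _ _ (by omega)] at hj
    simp at hj
  rw [List.getD_eq_getElem _ _ hlt] at hj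
  rcases eq_or_ne C [] with rfl | hC
  · have hlen : Q.length = j + 1 := by
      by_contra h
      rw [List.getD_eq_getElem _ _ (by omega : j + 1 < Q.length)] at hnext
      exact hne _ (List.getElem_mem (show j + 1 < Q.length by omega))
        (List.length_eq_zero_iff.1 (by simpa using hnext))
    refine ⟨Q.take j, fun C hC => hne C (List.mem_of_mem_take hC), by simp; omega, ?_⟩
    have htake := List.take_append_getElem hlt
    rw [hj, List.take_of_length_le (show Q.length ≤ j + 1 by omega)] at htake
    rw [addAt, if_neg (by simp)]
    exact htake.symm
  · refine ⟨Q.set j C, fun D hD => ?_, by simp; omega, ?_⟩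
    · rcases List.mem_or_eq_of_mem_set hD with h | rfl
      · exact hne D h
      · exact hC
    · rw [addAt, if_pos (by simpa using hlt), List.getD_eq_getElem _ _ (by simpa using hlt),
        List.getElem_set_self, List.set_set, ← hj, List.set_getElem_self]

/-- Every semistandard filling of the shape of `P` is the recording tableau of a sequence
inserting to `P`. -/
lemma exists_egPair_eq {P Q : List (List ℕ)} (hP : Tab P) (hne : ∀ C ∈ P, C ≠ [])
    (hr : Red (colRead P)) (hQ : QTab Q) (hne' : ∀ C ∈ Q, C ≠ [])
    (hlen : ∀ c, (Q.getD c []).length = (P.getD c []).length) :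
    ∃ L, Red (L.map Prod.snd) ∧ L.IsChain CompatRel ∧ egPair L = (P, Q) := by
  induction hm : (colRead P).length generalizing P Q with
  | zero =>
    have hPn : P = [] := by
      cases P with
      | nil => rfl
      | cons C P =>
        simp only [colRead, List.length_append, Nat.add_eq_zero_iff, List.length_eq_zero_iff] at hm
        exact absurd hm.2 (hne C (by simp))
    subst hPn
    have hQn : Q = [] := List.length_eq_zero_iff.1 (length_eq_of_getD hne hne' hlen)
    subst hQn
    exact ⟨[], hr, by simp, rfl⟩
  | succ m ih =>
    have hlen' := length_eq_of_getD hne hne' hlen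
    have hex : ∃ r j, r ∈ Q.getD j [] := by
      cases Q with
      | nil =>
        rw [List.length_eq_zero_iff.1 hlen'.symm] at hm
        simp [colRead] at hm
      | cons C Q =>
        obtain ⟨r, hr⟩ := List.exists_mem_of_ne_nil C (hne' C (by simp))
        exact ⟨r, 0, by simpa using hr⟩
    have hmem : ∀ {r j}, r ∈ Q.getD j [] → j < Q.length ∧ r ∈ Q.flatten := by
      intro r j h
      have hj : j < Q.length := by
        by_contra hj
        rw [List.getD_eq_default _ _ (by omega)] at h
        simp at h
      rw [List.getD_eq_getElem _ _ hj] at h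
      exact ⟨hj, List.mem_flatten.2 ⟨_, List.getElem_mem hj, h⟩⟩
    obtain ⟨r, hrQ, hrmax⟩ : ∃ r, (∃ j, r ∈ Q.getD j []) ∧ ∀ s j, s ∈ Q.getD j [] → s ≤ r := by
      classical
      obtain ⟨B, hB⟩ : ∃ B, ∀ s ∈ Q.flatten, s ≤ B :=
        ⟨Q.flatten.sum, fun s hs => List.single_le_sum (by simp) s hs⟩
      refine ⟨Nat.findGreatest (fun r => ∃ j, r ∈ Q.getD j []) B, ?_, fun s j hs => ?_⟩
      · obtain ⟨r, j, hrj⟩ := hex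
        exact Nat.findGreatest_spec (P := fun r => ∃ j, r ∈ Q.getD j []) (hB r (hmem hrj).2)
          ⟨j, hrj⟩
      · exact Nat.le_findGreatest (hB s (hmem hs).2) ⟨j, hs⟩
    obtain ⟨j, hrj, hjmax⟩ : ∃ j, r ∈ Q.getD j [] ∧ ∀ j', r ∈ Q.getD j' [] → j' ≤ j := by
      classical
      refine ⟨Nat.findGreatest (fun j => r ∈ Q.getD j []) Q.length, ?_, fun j' hj' => ?_⟩
      · obtain ⟨j, hj⟩ := hrQ
        exact Nat.findGreatest_spec (P := fun j => r ∈ Q.getD j []) (hmem hj).1.le hj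
      · exact Nat.le_findGreatest (hmem hj').1.le hj'
    obtain ⟨C, hC⟩ : ∃ C, Q.getD j [] = C ++ [r] := by
      obtain ⟨i, hi⟩ := List.mem_iff_getElem?.1 hrj
      have hi' := lt_length_of_getElem? hi
      have hlast : i + 1 = (Q.getD j []).length := by
        by_contra hne
        have h1 := List.getElem?_eq_getElem (show i + 1 < (Q.getD j []).length by omega)
        have h2 := hQ.col _ _ _ _ hi h1
        have h3 := hrmax _ j (List.mem_of_getElem? h1)
        omega
      refine ⟨(Q.getD j []).take i, ?_⟩
      have := List.take_append_getElem hi'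
      rw [(List.getElem?_eq_some_iff.1 hi).2,
        List.take_of_length_le (show (Q.getD j []).length ≤ i + 1 by omega)] at this
      exact this.symm
    have hnext : (Q.getD (j + 1) []).length ≤ C.length := by
      by_contra hlt
      push Not at hlt
      have h1 := List.getElem?_eq_getElem hlt
      have h2 := hQ.row C.length j r _ (by rw [hC]; simp) h1
      have h3 := List.mem_of_getElem? h1
      have h4 := hrmax _ _ h3
      rw [le_antisymm h4 h2] at h3
      have := hjmax _ h3
      omega
    obtain ⟨Q0, hne0', hj0, rfl⟩ := exists_removeAt hne' hC hnext
    obtain ⟨P0, a, hi, hP0, hne0, hr0⟩ := exists_egIns_rev hP hne hr (j := j) (by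
      rw [← hlen, ← hlen, hC, List.length_append, List.length_singleton]
      omega)
    have hlen0 : ∀ c, (Q0.getD c []).length = (P0.getD c []).length := by
      intro c
      have := hlen c
      rw [getD_addAt hj0, hi.length_getD] at this
      split_ifs at this with h
      · simpa [h] using this
      · exact this
    have hQ0 : QTab Q0 :=
      ⟨fun i c q q' h h' => hQ.row i c q q' ((getElem?_addAt hj0).2 (Or.inl h))
        ((getElem?_addAt hj0).2 (Or.inl h')),
        fun i c q q' h h' => hQ.col i c q q' ((getElem?_addAt hj0).2 (Or.inl h))
        ((getElem?_addAt hj0).2 (Or.inl h'))⟩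
    obtain ⟨L, hL1, hL2, hL3⟩ := ih hP0 hne0 hr0.left hQ0 hne0' hlen0 (by
      have := hi.length_colRead
      rw [hm, List.length_append] at this
      simpa using this.symm)
    have hinv := egInv_egPair hL1
    rw [hL3] at hinv
    have hred : Red ((L ++ [(r, a)]).map Prod.snd) := by
      refine hr0.of_eq (fun x hx => ?_) (by simp [hinv.length_colRead]) (by simp [hinv.wordProd_eq])
      simp only [List.map_append, List.map_cons, List.map_nil, List.mem_append] at hx
      rcases hx with hx | hx
      · exact hL1.1 x hx
      · exact hr0.1 x (List.mem_append_right _ hx)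
    refine ⟨L ++ [(r, a)], hred, ?_, by rw [egPair_append, hL3, egStep_eq hi]⟩
    rcases List.eq_nil_or_concat L with rfl | ⟨L0, ⟨r0, a0⟩, rfl⟩
    · simp
    rw [List.concat_eq_append] at *
    refine List.isChain_append.2 ⟨hL2, by simp, ?_⟩
    simp only [List.getLast?_concat, Option.mem_def, Option.some.injEq, List.head?_cons,
      forall_eq']
    obtain ⟨j0, hj0', hi0, hQ0'⟩ := exists_egPair_append hL1
    rw [hL3] at hi0 hQ0'
    simp only at hi0 hQ0'
    have hr0Q : (Q0.getD j0 [])[((egPair L0).2.getD j0 []).length]? = some r0 := by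
      rw [hQ0', getElem?_addAt hj0']
      simp
    have hr0Q' := (getElem?_addAt (r := r) hj0).2 (Or.inl hr0Q)
    have hle := hrmax _ _ (List.mem_of_getElem? hr0Q')
    refine ⟨hle, fun ha => lt_of_le_of_ne hle ?_⟩
    rintro rfl
    have h1 := hi0.col_le_of_lt hi ha
    have h2 := hjmax _ (List.mem_of_getElem? hr0Q')
    have h3 : j0 = j := by omega
    subst h3
    have hlast : ((addAt Q0 j0 r0).getD j0 [])[(Q0.getD j0 []).length]? = some r0 := by
      rw [getElem?_addAt hj0]
      simp
    have h4 := lt_length_of_getElem? hr0Q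
    have hstep : ∀ d i q q', ((addAt Q0 j0 r0).getD j0 [])[i]? = some q →
        ((addAt Q0 j0 r0).getD j0 [])[i + d + 1]? = some q' → q < q' := by
      intro d
      induction d with
      | zero => exact fun i q q' h h' => hQ.col i j0 q q' h h'
      | succ d ihd =>
        intro i q q' h h'
        obtain ⟨s, hs⟩ := exists_above (i' := i + d + 1) (by omega) h'
        exact (ihd i q s h hs).trans (hQ.col _ _ _ _ hs h')
    obtain ⟨d, hd⟩ := Nat.exists_eq_add_of_lt h4
    rw [hd] at hlast
    exact lt_irrefl _ (hstep d _ _ _ hr0Q' hlast)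

/-- Bounds on the recorded letters translate to bounds on the recording tableau. -/
lemma entry_add_le {L : List (ℕ × ℕ)} (hr : Red (L.map Prod.snd)) (hc : L.IsChain CompatRel)
    (hle : ∀ p ∈ L, p.1 ≤ p.2) {i c q t : ℕ} (hq : ((egPair L).2.getD c [])[i]? = some q)
    (ht : ((egPair L).1.getD c [])[i]? = some t) : q + c ≤ t := by
  induction L using List.reverseRecOn generalizing i c q t with
  | nil => simp [egPair] at hq
  | append_singleton L p ih =>
    obtain ⟨r, a⟩ := p
    have hrL : Red (L.map Prod.snd) := Red.left (by simpa using hr)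
    obtain ⟨j, hj, hi, hQ⟩ := exists_egPair_append hr
    have hmax := ((qTab_egPair hr hc).2 L r a rfl j hi _ _ _ hq).1
    have hra : r ≤ a := hle (r, a) (by simp)
    rcases hi.entry_new ht with h | h
    · rw [hQ, getElem?_addAt hj] at hq
      rcases hq with hq | ⟨rfl, rfl, rfl⟩
      · exact ih hrL hc.left_of_append (fun p hp => hle p (by simp [hp])) hq h
      · have := lt_length_of_getElem? h
        rw [(egInv_egPair hrL).length_eq] at this
        omega
    · omega

/-- Later insertions of large letters only create large entries. -/
lemma egPair_append_entries {L L' : List (ℕ × ℕ)} (hr : Red ((L ++ L').map Prod.snd)) {M : ℕ}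
    (hM : ∀ p ∈ L', M ≤ p.2) :
    (∀ i c s : ℕ, ((egPair L).1.getD c [])[i]? = some s →
      ∃ t, ((egPair (L ++ L')).1.getD c [])[i]? = some t ∧ t ≤ s) ∧
    (∀ i c t : ℕ, ((egPair (L ++ L')).1.getD c [])[i]? = some t →
      ((egPair L).1.getD c [])[i]? = some t ∨ M + c ≤ t) ∧
    (∀ i c q : ℕ, ((egPair L).2.getD c [])[i]? = some q →
      ((egPair (L ++ L')).2.getD c [])[i]? = some q) := by
  induction L' using List.reverseRecOn with
  | nil =>
    rw [List.append_nil]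
    exact ⟨fun i c s h => ⟨s, h, le_rfl⟩, fun i c t h => Or.inl h, fun i c q h => h⟩
  | append_singleton L' p ih =>
    rw [← List.append_assoc] at *
    have hrL : Red ((L ++ L').map Prod.snd) := Red.left (by simpa using hr)
    obtain ⟨h1, h2, h3⟩ := ih hrL fun p hp => hM p (by simp [hp])
    obtain ⟨j, hj, hi, hQ⟩ := exists_egPair_append hr
    have hp : M ≤ p.2 := hM p (by simp)
    refine ⟨fun i c s hs => ?_, fun i c t ht => ?_, fun i c q hq => ?_⟩
    · obtain ⟨t, ht, hts⟩ := h1 i c s hs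
      obtain ⟨u, hu, hut⟩ := hi.entry_le ht
      exact ⟨u, hu, hut.trans hts⟩
    · rcases hi.entry_new ht with h | h
      · exact h2 i c t h
      · right; omega
    · rw [hQ, getElem?_addAt hj]
      exact Or.inl (h3 i c q hq)

/-- Bounds on the recording tableau translate to bounds on the recorded letters. -/
lemma le_of_entry_add_le {v : Perm'} (hav : Avoids2143 v) {L : List (ℕ × ℕ)}
    (hr : Red (L.map Prod.snd)) (hc : L.IsChain CompatRel) (hT : IsRotheTab v (egPair L).1)
    (hle : ∀ i c q t : ℕ, ((egPair L).2.getD c [])[i]? = some q →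
      ((egPair L).1.getD c [])[i]? = some t → q + c ≤ t) : ∀ p ∈ L, p.1 ≤ p.2 := by
  have key : ∀ L₂ L₁, L = L₁ ++ L₂ → ∀ p ∈ L₂, p.1 ≤ p.2 := by
    intro L₂
    induction L₂ with
    | nil => simp
    | cons p L₂ ih =>
      rintro L₁ rfl
      obtain ⟨R, m⟩ := p
      have hlater := ih (L₁ ++ [(R, m)]) (by simp)
      simp only [List.mem_cons, forall_eq_or_imp]
      refine ⟨?_, hlater⟩
      by_contra hm
      simp only [not_le] at hm
      have hM : ∀ p ∈ L₂, R + 1 ≤ p.2 := by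
        have hc2 := (List.isChain_append.1 hc).2.1
        cases L₂ with
        | nil => simp
        | cons p L₂ =>
          rw [List.isChain_cons_cons] at hc2
          obtain ⟨⟨h1, h2⟩, h3⟩ := hc2
          have h4 := hlater p (by simp)
          simp only at h1 h2
          have h5 : R < p.1 := h2 (by omega)
          have h6 : (p :: L₂).IsChain (fun p q => p.1 ≤ q.1) := h3.imp fun _ _ h => h.1
          have h7 : (p :: L₂).Pairwise (fun p q => p.1 ≤ q.1) :=
            (List.isChain_iff_pairwise (R := fun p q : ℕ × ℕ => p.1 ≤ q.1)).1 h6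
          intro q hq
          have h8 := hlater q hq
          rcases List.mem_cons.1 hq with rfl | hq
          · omega
          · have := (List.pairwise_cons.1 h7).1 q hq
            omega
      have heq : L₁ ++ (R, m) :: L₂ = L₁ ++ [(R, m)] ++ L₂ := by simp
      rw [heq] at hr hT hle
      have hr1 : Red ((L₁ ++ [(R, m)]).map Prod.snd) := by
        rw [List.map_append] at hr
        exact hr.left
      obtain ⟨e1, e2, e3⟩ := egPair_append_entries hr hM
      obtain ⟨j', hj', hi, hQ⟩ := exists_egPair_append hr1
      have hinv := egInv_egPair (L := L₁) (Red.left (by simpa using hr1))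
      have hlen := hinv.length_eq j'
      obtain ⟨t, ht⟩ : ∃ t, ((egPair (L₁ ++ [(R, m)])).1.getD j' [])[
          ((egPair L₁).1.getD j' []).length]? = some t :=
        ⟨_, List.getElem?_eq_getElem (by rw [hi.length_getD]; simp)⟩
      obtain ⟨t', ht', htt⟩ := e1 _ _ _ ht
      have hRt := hle _ _ R t' (e3 _ _ _ (by
        rw [hQ, getElem?_addAt hj']
        exact Or.inr ⟨rfl, hlen.symm, rfl⟩)) ht'
      obtain ⟨j, hjj, i, u, hii, hu, hur, hw⟩ := hi.exists_gap hinv.tab hm ht (by omega)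
      obtain ⟨u', hu', huu⟩ := e1 _ _ _ hu
      obtain ⟨x, hx, hxu⟩ := (hT.iff_boxAt _ _ _).1 hu'
      obtain ⟨x', hx', hxt⟩ := (hT.iff_boxAt _ _ _).1 ht'
      have hs := (hT.iff_boxAt _ _ _).2 ⟨_, hx.succ hav hx' hii (by omega), rfl⟩
      rcases e2 _ _ _ hs with h | h
      · have := hw _ h
        omega
      · omega
  exact key L [] rfl

/-- Every permutation of finite support is a product of simple transpositions. -/
lemma exists_word {v : Perm'} (h0 : v 0 = 0) {n : ℕ} (hn : ∀ m, n < m → v m = m) :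
    ∃ l : List ℕ, (∀ x ∈ l, 1 ≤ x) ∧ wordProd l = v := by
  induction n generalizing v with
  | zero =>
    refine ⟨[], by simp, ?_⟩
    ext k
    rcases Nat.eq_zero_or_pos k with rfl | hk
    · simp [h0]
    · simp [hn k hk]
  | succ n ih =>
    have h1 : 1 ≤ v (n + 1) := by
      rw [Nat.one_le_iff_ne_zero, ← h0]
      exact fun h => by have := v.injective h; omega
    have h2 : v (n + 1) ≤ n + 1 := by
      by_contra h
      have := v.injective (hn (v (n + 1)) (by omega))
      omega
    obtain ⟨l, -, hl2, hl3⟩ := exists_word_descProd (v (n + 1)) (n + 1 - v (n + 1))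
    obtain ⟨l', hl', he⟩ := ih (v := descProd (v (n + 1)) (n + 1 - v (n + 1)) * v)
      (by rw [Equiv.Perm.mul_apply, h0, descProd_apply, if_pos (by omega)]) (fun m hm => by
        rw [Equiv.Perm.mul_apply, descProd_apply]
        rcases (Nat.succ_le_of_lt hm).eq_or_lt with rfl | hm
        · simp only [Nat.succ_eq_add_one, lt_self_iff_false, if_false, if_true]
          omega
        · rw [hn m hm]
          split_ifs <;> omega)
    refine ⟨l.reverse ++ l', fun x hx => ?_, ?_⟩
    · rcases List.mem_append.1 hx with hx | hx
      · exact h1.trans (hl2 x (List.mem_reverse.1 hx))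
      · exact hl' x hx
    · rw [wordProd_append, wordProd_reverse, hl3, he]
      ext k
      simp

lemma exists_red {v : Perm'} (h0 : v 0 = 0) {n : ℕ} (hn : ∀ m, n < m → v m = m) :
    ∃ l : List ℕ, Red l ∧ wordProd l = v := by
  classical
  have hex : ∃ k, ∃ l : List ℕ, l.length = k ∧ (∀ x ∈ l, 1 ≤ x) ∧ wordProd l = v := by
    obtain ⟨l, h1, h2⟩ := exists_word h0 hn
    exact ⟨_, l, rfl, h1, h2⟩
  obtain ⟨l, h1, h2, h3⟩ := Nat.find_spec hex
  exact ⟨l, ⟨h2, fun l' h4 h5 => h1 ▸ Nat.find_min' hex ⟨l', rfl, h4, h5.trans h3⟩⟩, h3⟩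

lemma exists_isRotheTab {v : Perm'} (h0 : v 0 = 0) {n : ℕ} (hn : ∀ m, n < m → v m = m)
    (hav : Avoids2143 v) :
    ∃ T, IsRotheTab v T ∧ Red (colRead T) ∧ wordProd (colRead T) = v := by
  obtain ⟨l, hl, rfl⟩ := exists_red h0 hn
  have hmap : (l.map fun a => (0, a)).map Prod.snd = l := by simp
  have hinv := egInv_egPair (L := l.map fun a => (0, a)) (by rwa [hmap])
  have he := hinv.wordProd_eq
  rw [hmap] at he
  refine ⟨_, ⟨hinv.tab, hinv.ne_nil, ?_⟩, hinv.red, he⟩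
  rw [← he] at hav ⊢
  exact getElem?_iff_boxAt hinv.tab hinv.red hav

lemma IsRotheTab.unique {v : Perm'} {T T' : List (List ℕ)} (hT : IsRotheTab v T)
    (hT' : IsRotheTab v T') : T = T' :=
  ext_of_getElem? hT.ne_nil hT'.ne_nil fun i j =>
    Option.ext fun t => (hT.iff_boxAt i j t).trans (hT'.iff_boxAt i j t).symm

lemma isRotheTab_egPair {v : Perm'} (hav : Avoids2143 v) {L : List (ℕ × ℕ)}
    (hr : Red (L.map Prod.snd)) (hv : wordProd (L.map Prod.snd) = v) :
    IsRotheTab v (egPair L).1 := by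
  have hinv := egInv_egPair hr
  have he := hinv.wordProd_eq.trans hv
  refine ⟨hinv.tab, hinv.ne_nil, ?_⟩
  rw [← he] at hav ⊢
  exact getElem?_iff_boxAt hinv.tab hinv.red hav

/-! ### From columns to rows -/

/-- The columns of a Young diagram. -/
structure Shaped (Q : List (List ℕ)) : Prop where
  ne_nil : ∀ C ∈ Q, C ≠ []
  length_le : ∀ c, (Q.getD (c + 1) []).length ≤ (Q.getD c []).length

lemma Shaped.antitone {Q : List (List ℕ)} (h : Shaped Q) :
    Antitone fun c => (Q.getD c []).length :=
  antitone_nat_of_succ_le h.length_le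

lemma lt_foldr_max {l : List ℕ} {i : ℕ} : i < l.foldr max 0 ↔ ∃ x ∈ l, i < x := by
  induction l with
  | nil => simp
  | cons a l ih => simp [ih]

lemma getElem?_filterMap_getElem? {Q : List (List ℕ)}
    (h : ∀ c, (Q.getD (c + 1) []).length ≤ (Q.getD c []).length) (i j : ℕ) :
    (Q.filterMap fun C => C[i]?)[j]? = (Q.getD j [])[i]? := by
  induction Q generalizing j with
  | nil => simp
  | cons C Q ih =>
    rcases hC : C[i]? with _ | x
    · have hle : C.length ≤ i := by simpa using hC
      have hanti : Antitone fun c => ((C :: Q).getD c []).length := antitone_nat_of_succ_le h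
      have hlen : ∀ c, ((C :: Q).getD c []).length ≤ i := fun c =>
        (hanti (Nat.zero_le c)).trans (by simpa using hle)
      rw [List.getElem?_eq_none (hlen j), List.filterMap_eq_nil_iff.2 fun D hD => ?_]
      · simp
      · obtain ⟨c, hc, rfl⟩ := List.getElem_of_mem hD
        have := hlen c
        rw [List.getD_eq_getElem _ _ hc] at this
        exact List.getElem?_eq_none this
    · rw [List.filterMap_cons_some (f := fun C : List ℕ => C[i]?) hC]
      cases j with
      | zero => simp [hC]
      | succ j => simpa using ih (fun c => by simpa using h (c + 1)) j

lemma Shaped.getElem?_colsToRows {Q : List (List ℕ)} (h : Shaped Q) (i j : ℕ) :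
    ((colsToRows Q).getD i [])[j]? = (Q.getD j [])[i]? := by
  rcases lt_or_ge i ((Q.map List.length).foldr max 0) with hi | hi
  · rw [← getElem?_filterMap_getElem? h.length_le, colsToRows,
      List.getD_eq_getElem _ _ (by simpa using hi)]
    simp
  · rw [colsToRows, List.getD_eq_default _ _ (by simpa using hi), List.getElem?_nil, eq_comm,
      List.getElem?_eq_none_iff]
    rcases lt_or_ge j Q.length with hj | hj
    · rw [List.getD_eq_getElem _ _ hj]
      by_contra hlt
      exact absurd (lt_foldr_max.2 ⟨_, List.mem_map_of_mem (List.getElem_mem hj), not_le.1 hlt⟩)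
        (not_lt.2 hi)
    · rw [List.getD_eq_default _ _ hj]
      simp

lemma length_le_of_getElem? {l l' : List ℕ}
    (h : ∀ j q : ℕ, l[j]? = some q → ∃ q', l'[j]? = some q') :
    l.length ≤ l'.length := by
  by_contra hlt
  obtain ⟨q, hq⟩ := h l'.length _ (List.getElem?_eq_getElem (not_le.1 hlt))
  simp at hq

lemma Shaped.colsToRows {Q : List (List ℕ)} (h : Shaped Q) : Shaped (colsToRows Q) where
  ne_nil := by
    intro R hR
    obtain ⟨i, hi, rfl⟩ := List.mem_map.1 hR
    obtain ⟨x, hx, hix⟩ := lt_foldr_max.1 (List.mem_range.1 hi)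
    obtain ⟨C, hC, rfl⟩ := List.mem_map.1 hx
    exact List.ne_nil_of_mem (List.mem_filterMap.2 ⟨C, hC, List.getElem?_eq_getElem hix⟩)
  length_le i := length_le_of_getElem? fun j q hq => by
    rw [h.getElem?_colsToRows] at hq ⊢
    exact exists_above (Nat.le_succ i) hq

lemma Shaped.colsToRows_colsToRows {Q : List (List ℕ)} (h : Shaped Q) :
    BPDPaper.colsToRows (BPDPaper.colsToRows Q) = Q :=
  ext_of_getElem? h.colsToRows.colsToRows.ne_nil h.ne_nil fun i j => by
    rw [h.colsToRows.getElem?_colsToRows, h.getElem?_colsToRows]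

lemma Tab.shaped {P : List (List ℕ)} (h : Tab P) (hne : ∀ C ∈ P, C ≠ []) : Shaped P :=
  ⟨hne, fun c => (h.getD c).2.length_le⟩

/-! ### Shapes -/

lemma lt_countP_iff {l : List ℕ} (h : l.Pairwise (· ≥ ·)) (i j : ℕ) :
    i < l.countP (fun x => j < x) ↔ j < l.getD i 0 := by
  induction l generalizing i with
  | nil => simp
  | cons a l ih =>
    rw [List.pairwise_cons] at h
    by_cases ha : j < a
    · rw [List.countP_cons_of_pos (by simpa using ha)]
      cases i with
      | zero => simpa using ha
      | succ i => simpa using ih h.2 i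
    · rw [List.countP_eq_zero.2 fun x hx => ?_]
      · simp only [not_lt_zero, false_iff, not_lt]
        rcases lt_or_ge i (a :: l).length with hi | hi
        · rw [List.getD_eq_getElem _ _ hi]
          rcases List.mem_cons.1 (List.getElem_mem hi) with he | he
          · omega
          · have := h.1 _ he
            omega
        · rw [List.getD_eq_default _ _ hi]
          omega
      · rcases List.mem_cons.1 hx with rfl | hx
        · simpa using ha
        · have := h.1 _ hx
          simp only [decide_eq_true_eq]
          omega

lemma eq_of_countP_eq {l l' : List ℕ} (h : l.Pairwise (· ≥ ·)) (h' : l'.Pairwise (· ≥ ·))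
    (hpos : ∀ x ∈ l, 0 < x) (hpos' : ∀ x ∈ l', 0 < x)
    (heq : ∀ j, l.countP (fun x => j < x) = l'.countP fun x => j < x) : l = l' := by
  have hlen : l.length = l'.length := by
    have := heq 0
    rwa [List.countP_eq_length.2 (by simpa using hpos),
      List.countP_eq_length.2 (by simpa using hpos')] at this
  refine List.ext_getElem hlen fun i h1 h2 => ?_
  rw [← List.getD_eq_getElem _ 0 h1, ← List.getD_eq_getElem _ 0 h2]
  refine eq_of_forall_lt_iff fun j => ?_
  rw [← lt_countP_iff h, ← lt_countP_iff h', heq]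

lemma perm_insDesc (x : ℕ) (l : List ℕ) : (insDesc x l).Perm (x :: l) := by
  induction l with
  | nil => simp [insDesc]
  | cons y l ih =>
    rw [insDesc]
    split_ifs
    · exact List.Perm.refl _
    · exact (ih.cons y).trans (List.Perm.swap x y l)

lemma pairwise_insDesc (x : ℕ) {l : List ℕ} (h : l.Pairwise (· ≥ ·)) :
    (insDesc x l).Pairwise (· ≥ ·) := by
  induction l with
  | nil => simp [insDesc]
  | cons y l ih =>
    rw [insDesc]
    split_ifs with hx
    · refine List.pairwise_cons.2 ⟨fun z hz => ?_, h⟩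
      rcases List.mem_cons.1 hz with rfl | hz
      · exact hx.le
      · exact ((List.pairwise_cons.1 h).1 z hz).trans hx.le
    · rw [List.pairwise_cons] at h
      refine List.pairwise_cons.2 ⟨fun z hz => ?_, ih h.2⟩
      rcases List.mem_cons.1 ((perm_insDesc x l).mem_iff.1 hz) with rfl | hz
      · exact not_lt.1 hx
      · exact h.1 z hz

lemma perm_sortDesc (l : List ℕ) : (sortDesc l).Perm l := by
  induction l with
  | nil => exact List.Perm.refl _
  | cons x l ih => exact (perm_insDesc x _).trans (ih.cons x)

lemma pairwise_sortDesc (l : List ℕ) : (sortDesc l).Pairwise (· ≥ ·) := by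
  induction l with
  | nil => exact List.Pairwise.nil
  | cons x l ih => exact pairwise_insDesc x ih

lemma pairwise_shapeOf (v : Perm') (n : ℕ) : (shapeOf v n).Pairwise (· ≥ ·) :=
  (pairwise_sortDesc _).filter _

lemma pos_of_mem_shapeOf {v : Perm'} {n x : ℕ} (h : x ∈ shapeOf v n) : 0 < x := by
  simpa using (List.mem_filter.1 h).2

lemma countP_shapeOf (v : Perm') (n j : ℕ) :
    (shapeOf v n).countP (fun x => j < x) =
      (List.range' 1 n).countP fun x => j < codeOf v x := by
  rw [shapeOf, List.countP_filter, (perm_sortDesc _).countP_eq, List.countP_map]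
  refine List.countP_congr fun x _ => ?_
  simp only [Function.comp_apply, Bool.and_eq_true, decide_eq_true_eq]
  omega

lemma Shaped.pairwise_map_length {R : List (List ℕ)} (h : Shaped R) :
    (R.map List.length).Pairwise (· ≥ ·) := by
  rw [List.pairwise_iff_getElem]
  intro i j hi hj hij
  have := h.antitone hij.le
  simp only [List.length_map] at hi hj
  simp only [List.getD_eq_getElem _ _ hi, List.getD_eq_getElem _ _ hj] at this
  simpa using this

lemma Shaped.countP_map_length {Q : List (List ℕ)} (h : Shaped Q) (j : ℕ) :
    ((BPDPaper.colsToRows Q).map List.length).countP (fun x => j < x) = (Q.getD j []).length := by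
  refine eq_of_forall_lt_iff fun i => ?_
  rw [lt_countP_iff h.colsToRows.pairwise_map_length,
    show (0 : ℕ) = ([] : List ℕ).length from rfl, List.getD_map]
  rw [← not_le, ← not_le, ← List.getElem?_eq_none_iff, ← List.getElem?_eq_none_iff,
    h.getElem?_colsToRows]

lemma Shaped.map_length_eq_iff {Q : List (List ℕ)} (h : Shaped Q) (v : Perm') (n : ℕ) :
    (BPDPaper.colsToRows Q).map List.length = shapeOf v n ↔
      ∀ j, (Q.getD j []).length = (List.range' 1 n).countP fun x => j < codeOf v x := by
  constructor
  · intro he j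
    rw [← h.countP_map_length, he, countP_shapeOf]
  · intro he
    refine eq_of_countP_eq h.colsToRows.pairwise_map_length (pairwise_shapeOf v n) ?_
      (fun x hx => pos_of_mem_shapeOf hx) fun j => ?_
    · intro x hx
      obtain ⟨C, hC, rfl⟩ := List.mem_map.1 hx
      exact List.length_pos_of_ne_nil (h.colsToRows.ne_nil C hC)
    · rw [h.countP_map_length, he, countP_shapeOf]

/-! ### Flagged tableaux -/

lemma Shaped.of_isSSYT {R : List (List ℕ)} (h : IsSSYT R) : Shaped R := by
  refine ⟨h.1, fun c => ?_⟩
  rcases lt_or_ge (c + 1) R.length with hc | hc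
  · rw [List.getD_eq_getElem _ _ hc, List.getD_eq_getElem _ _ (by omega)]
    exact List.isChain_iff_getElem.1 h.2.1 c hc
  · rw [List.getD_eq_default _ _ hc]
    simp

lemma Shaped.isSSYT_iff {Q : List (List ℕ)} (h : Shaped Q) :
    IsSSYT (BPDPaper.colsToRows Q) ↔ QTab Q := by
  have hR := h.colsToRows
  constructor
  · rintro ⟨-, -, h3, h4⟩
    refine ⟨fun i j q q' hq hq' => ?_, fun i j q q' hq hq' => ?_⟩
    · rw [← h.getElem?_colsToRows] at hq hq'
      have hi : i < (BPDPaper.colsToRows Q).length := by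
        by_contra hi
        rw [List.getD_eq_default _ _ (not_lt.1 hi)] at hq
        simp at hq
      rw [List.getD_eq_getElem _ _ hi] at hq hq'
      have := List.isChain_iff_getElem.1 (h3 _ (List.getElem_mem hi)) j (lt_length_of_getElem? hq')
      rwa [(List.getElem?_eq_some_iff.1 hq).2, (List.getElem?_eq_some_iff.1 hq').2] at this
    · rw [← h.getElem?_colsToRows] at hq hq'
      have hi : i + 1 < (BPDPaper.colsToRows Q).length := by
        by_contra hi
        rw [List.getD_eq_default _ _ (not_lt.1 hi)] at hq'
        simp at hq'
      have := h4 i j hi (lt_length_of_getElem? hq')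
      rwa [List.getD_eq_getElem?_getD, hq, List.getD_eq_getElem?_getD, hq'] at this
  · intro hQ
    refine ⟨hR.ne_nil, List.isChain_iff_getElem.2 fun c hc => ?_, fun R hRm => ?_,
      fun i j hi hj => ?_⟩
    · have := hR.length_le c
      rwa [List.getD_eq_getElem _ _ hc, List.getD_eq_getElem _ _ (by omega)] at this
    · obtain ⟨i, hi, rfl⟩ := List.getElem_of_mem hRm
      refine List.isChain_iff_getElem.2 fun j hj => hQ.row i j _ _ ?_ ?_ <;>
      · rw [← h.getElem?_colsToRows, List.getD_eq_getElem _ _ hi]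
        exact List.getElem?_eq_getElem _
    · have hj' : j < ((BPDPaper.colsToRows Q).getD i []).length := hj.trans_le (hR.length_le i)
      rw [List.getD_eq_getElem _ _ hj, List.getD_eq_getElem _ _ hj']
      refine hQ.col i j _ _ ?_ ?_ <;>
      · rw [← h.getElem?_colsToRows]
        exact List.getElem?_eq_getElem _

lemma getD_flagOf {v : Perm'} {n i : ℕ} (hi : i < (shapeOf v n).length) :
    (flagOf v n).getD i 0 = flagEntry v (i + 1) ((shapeOf v n).getD i 0) := by
  rw [flagOf, List.getD_eq_getElem _ _ (by simpa using hi)]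
  simp

lemma isFlaggedSSYT_iff {v : Perm'} (h0 : v 0 = 0) {n : ℕ} (hn : ∀ m, n < m → v m = m)
    {T Q : List (List ℕ)} (hT : IsRotheTab v T) (hQ : Shaped Q) :
    IsFlaggedSSYT (shapeOf v n) (flagOf v n) (colsToRows Q) ↔
      QTab Q ∧ (∀ j, (Q.getD j []).length = (T.getD j []).length) ∧
        ∀ i j q t : ℕ, (Q.getD j [])[i]? = some q → (T.getD j [])[i]? = some t →
          (T.getD (j + 1) [])[i]? = none → q + j ≤ t := by
  rw [IsFlaggedSSYT, hQ.isSSYT_iff, hQ.map_length_eq_iff]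
  refine and_congr_right fun hQT => ?_
  simp only [hT.length_column h0 hn]
  refine and_congr_right fun hlen => ?_
  have hshape := (hQ.map_length_eq_iff v n).2 hlen
  have hlenT : ∀ j, (Q.getD j []).length = (T.getD j []).length := fun j => by
    rw [hlen, hT.length_column h0 hn]
  have hflag : ∀ i, i < (colsToRows Q).length →
      (flagOf v n).getD i 0 = flagEntry v (i + 1) ((colsToRows Q).getD i []).length := by
    intro i hi
    rw [getD_flagOf (by simpa [← hshape] using hi), ← hshape,
      show (0 : ℕ) = ([] : List ℕ).length from rfl, List.getD_map]
  constructor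
  · intro h i j q t hq ht hend
    have hend' : (Q.getD (j + 1) [])[i]? = none := by
      rw [List.getElem?_eq_none_iff] at hend ⊢
      rwa [hlenT]
    rw [← hQ.getElem?_colsToRows] at hq hend'
    have hi : i < (colsToRows Q).length := by
      by_contra hi
      rw [List.getD_eq_default _ _ (not_lt.1 hi)] at hq
      simp at hq
    have hj := lt_length_of_getElem? hq
    have hrow : ((colsToRows Q).getD i []).length = j + 1 := by
      have := List.getElem?_eq_none_iff.1 hend'
      omega
    have hle := h i hi
    rw [hflag i hi, hrow, List.getLastD_eq_getLast?, List.getLast?_eq_getElem?, hrow,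
      Nat.add_sub_cancel, hq, Option.getD_some] at hle
    have := hT.flagEntry_eq h0 ht hend
    omega
  · intro h i hi
    have hne : ((colsToRows Q).getD i []) ≠ [] := by
      rw [List.getD_eq_getElem _ _ hi]
      exact hQ.colsToRows.ne_nil _ (List.getElem_mem hi)
    obtain ⟨j, hj⟩ := Nat.exists_eq_add_one_of_ne_zero (List.length_pos_of_ne_nil hne).ne'
    have hq := List.getElem?_eq_getElem (show j < ((colsToRows Q).getD i []).length by omega)
    have hend := List.getElem?_eq_none (show ((colsToRows Q).getD i []).length ≤ j + 1 by omega)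
    have hq' := hq
    rw [hQ.getElem?_colsToRows] at hq' hend
    have hjT := lt_length_of_getElem? hq'
    rw [hlenT] at hjT
    rw [List.getElem?_eq_none_iff, hlenT, ← List.getElem?_eq_none_iff] at hend
    have hle := h i j _ _ hq' (List.getElem?_eq_getElem hjT) hend
    have := hT.flagEntry_eq h0 (List.getElem?_eq_getElem hjT) hend
    rw [hflag i hi, hj, List.getLastD_eq_getLast?, List.getLast?_eq_getElem?, hj,
      Nat.add_sub_cancel, hq, Option.getD_some]
    omega

/-! ### Compatible sequences -/

lemma isCompatible_iff {v : Perm'} {P : Biword} :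
    IsCompatible v P ↔ ∃ L : List (ℕ × ℕ), P = ⟨L.map Prod.fst, L.map Prod.snd⟩ ∧
      Red (L.map Prod.snd) ∧ wordProd (L.map Prod.snd) = v ∧ L.IsChain CompatRel ∧
        ∀ p ∈ L, p.1 ≤ p.2 := by
  constructor
  · rintro ⟨h1, h2, h3, h4⟩
    have hlen := h3.length_eq
    obtain ⟨top, bot⟩ := P
    simp only at h1 h2 h3 h4 hlen
    have htop : (top.zip bot).map Prod.fst = top := List.map_fst_zip hlen.le
    have hbot : (top.zip bot).map Prod.snd = bot := List.map_snd_zip hlen.ge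
    rw [isReducedWord_iff] at h1
    refine ⟨top.zip bot, by rw [htop, hbot], by rw [hbot]; exact h1.1, by rw [hbot]; exact h1.2,
      List.isChain_iff_getElem.2 fun i hi => ?_, fun p hp => (List.forall₂_iff_zip.1 h3).2 hp⟩
    simp only [List.length_zip] at hi
    have h5 := List.isChain_iff_getElem.1 h2 i (by omega)
    have h6 := h4 i (by omega)
    rw [List.getD_eq_getElem _ _ (show i < bot.length by omega),
      List.getD_eq_getElem _ _ (show i + 1 < bot.length by omega),
      List.getD_eq_getElem _ _ (show i < top.length by omega),
      List.getD_eq_getElem _ _ (show i + 1 < top.length by omega)] at h6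
    simpa [CompatRel] using And.intro h5 h6
  · rintro ⟨L, rfl, h1, h2, h3, h4⟩
    refine ⟨isReducedWord_iff.2 ⟨h1, h2⟩, ?_, ?_, fun m hm => ?_⟩
    · exact (List.isChain_map _).2 (h3.imp fun _ _ h => h.1)
    · rw [List.forall₂_map_left_iff, List.forall₂_map_right_iff, List.forall₂_same]
      exact h4
    · simp only [List.length_map] at hm
      have := (List.isChain_iff_getElem.1 h3 m hm).2
      simpa [List.getD_eq_getElem?_getD, List.getElem?_eq_getElem hm,
        List.getElem?_eq_getElem (Nat.lt_of_succ_lt hm)] using this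

lemma qtilde_mk (L : List (ℕ × ℕ)) :
    Qtilde ⟨L.map Prod.fst, L.map Prod.snd⟩ = colsToRows (egPair L).2 := by
  rw [Qtilde, egPQ, egPair]
  simp only [List.zip_map', List.map_id']

lemma EGInv.shaped {L : List (ℕ × ℕ)} {P Q : List (List ℕ)} (h : EGInv L P Q) : Shaped Q :=
  ⟨h.ne_nil', fun c => by
    rw [h.length_eq, h.length_eq]
    exact (h.tab.getD c).2.length_le⟩

/-- **Lenart's bijection.** For `v` vexillary, the Edelman–Greene
recording-tableau map `Q̃` is a bijection from `PD(v)` onto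
`SSYT_{φ(v)}(λ(v))`, the `φ(v)`-flagged semistandard Young tableaux of shape `λ(v)`. -/
theorem stmt2 (v : Perm') (hv : Vexillary v) (n : ℕ) (hn : ∀ m, n < m → v m = m) :
    Set.BijOn Qtilde {P : Biword | IsCompatible v P}
      {T : List (List ℕ) | IsFlaggedSSYT (shapeOf v n) (flagOf v n) T} := by
  have h0 : v 0 = 0 := hv.1.1
  have hav : Avoids2143 v := hv.2
  refine ⟨fun P hP => ?_, fun P hP P' hP' heq => ?_, fun R hR => ?_⟩
  · obtain ⟨L, rfl, hr, hw, hc, hle⟩ := isCompatible_iff.1 hP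
    have hinv := egInv_egPair hr
    rw [Set.mem_ofPred_eq, qtilde_mk,
      isFlaggedSSYT_iff h0 hn (isRotheTab_egPair hav hr hw) hinv.shaped]
    exact ⟨(qTab_egPair hr hc).1, hinv.length_eq,
      fun i j q t hq ht _ => entry_add_le hr hc hle hq ht⟩
  · obtain ⟨L, rfl, hr, hw, hc, hle⟩ := isCompatible_iff.1 hP
    obtain ⟨L', rfl, hr', hw', hc', hle'⟩ := isCompatible_iff.1 hP'
    rw [qtilde_mk, qtilde_mk] at heq
    have hQ := congrArg colsToRows heq
    rw [(egInv_egPair hr).shaped.colsToRows_colsToRows,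
      (egInv_egPair hr').shaped.colsToRows_colsToRows] at hQ
    have hP := (isRotheTab_egPair hav hr hw).unique (isRotheTab_egPair hav hr' hw')
    rw [egPair_injective hr hc hr' hc' (Prod.ext hP hQ)]
  · have hRs := Shaped.of_isSSYT hR.1
    obtain ⟨T, hT, hTr, hTw⟩ := exists_isRotheTab h0 hn hav
    rw [Set.mem_ofPred_eq, ← hRs.colsToRows_colsToRows,
      isFlaggedSSYT_iff h0 hn hT hRs.colsToRows] at hR
    obtain ⟨hQ, hlen, hend⟩ := hR
    obtain ⟨L, hr, hc, he⟩ := exists_egPair_eq hT.tab hT.ne_nil hTr hQ hRs.colsToRows.ne_nil hlen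
    have hinv := egInv_egPair hr
    have hle := le_of_entry_add_le hav hr hc (by rwa [he]) (by
      rw [he]
      exact fun i c q t hq ht => hQ.entry_le hav hT hlen hend hq ht)
    refine ⟨⟨L.map Prod.fst, L.map Prod.snd⟩, isCompatible_iff.2 ⟨L, rfl, hr, ?_, hc, hle⟩, ?_⟩
    · rw [← hinv.wordProd_eq, he, hTw]
    · rw [qtilde_mk, he, hRs.colsToRows_colsToRows]

end BPDPaper
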